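/- Let 1 ≤ k < n and let D be an origin-symmetric star body in ℝⁿ. Then D is a k-intersection body if and only if the normed (or quasi-normed) space (ℝⁿ, ‖·‖_D) embeds in L_{−k}. -/

import Mathlib

open MeasureTheory Metric Module
open scoped ENNReal FourierTransform RealInnerProductSpace Pointwise

noncomputable section

/-- `ℝⁿ` with its Euclidean structure. -/
abbrev Euc (n : ℕ) : Type := EuclideanSpace ℝ (Fin n)

/-- The radial function of a star body: the reciprocal of the Minkowski functional (gauge). -/
def radialFn {n : ℕ} (K : Set (Euc n)) (x : Euc n) : ℝ := (gauge K x)⁻¹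

/-- A star body: compact, the origin is interior, the Minkowski functional is continuous and
positive off the origin, and `K` is the unit ball of its Minkowski functional. -/
def IsStarBody {n : ℕ} (K : Set (Euc n)) : Prop :=
  IsCompact K ∧ (0 : Euc n) ∈ interior K ∧ Continuous (gauge K) ∧
    (∀ x : Euc n, x ≠ 0 → gauge K x ≠ 0) ∧ K = {x : Euc n | gauge K x ≤ 1}

/-- The Grassmannian of `d`-dimensional linear subspaces of `ℝⁿ`. -/
def Gr (n d : ℕ) : Type := {H : Submodule ℝ (Euc n) // finrank ℝ H = d}

/-- The spherical Radon transform `R_{d} g (H) = ∫_{S^{n-1} ∩ H} g`, the integral being with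
respect to the `(d-1)`-dimensional Hausdorff measure on the sphere of the `d`-dimensional
subspace `H`. -/
def sphRadon (n d : ℕ) (g : Euc n → ℝ) (H : Gr n d) : ℝ :=
  ∫ x in sphere (0 : Euc n) 1 ∩ (H.1 : Set (Euc n)), g x ∂μH[(d : ℝ) - 1]

/-- A generalized `m`-intersection body: an origin-symmetric star body `K` such that there is a
positive continuous (= bounded) linear functional `ν` on the range of the spherical Radon
transform `R_{n-m}` with `∫_{S^{n-1}} ‖x‖_K^{-m} g(x) dx = ν (R_{n-m} g)` for all continuous
`g`. -/
def IsGenIntBody (n m : ℕ) (K : Set (Euc n)) : Prop :=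
  IsStarBody K ∧ K = -K ∧
    ∃ ν : (Gr n (n - m) → ℝ) → ℝ,
      (∀ g₁ g₂ : Euc n → ℝ, Continuous g₁ → Continuous g₂ →
        ν (sphRadon n (n - m) (g₁ + g₂)) =
          ν (sphRadon n (n - m) g₁) + ν (sphRadon n (n - m) g₂)) ∧
      (∀ (c : ℝ) (g : Euc n → ℝ), Continuous g →
        ν (sphRadon n (n - m) (c • g)) = c * ν (sphRadon n (n - m) g)) ∧
      (∀ g : Euc n → ℝ, Continuous g → (∀ H, 0 ≤ sphRadon n (n - m) g H) →
        0 ≤ ν (sphRadon n (n - m) g)) ∧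
      (∃ C : ℝ, ∀ g : Euc n → ℝ, Continuous g →
        |ν (sphRadon n (n - m) g)| ≤ C * ⨆ H : Gr n (n - m), |sphRadon n (n - m) g H|) ∧
      (∀ g : Euc n → ℝ, Continuous g →
        (∫ x in sphere (0 : Euc n) 1, radialFn K x ^ m * g x ∂μH[(n : ℝ) - 1]) =
          ν (sphRadon n (n - m) g))

/-- `D` is the `k`-intersection body of `L`: `|D ∩ H^⊥| = |L ∩ H|` for every
`(n-k)`-dimensional subspace `H`. -/
def IsKIntBodyOf (n k : ℕ) (D L : Set (Euc n)) : Prop :=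
  ∀ H : Submodule ℝ (Euc n), finrank ℝ H = n - k →
    μH[(k : ℝ)] ((Hᗮ : Set (Euc n)) ∩ D) = μH[((n - k : ℕ) : ℝ)] ((H : Set (Euc n)) ∩ L)

/-- The class of `k`-intersection bodies: the closure in the radial metric of the class of
`k`-intersection bodies of star bodies. -/
def IsKIntBody (n k : ℕ) (D : Set (Euc n)) : Prop :=
  IsStarBody D ∧ ∀ ε : ℝ, 0 < ε → ∃ D' L : Set (Euc n),
    IsStarBody D' ∧ IsStarBody L ∧ IsKIntBodyOf n k D' L ∧
    ∀ ξ ∈ sphere (0 : Euc n) 1, |radialFn D ξ - radialFn D' ξ| ≤ ε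

/-- `K` is the intersection body of the star body `L` (Lutwak): the radius of `K` in every
direction equals the `(n-1)`-dimensional volume of the central hyperplane section of `L`
perpendicular to that direction. -/
def IsIntBodyOfStar (n : ℕ) (K L : Set (Euc n)) : Prop :=
  K = -K ∧ L = -L ∧ ∀ ξ ∈ sphere (0 : Euc n) 1,
    radialFn K ξ = (μH[((n - 1 : ℕ) : ℝ)] (((ℝ ∙ ξ)ᗮ : Set (Euc n)) ∩ L)).toReal

/-- The class of intersection bodies: the closure in the radial metric of the class of
intersection bodies of star bodies. -/
def IsIntersectionBody (n : ℕ) (K : Set (Euc n)) : Prop :=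
  IsStarBody K ∧ ∀ ε : ℝ, 0 < ε → ∃ K' L : Set (Euc n),
    IsStarBody K' ∧ IsStarBody L ∧ IsIntBodyOfStar n K' L ∧
    ∀ ξ ∈ sphere (0 : Euc n) 1, |radialFn K ξ - radialFn K' ξ| ≤ ε

/-- Geometric distance between star bodies. -/
def geomDist {n : ℕ} (K L : Set (Euc n)) : ℝ :=
  sInf {r : ℝ | 0 < r ∧ ∃ a : ℝ, 0 < a ∧ K ⊆ a • L ∧ a • L ⊆ r • K}

/-- Banach–Mazur distance. -/
def bmDist {n : ℕ} (K L : Set (Euc n)) : ℝ :=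
  ⨅ T : Euc n ≃ₗ[ℝ] Euc n, geomDist K (T '' L)

/-- Banach–Mazur distance from a body to a class of bodies. -/
def bmDistClass {n : ℕ} (L : Set (Euc n)) (P : Set (Euc n) → Prop) : ℝ :=
  sInf {r : ℝ | ∃ K, P K ∧ r = bmDist L K}

/-- Volume of the unit Euclidean ball `B_2^k` in `ℝ^k`. -/
def ballVol (k : ℕ) : ℝ := (volume (ball (0 : Euc k) 1)).toReal

/-- The constant `c_{n,m} = |B_2^n|^{(n-m)/n} / |B_2^{n-m}|`. -/
def cnm (n m : ℕ) : ℝ := ballVol n ^ (((n : ℝ) - m) / n) / ballVol (n - m)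

/-- The space `(ℝⁿ, N)` embeds in `L_{-p}`, `0 < p < n`. -/
def EmbedsInLNeg (n : ℕ) (p : ℝ) (N : Euc n → ℝ) : Prop :=
  ∃ μ : Measure (sphere (0 : Euc n) 1), IsFiniteMeasure μ ∧
    ∀ φ : SchwartzMap (Euc n) ℂ, (∀ x, φ (-x) = φ x) →
      (∫ x : Euc n, (N x ^ (-p)) • φ x) =
        ∫ θ : sphere (0 : Euc n) 1,
          (∫ t : ℝ, |t| ^ (p - 1) • 𝓕 (⇑φ) (t • (θ : Euc n))) ∂μ

/-- The space `(ℝⁿ, N)` embeds in `L_q`, `q > 0`: Lévy's representation of the norm. -/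
def EmbedsInLPos (n : ℕ) (q : ℝ) (N : Euc n → ℝ) : Prop :=
  ∃ μ : Measure (sphere (0 : Euc n) 1), IsFiniteMeasure μ ∧
    ∀ x : Euc n, N x ^ q = ∫ ξ : sphere (0 : Euc n) 1, |⟪x, (ξ : Euc n)⟫| ^ q ∂μ

/-- Embedding in `L_p` for `p ≠ 0` of either sign. -/
def EmbedsInL (n : ℕ) (p : ℝ) (N : Euc n → ℝ) : Prop :=
  if 0 < p then EmbedsInLPos n p N else EmbedsInLNeg n (-p) N

/-- `N` is a norm on `ℝⁿ`. -/
def IsNormOn (n : ℕ) (N : Euc n → ℝ) : Prop :=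
  (∀ x : Euc n, N x = 0 ↔ x = 0) ∧
  (∀ (c : ℝ) (x : Euc n), N (c • x) = |c| * N x) ∧
  (∀ x y : Euc n, N (x + y) ≤ N x + N y)

/-- The `L_p([0,1])` (quasi-)norm of an a.e.-equivalence class of functions on `[0,1]`. -/
def lpNormIcc (p : ℝ) (f : ℝ →ₘ[volume.restrict (Set.Icc (0 : ℝ) 1)] ℝ) : ℝ :=
  (eLpNorm f (ENNReal.ofReal p) (volume.restrict (Set.Icc (0 : ℝ) 1))).toReal

/-- `L` is the unit ball of an `n`-dimensional subspace of `L_p([0,1])`: there is an injective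
linear map `T` from `ℝⁿ` to (equivalence classes of) functions on `[0,1]` and `L` is the unit
ball of the norm `x ↦ ‖T x‖_p`. -/
def IsUnitBallOfLpSubspace (n : ℕ) (p : ℝ) (L : Set (Euc n)) : Prop :=
  ∃ T : Euc n →ₗ[ℝ] (ℝ →ₘ[volume.restrict (Set.Icc (0 : ℝ) 1)] ℝ),
    Function.Injective T ∧ L = {x : Euc n | lpNormIcc p (T x) ≤ 1}

namespace KInt

set_option linter.unusedSectionVars false

/-- The orthogonal group of a finite-dimensional inner product space. -/
abbrev Orth (V : Type*) [NormedAddCommGroup V] [InnerProductSpace ℝ V] [FiniteDimensional ℝ V] :=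
  unitary (V →L[ℝ] V)

section Orth

variable {V : Type*} [NormedAddCommGroup V] [InnerProductSpace ℝ V] [FiniteDimensional ℝ V]

instance : CompactSpace (Orth V) := by
  refine isCompact_iff_compactSpace.mp ?_
  refine Metric.isCompact_of_isClosed_isBounded (isClosed_unitary) ?_
  refine (Metric.isBounded_closedBall (x := (0 : V →L[ℝ] V)) (r := 1)).subset ?_
  intro U hU
  rw [mem_closedBall_zero_iff]
  refine ContinuousLinearMap.opNorm_le_bound _ zero_le_one fun x => ?_
  rw [one_mul]
  exact (Unitary.norm_map ⟨U, hU⟩ x).le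

instance : SecondCountableTopology (Orth V) := by infer_instance

instance : MeasurableSpace (Orth V) := borel _
instance : BorelSpace (Orth V) := ⟨rfl⟩

def haar (V : Type*) [NormedAddCommGroup V] [InnerProductSpace ℝ V] [FiniteDimensional ℝ V] : Measure (Orth V) :=
  Measure.haarMeasure ⊤

instance : (haar V).IsHaarMeasure := by unfold haar; infer_instance
instance : IsProbabilityMeasure (haar V) := ⟨by
  simpa [haar] using Measure.haarMeasure_self (K₀ := (⊤ : TopologicalSpace.PositiveCompacts (Orth V)))⟩

instance : (haar V).IsMulRightInvariant := ⟨fun g => by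
  have : IsProbabilityMeasure (Measure.map (fun x => x * g) (haar V)) :=
    Measure.isProbabilityMeasure_map (by fun_prop)
  have := Measure.isHaarMeasure_map_mul_right (haar V) g
  exact Measure.isHaarMeasure_eq_of_isProbabilityMeasure _ _⟩

theorem continuous_act : Continuous fun p : Orth V × V => (p.1 : V →L[ℝ] V) p.2 := by fun_prop

theorem exists_orth_apply_eq {x y : V} (h : ‖x‖ = ‖y‖) : ∃ U : Orth V, (U : V →L[ℝ] V) x = y :=
  ⟨Unitary.linearIsometryEquiv.symm (Submodule.reflection (ℝ ∙ (x - y))ᗮ), by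
    simpa using Submodule.reflection_sub h⟩

theorem orth_comp (U W : Orth V) (x : V) :
    ((U * W : Orth V) : V →L[ℝ] V) x = (U : V →L[ℝ] V) ((W : V →L[ℝ] V) x) := rfl

theorem orth_ne_zero (U : Orth V) {x : V} (hx : x ≠ 0) : (U : V →L[ℝ] V) x ≠ 0 := by
  rw [← norm_ne_zero_iff, Unitary.norm_map]; exact norm_ne_zero_iff.2 hx

/-- Average of a function over the orthogonal group. -/
def avg (f : V → ℝ) (x : V) : ℝ := ∫ U : Orth V, f ((U : V →L[ℝ] V) x) ∂haar V

theorem avg_congr_norm (f : V → ℝ) {x y : V} (h : ‖x‖ = ‖y‖) : avg f x = avg f y := by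
  obtain ⟨W, rfl⟩ := exists_orth_apply_eq h
  unfold avg
  exact (integral_mul_right_eq_self (fun U : Orth V => f ((U : V →L[ℝ] V) x)) W).symm

section Measure
variable [MeasurableSpace V] [BorelSpace V]

theorem measurePreserving_orth (U : Orth V) :
    MeasurePreserving (fun x => (U : V →L[ℝ] V) x) (volume : Measure V) volume :=
  (Unitary.linearIsometryEquiv U).measurePreserving

theorem measurePreserving_act :
    MeasurePreserving (fun p : Orth V × V => (p.1, (p.1 : V →L[ℝ] V) p.2))
      ((haar V).prod volume) ((haar V).prod volume) :=
  (MeasurePreserving.id (haar V)).skew_product (g := fun U x => (U : V →L[ℝ] V) x)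
    continuous_act.measurable (.of_forall fun U => (measurePreserving_orth U).map_eq)

theorem integrable_act {f : V → ℝ} (hf : Integrable f) :
    Integrable (fun p : Orth V × V => f ((p.1 : V →L[ℝ] V) p.2)) ((haar V).prod volume) :=
  measurePreserving_act.integrable_comp_of_integrable (hf.comp_snd (haar V))

theorem integral_avg {f : V → ℝ} (hf : Integrable f) : ∫ x, avg f x = ∫ x, f x := by
  unfold avg
  rw [← integral_integral_swap (integrable_act hf)]
  have (U : Orth V) : ∫ x, f ((U : V →L[ℝ] V) x) = ∫ x, f x :=
    (Unitary.linearIsometryEquiv U).measurePreserving.integral_comp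
      (Unitary.linearIsometryEquiv U).toHomeomorph.measurableEmbedding f
  simp [this]

end Measure
end Orth

section PosHom

variable {V : Type*} [NormedAddCommGroup V] [InnerProductSpace ℝ V]

/-- Functions which are positive and continuous off the origin, and positively homogeneous of
degree `-d`. -/
structure PosHom (d : ℕ) (F : V → ℝ) : Prop where
  pos : ∀ x, x ≠ 0 → 0 < F x
  cont : ContinuousOn F {0}ᶜ
  hom : ∀ t : ℝ, 0 < t → ∀ x, F (t • x) = (t ^ d)⁻¹ * F x

namespace PosHom

variable {d : ℕ} {F : V → ℝ}

theorem continuousAt (h : PosHom d F) {x : V} (hx : x ≠ 0) : ContinuousAt F x :=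
  h.cont.continuousAt (isOpen_compl_singleton.mem_nhds hx)

theorem zero (h : PosHom d F) (hd : 1 ≤ d) : F 0 = 0 := by
  have h2 := h.hom 2 two_pos 0
  rw [smul_zero] at h2
  have : ((2 : ℝ) ^ d)⁻¹ < 1 := inv_lt_one_of_one_lt₀ (one_lt_pow₀ one_lt_two (by omega))
  by_contra h0
  exact this.ne (mul_right_cancel₀ h0 (by rw [one_mul]; exact h2.symm))

theorem nonneg (h : PosHom d F) (hd : 1 ≤ d) (x : V) : 0 ≤ F x := by
  rcases eq_or_ne x 0 with rfl | hx
  · exact (h.zero hd).ge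
  · exact (h.pos x hx).le

theorem eq_dir (h : PosHom d F) {x : V} (hx : x ≠ 0) :
    F x = (‖x‖ ^ d)⁻¹ * F (‖x‖⁻¹ • x) := by
  rw [← h.hom _ (norm_pos_iff.2 hx), smul_smul, mul_inv_cancel₀ (norm_ne_zero_iff.2 hx), one_smul]

theorem bounds [FiniteDimensional ℝ V] (h : PosHom d F) :
    ∃ c C : ℝ, 0 < c ∧ 0 < C ∧ ∀ x, x ≠ 0 → c * (‖x‖ ^ d)⁻¹ ≤ F x ∧ F x ≤ C * (‖x‖ ^ d)⁻¹ := by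
  have hne : ∀ x ∈ sphere (0 : V) 1, x ≠ 0 := fun x hx h0 => by simp [h0] at hx
  have hc : ContinuousOn F (sphere (0 : V) 1) := h.cont.mono hne
  rcases (sphere (0 : V) 1).eq_empty_or_nonempty with he | hne'
  · refine ⟨1, 1, one_pos, one_pos, fun x hx => ?_⟩
    have : ‖x‖⁻¹ • x ∈ sphere (0 : V) 1 := by simp [norm_smul, norm_ne_zero_iff.2 hx]
    simp [he] at this
  · obtain ⟨a, ha, hamin⟩ := (isCompact_sphere (0 : V) 1).exists_isMinOn hne' hc
    obtain ⟨b, hb, hbmax⟩ := (isCompact_sphere (0 : V) 1).exists_isMaxOn hne' hc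
    refine ⟨F a, F b, h.pos a (hne a ha), h.pos b (hne b hb), fun x hx => ?_⟩
    have hm : ‖x‖⁻¹ • x ∈ sphere (0 : V) 1 := by simp [norm_smul, norm_ne_zero_iff.2 hx]
    have hp : 0 ≤ (‖x‖ ^ d)⁻¹ := by positivity
    rw [h.eq_dir hx, mul_comm (F a), mul_comm (F b)]
    exact ⟨mul_le_mul_of_nonneg_left (hamin hm) hp, mul_le_mul_of_nonneg_left (hbmax hm) hp⟩

theorem abs_le [FiniteDimensional ℝ V] (h : PosHom d F) (hd : 1 ≤ d) :
    ∃ C : ℝ, 0 < C ∧ ∀ x, |F x| ≤ C * (‖x‖ ^ d)⁻¹ := by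
  obtain ⟨c, C, -, hC, H⟩ := h.bounds
  refine ⟨C, hC, fun x => ?_⟩
  rw [abs_of_nonneg (h.nonneg hd x)]
  rcases eq_or_ne x 0 with rfl | hx
  · rw [h.zero hd]; positivity
  · exact (H x hx).2

theorem comp_linear {W : Type*} [NormedAddCommGroup W] [InnerProductSpace ℝ W]
    (h : PosHom d F) (T : W →L[ℝ] V) (hT : Function.Injective T) : PosHom d (fun x => F (T x)) where
  pos x hx := h.pos _ ((map_ne_zero_iff T hT).2 hx)
  cont := h.cont.comp T.continuous.continuousOn fun x hx => (map_ne_zero_iff T hT).2 hx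
  hom t ht x := by simp [h.hom t ht]

theorem const_mul (h : PosHom d F) {c : ℝ} (hc : 0 < c) : PosHom d (fun x => c * F x) where
  pos x hx := mul_pos hc (h.pos x hx)
  cont := continuousOn_const.mul h.cont
  hom t ht x := by rw [h.hom t ht]; ring

theorem norm_inv (d : ℕ) : PosHom d (fun x : V => (‖x‖ ^ d)⁻¹) where
  pos x hx := by have := norm_pos_iff.2 hx; positivity
  cont := by
    refine ContinuousOn.inv₀ (by fun_prop) fun x hx => ?_
    exact pow_ne_zero _ (norm_ne_zero_iff.2 hx)
  hom t ht x := by rw [norm_smul, mul_pow, mul_inv, Real.norm_of_nonneg ht.le]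

theorem measurable [MeasurableSpace V] [BorelSpace V] (h : PosHom d F) : Measurable F := by
  refine measurable_of_measurable_on_compl_singleton 0 ?_
  exact (continuousOn_iff_continuous_domRestrict.1 h.cont).measurable

end PosHom

section Integrable
variable [FiniteDimensional ℝ V] [MeasurableSpace V] [BorelSpace V]

theorem integrableOn_norm_inv_pow {d : ℕ} (hd : d < finrank ℝ V) :
    IntegrableOn (fun x : V => (‖x‖ ^ d)⁻¹) (closedBall 0 1) := by
  have : Nontrivial V := finrank_pos_iff (R := ℝ).1 (by omega)
  rw [← integrable_indicator_iff measurableSet_closedBall]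
  have := (integrable_fun_norm_addHaar (E := V) volume
    (f := (Set.Iic (1 : ℝ)).indicator fun r => (r ^ d)⁻¹)).2 ?_
  · refine this.congr (.of_forall fun x => ?_)
    by_cases h : ‖x‖ ≤ 1 <;> simp [Set.indicator, h]
  · have h1 : IntegrableOn (fun r : ℝ => (Set.Ioc (0:ℝ) 1).indicator (fun r => r ^ (finrank ℝ V - 1 - d)) r)
        (Set.Ioi 0) := by
      refine Integrable.integrableOn ?_
      rw [integrable_indicator_iff measurableSet_Ioc]
      exact (Continuous.integrableOn_Icc (by fun_prop)).mono_set Set.Ioc_subset_Icc_self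
    refine h1.congr_fun (fun r hr => ?_) measurableSet_Ioi
    simp only [Set.mem_Ioi] at hr
    by_cases h : r ≤ 1
    · have h2 : r ^ (finrank ℝ V - 1) = r ^ (finrank ℝ V - 1 - d) * r ^ d := by
        rw [← pow_add]; congr 1; omega
      have h3 : r ^ d ≠ 0 := (pow_pos hr d).ne'
      simp [Set.indicator, h, hr, h2, h3]
    · simp [Set.indicator, h]

theorem PosHom.integrable_mul {d : ℕ} {F : V → ℝ} (h : PosHom d F) (h1 : 1 ≤ d)
    (hd : d < finrank ℝ V) {φ : V → ℝ} (hφ : Integrable φ) {M : ℝ} (hM : ∀ x, |φ x| ≤ M) :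
    Integrable fun x => F x * φ x := by
  obtain ⟨C, hC, hF⟩ := h.abs_le h1
  have hM0 : 0 ≤ M := (abs_nonneg _).trans (hM 0)
  have hi := ((integrableOn_norm_inv_pow hd).integrable_indicator measurableSet_closedBall).mul_const (C * M)
  refine (hi.add (hφ.norm.const_mul C)).mono' (h.measurable.aestronglyMeasurable.mul hφ.1)
    (.of_forall fun x => ?_)
  rw [norm_mul, Real.norm_eq_abs]
  by_cases hx : ‖x‖ ≤ 1
  · have h2 : (closedBall (0 : V) 1).indicator (fun x : V => (‖x‖ ^ d)⁻¹) x = (‖x‖ ^ d)⁻¹ := by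
      simp [Set.indicator, hx]
    simp only [Pi.add_apply, h2]
    have : |F x| * ‖φ x‖ ≤ C * (‖x‖ ^ d)⁻¹ * M := mul_le_mul (hF x) (hM x) (by positivity) (by positivity)
    have : 0 ≤ C * ‖φ x‖ := by positivity
    linarith
  · have h2 : (closedBall (0 : V) 1).indicator (fun x : V => (‖x‖ ^ d)⁻¹) x = 0 := by
      simp [Set.indicator, hx]
    simp only [Pi.add_apply, h2, zero_mul, zero_add]
    refine mul_le_mul_of_nonneg_right ((hF x).trans ?_) (norm_nonneg _)
    refine mul_le_of_le_one_right hC.le (inv_le_one_of_one_le₀ (one_le_pow₀ (not_le.1 hx).le))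

/-- The standard Gaussian density. -/
def gauss (x : V) : ℝ := Real.exp (-Real.pi * ‖x‖ ^ 2)

theorem gauss_pos (x : V) : 0 < gauss x := Real.exp_pos _
theorem gauss_le_one (x : V) : gauss x ≤ 1 := by
  unfold gauss; rw [Real.exp_le_one_iff]; nlinarith [Real.pi_pos, sq_nonneg ‖x‖]
theorem continuous_gauss : Continuous (gauss : V → ℝ) := by unfold gauss; fun_prop
theorem gauss_congr {W : Type*} [NormedAddCommGroup W] {x : V} {y : V} (h : ‖x‖ = ‖y‖) : gauss x = gauss y := by
  unfold gauss; rw [h]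

theorem integral_gauss : ∫ x : V, gauss x = 1 := by
  have := GaussianFourier.integral_rexp_neg_mul_sq_norm (V := V) Real.pi_pos
  simpa [gauss, Real.pi_pos.ne'] using this

theorem integrable_gauss : Integrable (gauss : V → ℝ) := by
  by_contra h
  have := integral_undef h
  rw [integral_gauss] at this
  exact one_ne_zero this

/-- The absolute value of the determinant of a linear automorphism. -/
def adet (A : V ≃L[ℝ] V) : ℝ := |LinearMap.det (A.toLinearEquiv : V →ₗ[ℝ] V)|

theorem adet_pos (A : V ≃L[ℝ] V) : 0 < adet A := abs_pos.2 (LinearEquiv.isUnit_det' A.toLinearEquiv).ne_zero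

theorem map_volume (A : V ≃L[ℝ] V) :
    (volume : Measure V).map A = ENNReal.ofReal (adet A)⁻¹ • volume := by
  have := Measure.map_linearMap_addHaar_eq_smul_addHaar (volume : Measure V)
    (f := (A.toLinearEquiv : V →ₗ[ℝ] V)) (LinearEquiv.isUnit_det' A.toLinearEquiv).ne_zero
  rw [abs_inv] at this
  exact this

theorem integral_comp_equiv (A : V ≃L[ℝ] V) (f : V → ℝ) :
    ∫ x, f (A x) = (adet A)⁻¹ * ∫ x, f x := by
  have := A.toHomeomorph.measurableEmbedding.integral_map (μ := volume) f
  rw [show (⇑A.toHomeomorph) = ⇑A from rfl, map_volume, integral_smul_measure,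
    ENNReal.toReal_ofReal (inv_nonneg.2 (adet_pos A).le), smul_eq_mul] at this
  exact this.symm

theorem integrable_comp_equiv (A : V ≃L[ℝ] V) {f : V → ℝ} (hf : Integrable f) :
    Integrable fun x => f (A x) := by
  have := A.toHomeomorph.measurableEmbedding.integrable_map_iff (μ := volume) (g := f)
  rw [show (⇑A.toHomeomorph) = ⇑A from rfl, map_volume] at this
  exact this.1 (hf.smul_measure ENNReal.ofReal_ne_top)

theorem adet_trans (A B : V ≃L[ℝ] V) : adet (A.trans B) = adet A * adet B := by
  unfold adet
  rw [← abs_mul, mul_comm, ← LinearMap.det_comp]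
  rfl

theorem adet_symm (A : V ≃L[ℝ] V) : adet A.symm = (adet A)⁻¹ := by
  refine eq_inv_of_mul_eq_one_left ?_
  rw [← adet_trans]
  have : (A.symm.trans A) = ContinuousLinearEquiv.refl ℝ V := by ext; simp
  rw [this]
  have h : ((ContinuousLinearEquiv.refl ℝ V).toLinearEquiv : V →ₗ[ℝ] V) = LinearMap.id := rfl
  simp [adet, h]

theorem adet_orth (U : V ≃ₗᵢ[ℝ] V) : adet U.toContinuousLinearEquiv = 1 := by
  have h1 := integral_comp_equiv U.toContinuousLinearEquiv (gauss : V → ℝ)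
  have h2 : ∫ x : V, gauss (U.toContinuousLinearEquiv x) = ∫ x : V, gauss x := by
    congr 1; ext x; simp [gauss]
  rw [h2, integral_gauss, mul_one] at h1
  exact (inv_eq_one.1 h1.symm)

/-- `A'` is the inverse transpose of `A`. -/
def Dual (A A' : V ≃L[ℝ] V) : Prop := ∀ x y, ⟪A x, A' y⟫ = ⟪x, y⟫

theorem Dual.swap {A A' : V ≃L[ℝ] V} (h : Dual A A') : Dual A' A := fun x y => by
  rw [real_inner_comm, h, real_inner_comm]

theorem Dual.trans {A A' B B' : V ≃L[ℝ] V} (h : Dual A A') (h' : Dual B B') :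
    Dual (A.trans B) (A'.trans B') := fun x y => by
  simp [h' _ _, h x y]

theorem Dual.symm {A A' : V ≃L[ℝ] V} (h : Dual A A') : Dual A.symm A'.symm := fun x y => by
  rw [← h]; simp

theorem dual_orth (U : V ≃ₗᵢ[ℝ] V) :
    Dual U.toContinuousLinearEquiv U.toContinuousLinearEquiv := fun x y => by simp

theorem exists_dual (A : V ≃L[ℝ] V) : ∃ A', Dual A A' := by
  refine ⟨ContinuousLinearEquiv.equivOfInverse
    (ContinuousLinearMap.adjoint (A.symm : V →L[ℝ] V)) (ContinuousLinearMap.adjoint (A : V →L[ℝ] V))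
    (fun x => ?_) (fun x => ?_), fun x y => ?_⟩
  · refine ext_inner_left ℝ fun y => ?_
    rw [ContinuousLinearMap.adjoint_inner_right, ContinuousLinearMap.adjoint_inner_right]; simp
  · refine ext_inner_left ℝ fun y => ?_
    rw [ContinuousLinearMap.adjoint_inner_right, ContinuousLinearMap.adjoint_inner_right]; simp
  · rw [ContinuousLinearEquiv.equivOfInverse_apply, ContinuousLinearMap.adjoint_inner_right]; simp

end Integrable
end PosHom

section Tot
variable {V : Type*} [NormedAddCommGroup V] [InnerProductSpace ℝ V] [FiniteDimensional ℝ V]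
  [MeasurableSpace V] [BorelSpace V]

theorem lintegral_polar {Ψ : V → ℝ≥0∞} (hΨ : Measurable Ψ) {e : V} (he : ‖e‖ = 1) :
    ∫⁻ x, Ψ x = ∫⁻ U : Orth V, (∫⁻ x : V, Ψ (‖x‖ • (U : V →L[ℝ] V) e)) ∂haar V := by
  have h1 (U : Orth V) : ∫⁻ x, Ψ ((U : V →L[ℝ] V) x) = ∫⁻ x, Ψ x :=
    (measurePreserving_orth U).lintegral_comp hΨ
  have h2 (x : V) : ∫⁻ U : Orth V, Ψ ((U : V →L[ℝ] V) x) ∂haar V =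
      ∫⁻ U : Orth V, Ψ (‖x‖ • (U : V →L[ℝ] V) e) ∂haar V := by
    obtain ⟨W, hW⟩ := exists_orth_apply_eq (x := ‖x‖ • e) (y := x) (by simp [norm_smul, he])
    rw [← lintegral_mul_right_eq_self (μ := haar V) (fun U : Orth V => Ψ (‖x‖ • (U : V →L[ℝ] V) e)) W]
    refine lintegral_congr fun U => ?_
    rw [← map_smul, orth_comp, hW]
  calc ∫⁻ x, Ψ x = ∫⁻ U : Orth V, (∫⁻ x : V, Ψ ((U : V →L[ℝ] V) x)) ∂haar V := by simp [h1]
    _ = ∫⁻ x : V, ∫⁻ U : Orth V, Ψ ((U : V →L[ℝ] V) x) ∂haar V :=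
      lintegral_lintegral_swap (hΨ.comp continuous_act.measurable).aemeasurable
    _ = ∫⁻ x : V, ∫⁻ U : Orth V, Ψ (‖x‖ • (U : V →L[ℝ] V) e) ∂haar V := by simp_rw [h2]
    _ = _ := by
      refine lintegral_lintegral_swap (hΨ.comp ?_).aemeasurable
      exact Continuous.measurable (by fun_prop)


/-- The Gaussian (equivalently, spherical) mean of `F x * ‖x‖ ^ d`. -/
def tot (d : ℕ) (F : V → ℝ) : ℝ := ∫ x, F x * (‖x‖ ^ d * gauss x)

theorem abs_mul_pow_le {d : ℕ} {F : V → ℝ} {C : ℝ} (hC : 0 < C) (h : ∀ x, |F x| ≤ C * (‖x‖ ^ d)⁻¹)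
    (x : V) : |F x * ‖x‖ ^ d| ≤ C := by
  rw [abs_mul, abs_of_nonneg (by positivity : 0 ≤ ‖x‖ ^ d)]
  rcases eq_or_ne (‖x‖ ^ d) 0 with h0 | h0
  · rw [h0, mul_zero]; exact hC.le
  · calc |F x| * ‖x‖ ^ d ≤ C * (‖x‖ ^ d)⁻¹ * ‖x‖ ^ d := by gcongr; exact h x
      _ = C := by field_simp

variable {d : ℕ} {F : V → ℝ}

theorem PosHom.integrable_tot (h : PosHom d F) (hd : 1 ≤ d) :
    Integrable fun x => F x * (‖x‖ ^ d * gauss x) := by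
  obtain ⟨C, hC, H⟩ := h.abs_le hd
  refine (integrable_gauss.const_mul C).mono'
    (h.measurable.mul ((by fun_prop : Continuous fun x : V => ‖x‖ ^ d).mul
      continuous_gauss).measurable).aestronglyMeasurable (.of_forall fun x => ?_)
  rw [← mul_assoc, norm_mul, Real.norm_eq_abs, Real.norm_of_nonneg (gauss_pos x).le]
  exact mul_le_mul_of_nonneg_right (abs_mul_pow_le hC H x) (gauss_pos x).le

theorem PosHom.avg_smul (h : PosHom d F) {t : ℝ} (ht : 0 < t) (x : V) :
    avg F (t • x) = (t ^ d)⁻¹ * avg F x := by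
  simp [avg, h.hom t ht, integral_const_mul]

theorem PosHom.avg_eq_of_norm_one (h : PosHom d F) (hd : 1 ≤ d) {e : V} (he : ‖e‖ = 1) :
    avg F e = tot d F := by
  have : Nontrivial V := ⟨e, 0, by rintro rfl; simp at he⟩
  have h1 : tot d F = ∫ x, avg (fun x => F x * (‖x‖ ^ d * gauss x)) x := (integral_avg (h.integrable_tot hd)).symm
  have h2 : ∀ᵐ x : V, avg (fun x => F x * (‖x‖ ^ d * gauss x)) x = avg F e * gauss x := by
    have : ∀ᵐ x : V, x ≠ 0 := by simp [ae_iff]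
    filter_upwards [this] with x hx
    have hx' := norm_pos_iff.2 hx
    have h3 : avg F x = (‖x‖ ^ d)⁻¹ * avg F e := by
      rw [← h.avg_smul hx']; exact avg_congr_norm F (by simp [norm_smul, he])
    have h4 : avg (fun x => F x * (‖x‖ ^ d * gauss x)) x = avg F x * (‖x‖ ^ d * gauss x) := by
      simp only [avg, ← integral_mul_const]
      refine integral_congr_ae (.of_forall fun U => ?_)
      simp only [gauss, Unitary.norm_map]
    rw [h4, h3]; field_simp
  rw [h1, integral_congr_ae h2, integral_const_mul, integral_gauss, mul_one]

theorem PosHom.avg_eq (h : PosHom d F) (hd : 1 ≤ d) (x : V) :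
    avg F x = (‖x‖ ^ d)⁻¹ * tot d F := by
  rcases eq_or_ne x 0 with rfl | hx
  · have : d ≠ 0 := by omega
    simp [avg, h.zero hd, this]
  have hx' := norm_pos_iff.2 hx
  have he : ‖‖x‖⁻¹ • x‖ = 1 := by simp [norm_smul, hx'.ne']
  rw [← h.avg_eq_of_norm_one hd he, ← h.avg_smul hx', smul_smul, mul_inv_cancel₀ hx'.ne', one_smul]

theorem PosHom.tot_pos [Nontrivial V] (h : PosHom d F) (hd : 1 ≤ d) : 0 < tot d F := by
  refine (integral_pos_iff_support_of_nonneg (fun x => ?_) (h.integrable_tot hd)).2 ?_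
  · have := h.nonneg hd x; have := gauss_pos x; positivity
  · have : ({0}ᶜ : Set V) ⊆ Function.support fun x => F x * (‖x‖ ^ d * gauss x) := fun x hx => by
      have := h.pos x hx; have := gauss_pos x; have := norm_pos_iff.2 hx
      simp only [Function.mem_support]; positivity
    refine lt_of_lt_of_le ?_ (measure_mono this)
    have h0 : volume ({0}ᶜ : Set V) = volume (Set.univ : Set V) := by
      refine measure_congr ?_
      rw [ae_eq_univ]; simp
    rw [h0]; simp

theorem PosHom.integral_mul_radial (h : PosHom d F) (hd : 1 ≤ d) {g : ℝ → ℝ}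
    (hi : Integrable fun x => F x * g ‖x‖) :
    ∫ x, F x * g ‖x‖ = tot d F * ∫ x : V, (‖x‖ ^ d)⁻¹ * g ‖x‖ := by
  rw [← integral_avg hi, ← integral_const_mul]
  refine integral_congr_ae (.of_forall fun x => ?_)
  have : avg (fun x => F x * g ‖x‖) x = avg F x * g ‖x‖ := by
    simp only [avg, ← integral_mul_const, Unitary.norm_map]
  simp only [this, h.avg_eq hd]; ring

/-- The star body with radial function `F ^ (1 / d)`. -/
def body (F : V → ℝ) : Set V := {x | x = 0 ∨ 1 ≤ F x}

theorem PosHom.measurableSet_body (h : PosHom d F) : MeasurableSet (body F) :=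
  (measurableSet_singleton (0 : V)).union (measurableSet_le measurable_const h.measurable)

theorem PosHom.volume_body (h : PosHom d F) (hd : 1 ≤ d) (hV : finrank ℝ V = d) :
    volume (body F) = ENNReal.ofReal (tot d F) * volume (ball (0 : V) 1) := by
  have : Nontrivial V := finrank_pos_iff (R := ℝ).1 (by omega)
  obtain ⟨e, he⟩ := exists_norm_eq V zero_le_one
  rw [← lintegral_indicator_one h.measurableSet_body,
    lintegral_polar (measurable_one.indicator h.measurableSet_body) he]
  have h1 (U : Orth V) : ∫⁻ x : V, (body F).indicator 1 (‖x‖ • (U : V →L[ℝ] V) e) =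
      ENNReal.ofReal (F ((U : V →L[ℝ] V) e)) * volume (ball (0 : V) 1) := by
    have hu : (U : V →L[ℝ] V) e ≠ 0 := orth_ne_zero U (by rintro rfl; simp at he)
    have hFu := h.pos _ hu
    set r := F ((U : V →L[ℝ] V) e) ^ ((d : ℝ)⁻¹) with hr
    have hr0 : 0 < r := Real.rpow_pos_of_pos hFu _
    have hrd : r ^ d = F ((U : V →L[ℝ] V) e) := Real.rpow_inv_natCast_pow hFu.le (by omega)
    have h2 : ∀ x : V, (body F).indicator (1 : V → ℝ≥0∞) (‖x‖ • (U : V →L[ℝ] V) e) =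
        (closedBall (0 : V) r).indicator 1 x := fun x => by
      have : ‖x‖ • (U : V →L[ℝ] V) e ∈ body F ↔ x ∈ closedBall (0 : V) r := by
        rw [mem_closedBall_zero_iff]
        rcases eq_or_ne x 0 with rfl | hx
        · simp [body, hr0.le]
        have hx' := norm_pos_iff.2 hx
        rw [body, Set.mem_ofPred_eq, h.hom _ hx', ← hrd, ← pow_le_pow_iff_left₀ hx'.le hr0.le (by omega : d ≠ 0)]
        have : ‖x‖ • (U : V →L[ℝ] V) e ≠ 0 := smul_ne_zero hx'.ne' hu
        simp only [this, false_or]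
        rw [← div_eq_inv_mul, one_le_div (by positivity)]
      by_cases hx : x ∈ closedBall (0 : V) r
      · rw [Set.indicator_of_mem hx, Set.indicator_of_mem (this.2 hx)]; rfl
      · rw [Set.indicator_of_notMem hx, Set.indicator_of_notMem (fun h => hx (this.1 h))]
    simp_rw [h2]
    rw [lintegral_indicator_one measurableSet_closedBall, Measure.addHaar_closedBall _ _ hr0.le, hV, hrd]
  simp_rw [h1]
  have h3 : Measurable fun U : Orth V => F ((U : V →L[ℝ] V) e) :=
    h.measurable.comp (Continuous.measurable (by fun_prop))
  rw [lintegral_mul_const _ h3.ennreal_ofReal, ← h.avg_eq_of_norm_one hd he, avg,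
    ofReal_integral_eq_lintegral_ofReal]
  · obtain ⟨C, hC, H⟩ := h.abs_le hd
    refine Integrable.of_bound h3.aestronglyMeasurable C (.of_forall fun U => ?_)
    have := H ((U : V →L[ℝ] V) e)
    rw [Unitary.norm_map, he] at this
    simpa using this
  · exact .of_forall fun U => h.nonneg hd _

theorem PosHom.tot_comp (h : PosHom d F) (hd : 1 ≤ d) (hV : finrank ℝ V = d) (A : V ≃L[ℝ] V) :
    tot d (fun x => F (A x)) = (adet A)⁻¹ * tot d F := by
  have : Nontrivial V := finrank_pos_iff (R := ℝ).1 (by omega)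
  have h' : PosHom d (fun x => F (A x)) := h.comp_linear (A : V →L[ℝ] V) A.injective
  have h1 : body (fun x => F (A x)) = A ⁻¹' body F := by
    ext x; simp [body]
  have h2 := h'.volume_body hd hV
  rw [h1, Measure.addHaar_preimage_continuousLinearEquiv, h.volume_body hd hV, ← mul_assoc] at h2
  have h3 : |LinearMap.det (A.symm : V →ₗ[ℝ] V)| = (adet A)⁻¹ := adet_symm A
  rw [h3, ENNReal.mul_left_inj (measure_ball_pos _ _ one_pos).ne' measure_ball_lt_top.ne,
    ← ENNReal.ofReal_mul (inv_nonneg.2 (adet_pos A).le), ENNReal.ofReal_eq_ofReal_iff] at h2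
  · exact h2.symm
  · have := adet_pos A; have := h.tot_pos hd; positivity
  · exact (h'.tot_pos hd).le

theorem Dual.adet_mul {A A' : V ≃L[ℝ] V} (h : Dual A A') : adet A * adet A' = 1 := by
  have h1 : (LinearMap.adjoint (A.toLinearEquiv : V →ₗ[ℝ] V)) ∘ₗ (A'.toLinearEquiv : V →ₗ[ℝ] V) = LinearMap.id := by
    ext y
    refine ext_inner_left ℝ fun x => ?_
    rw [LinearMap.comp_apply, LinearMap.adjoint_inner_right]
    exact h x y
  have h2 := congrArg LinearMap.det h1
  have h3 : LinearMap.det (LinearMap.adjoint (A.toLinearEquiv : V →ₗ[ℝ] V)) =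
      LinearMap.det (A.toLinearEquiv : V →ₗ[ℝ] V) := by
    rw [← LinearMap.det_toMatrix (stdOrthonormalBasis ℝ V).toBasis, LinearMap.toMatrix_adjoint,
      Matrix.det_conjTranspose, LinearMap.det_toMatrix]
    simp
  rw [LinearMap.det_comp, LinearMap.det_id, h3] at h2
  rw [adet, adet, ← abs_mul, h2, abs_one]

end Tot

section Frame
variable {V : Type*} [NormedAddCommGroup V] [InnerProductSpace ℝ V] [FiniteDimensional ℝ V]
  [MeasurableSpace V] [BorelSpace V]
variable {V₁ : Type*} [NormedAddCommGroup V₁] [InnerProductSpace ℝ V₁] [FiniteDimensional ℝ V₁]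
  [MeasurableSpace V₁] [BorelSpace V₁]
variable {V₂ : Type*} [NormedAddCommGroup V₂] [InnerProductSpace ℝ V₂] [FiniteDimensional ℝ V₂]
  [MeasurableSpace V₂] [BorelSpace V₂]

/-- The inclusion of the first summand of an orthogonal decomposition. -/
def inl (J : WithLp 2 (V₁ × V₂) ≃ₗᵢ[ℝ] V) : V₁ →ₗᵢ[ℝ] V where
  toFun v := J (WithLp.toLp 2 (v, 0))
  map_add' v w := by rw [← map_add, ← WithLp.toLp_add]; simp
  map_smul' c v := by rw [RingHom.id_apply, ← map_smul, ← WithLp.toLp_smul]; simp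
  norm_map' v := by simp

/-- The inclusion of the second summand of an orthogonal decomposition. -/
def inr (J : WithLp 2 (V₁ × V₂) ≃ₗᵢ[ℝ] V) : V₂ →ₗᵢ[ℝ] V where
  toFun v := J (WithLp.toLp 2 (0, v))
  map_add' v w := by rw [← map_add, ← WithLp.toLp_add]; simp
  map_smul' c v := by rw [RingHom.id_apply, ← map_smul, ← WithLp.toLp_smul]; simp
  norm_map' v := by simp

variable (J : WithLp 2 (V₁ × V₂) ≃ₗᵢ[ℝ] V)

theorem inl_add_inr (v : V₁) (w : V₂) : inl J v + inr J w = J (WithLp.toLp 2 (v, w)) := by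
  simp [inl, inr, ← map_add, ← WithLp.toLp_add]

theorem inner_inl_inr (v : V₁) (w : V₂) : ⟪inl J v, inr J w⟫ = 0 := by
  have : ⟪J (WithLp.toLp 2 (v, 0)), J (WithLp.toLp 2 (0, w))⟫ = 0 := by
    rw [J.inner_map_map, WithLp.prod_inner_apply]; simp
  exact this

theorem exists_eq_inl_add_inr (x : V) : ∃ v w, x = inl J v + inr J w :=
  ⟨(J.symm x).fst, (J.symm x).snd, by rw [inl_add_inr]; exact (J.apply_symm_apply x).symm⟩

theorem norm_inl_add_inr_sq (v : V₁) (w : V₂) : ‖inl J v + inr J w‖ ^ 2 = ‖v‖ ^ 2 + ‖w‖ ^ 2 := by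
  rw [inl_add_inr, J.norm_map, WithLp.prod_norm_sq_eq_of_L2]
  rfl


theorem gauss_inl_add_inr (v : V₁) (w : V₂) : gauss (inl J v + inr J w) = gauss v * gauss w := by
  simp only [gauss, norm_inl_add_inr_sq, ← Real.exp_add]; congr 1; ring

theorem measurePreserving_frame :
    MeasurePreserving (fun p : V₁ × V₂ => inl J p.1 + inr J p.2) (volume.prod volume) volume := by
  simp only [inl_add_inr]
  exact J.measurePreserving.comp (WithLp.volume_preserving_toLp V₁ V₂)

theorem measurableEmbedding_frame :
    MeasurableEmbedding (fun p : V₁ × V₂ => inl J p.1 + inr J p.2) := by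
  simp_rw [inl_add_inr]
  exact J.toHomeomorph.measurableEmbedding.comp
    (MeasurableEquiv.toLp 2 (V₁ × V₂)).measurableEmbedding

theorem integral_frame (f : V → ℝ) :
    ∫ x, f x = ∫ p : V₁ × V₂, f (inl J p.1 + inr J p.2) ∂(volume.prod volume) :=
  ((measurePreserving_frame J).integral_comp (measurableEmbedding_frame J) f).symm

theorem integrable_frame {f : V → ℝ} (hf : Integrable f) :
    Integrable (fun p : V₁ × V₂ => f (inl J p.1 + inr J p.2)) (volume.prod volume) :=
  (measurePreserving_frame J).integrable_comp_of_integrable hf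

theorem exists_orth_map (S : V₁ →ₗᵢ[ℝ] V) (W : Submodule ℝ V) (hW : finrank ℝ W = finrank ℝ V₁) :
    ∃ U : V ≃ₗᵢ[ℝ] V, (∀ v, U (S v) ∈ W) ∧ ∀ x ∈ W, ∃ v, U (S v) = x := by
  let e : V₁ ≃ₗᵢ[ℝ] W := (stdOrthonormalBasis ℝ V₁).equiv (stdOrthonormalBasis ℝ W)
    (finCongr hW.symm)
  let L : LinearMap.range S.toLinearMap →ₗᵢ[ℝ] V :=
    W.subtypeₗᵢ.comp (e.toLinearIsometry.comp S.equivRange.symm.toLinearIsometry)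
  have key (v : V₁) : L.extend (S v) = e v := by
    have h1 : L ⟨S v, LinearMap.mem_range_self _ v⟩ = e v := by
      have : S.equivRange.symm ⟨S v, LinearMap.mem_range_self _ v⟩ = v := by
        rw [LinearIsometryEquiv.symm_apply_eq]; rfl
      exact congrArg (fun z => (e z : V)) this
    rw [← h1]
    exact LinearIsometry.extend_apply L ⟨S v, LinearMap.mem_range_self _ v⟩
  refine ⟨L.extend.toLinearIsometryEquiv rfl, fun v => ?_, fun x hx => ⟨e.symm ⟨x, hx⟩, ?_⟩⟩
  · rw [LinearIsometry.coe_toLinearIsometryEquiv, key]; exact (e v).2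
  · rw [LinearIsometry.coe_toLinearIsometryEquiv, key]; simp

/-- Comparison of the central sections of two homogeneous functions. -/
def SecEq (k m : ℕ) (F G : V → ℝ) (c : ℝ) : Prop :=
  ∀ U : V ≃ₗᵢ[ℝ] V, tot k (fun v => F (U (inl J v))) = c * tot m (fun w => G (U (inr J w)))

/-- Comparison of the Gaussian integrals of two homogeneous functions. -/
def GaussEq (F G : V → ℝ) (c : ℝ) : Prop :=
  ∀ A A' : V ≃L[ℝ] V, Dual A A' →
    adet A * ∫ x, F (A x) * gauss x = c * ∫ x, G (A' x) * gauss x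

theorem adet_block (U : V ≃ₗᵢ[ℝ] V) (A A' : V ≃L[ℝ] V) (hA : Dual A A') (T : V₁ ≃L[ℝ] V₁) (N : V₂ ≃L[ℝ] V₂)
    (hT : ∀ v, A (inl J v) = U (inl J (T v))) (hN : ∀ w, A' (inr J w) = U (inr J (N w))) :
    adet A * adet N = adet T := by
  obtain ⟨Y, hY⟩ := exists_dual N
  have h0 (w : V₂) : ∃ z, A (inr J w) = U (inl J z + inr J (Y w)) := by
    obtain ⟨z, y, hzy⟩ := exists_eq_inl_add_inr J (U.symm (A (inr J w)))
    refine ⟨z, ?_⟩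
    have hy : y = Y w := by
      obtain ⟨w', hw'⟩ : ∃ w', N w' = y - Y w := ⟨N.symm (y - Y w), by simp⟩
      have h1 : ⟪y, N w'⟫ = ⟪w, w'⟫ := by
        have h2 := hA (inr J w) (inr J w')
        rw [LinearIsometry.inner_map_map, hN, ← LinearIsometryEquiv.apply_symm_apply U (A (inr J w)), hzy,
          LinearIsometryEquiv.inner_map_map, inner_add_left, inner_inl_inr, zero_add,
          LinearIsometry.inner_map_map] at h2
        exact h2
      have h3 : ⟪Y w, N w'⟫ = ⟪w, w'⟫ := hY.swap w w'
      rw [← sub_eq_zero, ← inner_self_eq_zero (𝕜 := ℝ)]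
      nth_rw 2 [← hw']
      rw [inner_sub_left, h1, h3, sub_self]
    rw [← hy, ← hzy]; simp
  choose X hX using h0
  have hg (v : V₁) (w : V₂) : gauss (A (inl J v + inr J w)) = gauss (T v + X w) * gauss (Y w) := by
    rw [map_add, hT, hX, ← map_add, ← add_assoc, ← map_add, ← gauss_inl_add_inr J]
    rw [gauss, U.norm_map]; rfl
  have h1 := integral_comp_equiv A (gauss : V → ℝ)
  rw [integral_gauss, mul_one, integral_frame J, integral_prod_symm _ (integrable_frame J
    (integrable_comp_equiv A integrable_gauss))] at h1
  simp only [hg, integral_mul_const] at h1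
  have h2 (w : V₂) : ∫ v, gauss (T v + X w) = (adet T)⁻¹ := by
    have := integral_add_right_eq_self (μ := volume) (fun v => gauss (T v)) (T.symm (X w))
    simp only [map_add, ContinuousLinearEquiv.apply_symm_apply] at this
    rw [this, integral_comp_equiv, integral_gauss, mul_one]
  simp only [h2, integral_const_mul, integral_comp_equiv Y, integral_gauss, mul_one] at h1
  have h3 := hY.adet_mul
  have := adet_pos A; have := adet_pos T; have := adet_pos Y
  rw [← mul_inv, inv_inj] at h1
  rw [← h1, mul_assoc, mul_comm (adet Y), h3, mul_one]

variable {J}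

theorem SecEq.linear {k m : ℕ} (hk : 1 ≤ k) (hm : 1 ≤ m) (h1 : finrank ℝ V₁ = k) (h2 : finrank ℝ V₂ = m)
    {F G : V → ℝ} (hF : PosHom k F) (hG : PosHom m G)
    {c : ℝ} (h : SecEq J k m F G c) {A A' : V ≃L[ℝ] V} (hA : Dual A A') :
    adet A * tot k (fun v => F (A (inl J v))) = c * tot m (fun w => G (A' (inr J w))) := by
  obtain ⟨U, hU, hU'⟩ := exists_orth_map (inl J)
    (LinearMap.range ((A : V →L[ℝ] V).toLinearMap ∘ₗ (inl J).toLinearMap))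
    (LinearMap.finrank_range_of_inj (A.injective.comp (inl J).injective))
  have hT (v : V₁) : ∃ z, A (inl J v) = U (inl J z) := by
    obtain ⟨z, hz⟩ := hU' (A (inl J v)) ⟨v, rfl⟩
    exact ⟨z, hz.symm⟩
  have hN (w : V₂) : ∃ z, A' (inr J w) = U (inr J z) := by
    obtain ⟨z, y, hzy⟩ := exists_eq_inl_add_inr J (U.symm (A' (inr J w)))
    have hz : z = 0 := by
      obtain ⟨v, hv⟩ := hU z
      have h3 : ⟪A (inl J v), A' (inr J w)⟫ = 0 := by rw [hA, inner_inl_inr]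
      have hv' : A (inl J v) = U (inl J z) := hv
      rw [hv', ← LinearIsometryEquiv.apply_symm_apply U (A' (inr J w)), hzy,
          LinearIsometryEquiv.inner_map_map, inner_add_right, inner_inl_inr, add_zero,
          LinearIsometry.inner_map_map, inner_self_eq_zero] at h3
      exact h3
    refine ⟨y, ?_⟩
    rw [hz, map_zero, zero_add] at hzy
    rw [← hzy]; simp
  choose T₀ hT₀ using hT
  choose N₀ hN₀ using hN
  let T₁ : V₁ →ₗ[ℝ] V₁ :=
    { toFun := T₀
      map_add' := fun x y => (inl J).injective <| U.injective <| by
        rw [← hT₀]; simp [map_add, hT₀]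
      map_smul' := fun c x => (inl J).injective <| U.injective <| by
        rw [← hT₀]; simp [hT₀] }
  let N₁ : V₂ →ₗ[ℝ] V₂ :=
    { toFun := N₀
      map_add' := fun x y => (inr J).injective <| U.injective <| by
        rw [← hN₀]; simp [map_add, hN₀]
      map_smul' := fun c x => (inr J).injective <| U.injective <| by
        rw [← hN₀]; simp [hN₀] }
  have hTi : Function.Injective T₁ := fun x y hxy => (inl J).injective <| A.injective <| by
    rw [hT₀, hT₀]; exact congrArg (fun z => U (inl J z)) hxy
  have hNi : Function.Injective N₁ := fun x y hxy => (inr J).injective <| A'.injective <| by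
    rw [hN₀, hN₀]; exact congrArg (fun z => U (inr J z)) hxy
  let T : V₁ ≃L[ℝ] V₁ := (LinearEquiv.ofInjectiveEndo T₁ hTi).toContinuousLinearEquiv
  let N : V₂ ≃L[ℝ] V₂ := (LinearEquiv.ofInjectiveEndo N₁ hNi).toContinuousLinearEquiv
  have hT : ∀ v, A (inl J v) = U (inl J (T v)) := hT₀
  have hN : ∀ w, A' (inr J w) = U (inr J (N w)) := hN₀
  have hdet := adet_block J U A A' hA T N hT hN
  have hFU : PosHom k (fun v => F (U (inl J v))) :=
    hF.comp_linear ((U.toContinuousLinearEquiv : V →L[ℝ] V).comp (inl J).toContinuousLinearMap)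
      (U.injective.comp (inl J).injective)
  have hGU : PosHom m (fun v => G (U (inr J v))) :=
    hG.comp_linear ((U.toContinuousLinearEquiv : V →L[ℝ] V).comp (inr J).toContinuousLinearMap)
      (U.injective.comp (inr J).injective)
  simp only [hT, hN]
  rw [hFU.tot_comp hk h1 T, hGU.tot_comp hm h2 N, h U, ← hdet]
  have := adet_pos A; have := adet_pos N
  field_simp

end Frame

section Avg
variable {V : Type*} [NormedAddCommGroup V] [InnerProductSpace ℝ V] [FiniteDimensional ℝ V]
  [MeasurableSpace V] [BorelSpace V]
variable {V₁ : Type*} [NormedAddCommGroup V₁] [InnerProductSpace ℝ V₁] [FiniteDimensional ℝ V₁]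
  [MeasurableSpace V₁] [BorelSpace V₁]
variable {V₂ : Type*} [NormedAddCommGroup V₂] [InnerProductSpace ℝ V₂] [FiniteDimensional ℝ V₂]
  [MeasurableSpace V₂] [BorelSpace V₂]

theorem integral_tot_orth [Nontrivial V₁] {d : ℕ} (hd : 1 ≤ d) {F : V → ℝ} (hF : PosHom d F) (S : V₁ →ₗᵢ[ℝ] V) :
    ∫ U : Orth V, tot d (fun v => F ((U : V →L[ℝ] V) (S v))) ∂haar V = tot d F := by
  have hcont : Continuous fun p : Orth V × V₁ => (p.1 : V →L[ℝ] V) (S p.2) := by fun_prop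
  obtain ⟨C, hC, H⟩ := hF.abs_le hd
  have hi : Integrable (fun p : Orth V × V₁ => F ((p.1 : V →L[ℝ] V) (S p.2)) * (‖p.2‖ ^ d * gauss p.2))
      ((haar V).prod volume) := by
    refine Integrable.mono' ((integrable_gauss.const_mul C).comp_snd (haar V))
      (((hF.measurable.comp hcont.measurable).mul (Continuous.measurable ?_)).aestronglyMeasurable)
      (.of_forall fun p => ?_)
    · exact (by fun_prop : Continuous fun p : Orth V × V₁ => ‖p.2‖ ^ d).mul (continuous_gauss.comp continuous_snd)
    · rw [← mul_assoc, norm_mul, Real.norm_eq_abs, Real.norm_of_nonneg (gauss_pos _).le]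
      refine mul_le_mul_of_nonneg_right ?_ (gauss_pos _).le
      have := abs_mul_pow_le hC H ((p.1 : V →L[ℝ] V) (S p.2))
      rwa [Unitary.norm_map, S.norm_map] at this
  unfold tot
  rw [integral_integral_swap hi]
  have h1 (v : V₁) : ∫ U : Orth V, F ((U : V →L[ℝ] V) (S v)) * (‖v‖ ^ d * gauss v) ∂haar V =
      (‖v‖ ^ d)⁻¹ * tot d F * (‖v‖ ^ d * gauss v) := by
    rw [integral_mul_const]
    have := hF.avg_eq hd (S v)
    rw [S.norm_map] at this
    rw [← this]; rfl
  simp only [h1]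
  have : ∀ᵐ v : V₁, (‖v‖ ^ d)⁻¹ * tot d F * (‖v‖ ^ d * gauss v) = tot d F * gauss v := by
    have : ∀ᵐ x : V₁, x ≠ 0 := by simp [ae_iff]
    filter_upwards [this] with x hx
    have hx' := norm_pos_iff.2 hx
    field_simp
  rw [integral_congr_ae this, integral_const_mul, integral_gauss, mul_one]
  rfl

/-- The Gaussian integral of `‖x‖ ^ (-d)`. -/
def radI (V : Type*) [NormedAddCommGroup V] [InnerProductSpace ℝ V] [FiniteDimensional ℝ V]
    [MeasurableSpace V] [BorelSpace V] (d : ℕ) : ℝ := ∫ x : V, (‖x‖ ^ d)⁻¹ * gauss x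

theorem integrable_radI {d : ℕ} (hd : 1 ≤ d) (hdV : d < finrank ℝ V) :
    Integrable fun x : V => (‖x‖ ^ d)⁻¹ * gauss x :=
  (PosHom.norm_inv d).integrable_mul hd hdV integrable_gauss (M := 1) fun x => by
    rw [abs_of_pos (gauss_pos x)]; exact gauss_le_one x

theorem radI_pos {d : ℕ} (hd : 1 ≤ d) (hdV : d < finrank ℝ V) : 0 < radI V d := by
  have : Nontrivial V := finrank_pos_iff (R := ℝ).1 (by omega)
  refine (integral_pos_iff_support_of_nonneg (fun x => ?_) (integrable_radI hd hdV)).2 ?_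
  · have := gauss_pos x; positivity
  · have : ({0}ᶜ : Set V) ⊆ Function.support fun x : V => (‖x‖ ^ d)⁻¹ * gauss x := fun x hx => by
      have := gauss_pos x; have := norm_pos_iff.2 hx
      simp only [Function.mem_support]; positivity
    refine lt_of_lt_of_le ?_ (measure_mono this)
    have h0 : volume ({0}ᶜ : Set V) = volume (Set.univ : Set V) := by
      refine measure_congr ?_
      rw [ae_eq_univ]; simp
    rw [h0]; simp

theorem PosHom.integrable_gauss_mul {d : ℕ} {F : V → ℝ} (hF : PosHom d F) (hd : 1 ≤ d)
    (hdV : d < finrank ℝ V) : Integrable fun x => F x * gauss x :=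
  hF.integrable_mul hd hdV integrable_gauss (M := 1) fun x => by
    rw [abs_of_pos (gauss_pos x)]; exact gauss_le_one x

theorem PosHom.integral_gauss_mul {d : ℕ} {F : V → ℝ} (hF : PosHom d F) (hd : 1 ≤ d)
    (hdV : d < finrank ℝ V) : ∫ x, F x * gauss x = tot d F * radI V d :=
  hF.integral_mul_radial hd (g := fun r => Real.exp (-Real.pi * r ^ 2)) (hF.integrable_gauss_mul hd hdV)

theorem PosHom.comp_equiv {d : ℕ} {F : V → ℝ} (hF : PosHom d F) (A : V ≃L[ℝ] V) :
    PosHom d fun x => F (A x) := hF.comp_linear (A : V →L[ℝ] V) A.injective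

variable {J : WithLp 2 (V₁ × V₂) ≃ₗᵢ[ℝ] V}

theorem SecEq.gaussEq [Nontrivial V₁] [Nontrivial V₂] {k m : ℕ} (hk : 1 ≤ k) (hm : 1 ≤ m)
    (h1 : finrank ℝ V₁ = k) (h2 : finrank ℝ V₂ = m) (hkV : k < finrank ℝ V) (hmV : m < finrank ℝ V)
    {F G : V → ℝ} (hF : PosHom k F) (hG : PosHom m G)
    {c : ℝ} (h : SecEq J k m F G c) : GaussEq F G (c * radI V k / radI V m) := by
  intro A A' hA
  have key : adet A * tot k (fun x => F (A x)) = c * tot m (fun x => G (A' x)) := by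
    rw [← integral_tot_orth hk (hF.comp_equiv A) (inl J), ← integral_tot_orth hm (hG.comp_equiv A') (inr J),
      ← integral_const_mul, ← integral_const_mul]
    refine integral_congr_ae (.of_forall fun U => ?_)
    have hU := (dual_orth (Unitary.linearIsometryEquiv U)).trans hA
    have := h.linear hk hm h1 h2 hF hG hU
    rw [adet_trans, adet_orth, one_mul] at this
    exact this
  rw [(hF.comp_equiv A).integral_gauss_mul hk hkV, (hG.comp_equiv A').integral_gauss_mul hm hmV,
    ← mul_assoc, key]
  have := radI_pos hm hmV
  field_simp

end Avg

section Stretch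
variable {V : Type*} [NormedAddCommGroup V] [InnerProductSpace ℝ V] [FiniteDimensional ℝ V]
  [MeasurableSpace V] [BorelSpace V]
variable {V₁ : Type*} [NormedAddCommGroup V₁] [InnerProductSpace ℝ V₁] [FiniteDimensional ℝ V₁]
  [MeasurableSpace V₁] [BorelSpace V₁]
variable {V₂ : Type*} [NormedAddCommGroup V₂] [InnerProductSpace ℝ V₂] [FiniteDimensional ℝ V₂]
  [MeasurableSpace V₂] [BorelSpace V₂]
variable (J : WithLp 2 (V₁ × V₂) ≃ₗᵢ[ℝ] V)

/-- Dilation of the two summands of an orthogonal decomposition by different factors. -/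
def stretch (a b : ℝ) (ha : a ≠ 0) (hb : b ≠ 0) : V ≃L[ℝ] V :=
  (J.symm.toLinearEquiv ≪≫ₗ WithLp.linearEquiv 2 ℝ (V₁ × V₂) ≪≫ₗ
    LinearEquiv.prodCongr (LinearEquiv.smulOfNeZero ℝ V₁ a ha) (LinearEquiv.smulOfNeZero ℝ V₂ b hb) ≪≫ₗ
    (WithLp.linearEquiv 2 ℝ (V₁ × V₂)).symm ≪≫ₗ J.toLinearEquiv).toContinuousLinearEquiv

theorem stretch_apply {a b : ℝ} (ha : a ≠ 0) (hb : b ≠ 0) (v : V₁) (w : V₂) :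
    stretch J a b ha hb (inl J v + inr J w) = inl J (a • v) + inr J (b • w) := by
  rw [inl_add_inr, inl_add_inr]
  simp [stretch]

theorem dual_stretch {a b : ℝ} (ha : a ≠ 0) (hb : b ≠ 0) :
    Dual (stretch J a b ha hb) (stretch J a⁻¹ b⁻¹ (inv_ne_zero ha) (inv_ne_zero hb)) := fun x y => by
  obtain ⟨v, w, rfl⟩ := exists_eq_inl_add_inr J x
  obtain ⟨v', w', rfl⟩ := exists_eq_inl_add_inr J y
  rw [stretch_apply, stretch_apply]
  have h (w : V₂) (v : V₁) : ⟪inr J w, inl J v⟫ = 0 := by rw [real_inner_comm, inner_inl_inr]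
  simp only [inner_add_left, inner_add_right, inner_inl_inr, h, LinearIsometry.inner_map_map,
    inner_smul_left, inner_smul_right]
  simp [ha, hb]

/-- Interchange of the two summands of an orthogonal decomposition. -/
def flip : WithLp 2 (V₂ × V₁) ≃ₗᵢ[ℝ] V where
  toLinearEquiv := WithLp.linearEquiv 2 ℝ (V₂ × V₁) ≪≫ₗ LinearEquiv.prodComm ℝ V₂ V₁ ≪≫ₗ
    (WithLp.linearEquiv 2 ℝ (V₁ × V₂)).symm ≪≫ₗ J.toLinearEquiv
  norm_map' x := by
    have : ‖J (WithLp.toLp 2 (x.snd, x.fst))‖ = ‖x‖ := by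
      rw [J.norm_map, ← sq_eq_sq₀ (norm_nonneg _) (norm_nonneg _), WithLp.prod_norm_sq_eq_of_L2,
        WithLp.prod_norm_sq_eq_of_L2, add_comm]
      rfl
    exact this

theorem stretch_flip {a b : ℝ} (ha : a ≠ 0) (hb : b ≠ 0) (x : V) :
    stretch (flip J) a b ha hb x = stretch J b a hb ha x := by
  obtain ⟨v, w, rfl⟩ := exists_eq_inl_add_inr J x
  rw [stretch_apply, add_comm (inl J v), add_comm (inl J _)]
  exact stretch_apply (flip J) ha hb w v

theorem not_integrable_norm_inv_pow_finrank [Nontrivial V] :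
    ¬ Integrable fun x : V => (‖x‖ ^ finrank ℝ V)⁻¹ * gauss x := by
  intro h
  have h1 := (integrable_fun_norm_addHaar (E := V) volume
    (f := fun r : ℝ => (r ^ finrank ℝ V)⁻¹ * Real.exp (-Real.pi * r ^ 2))).1 h
  have h2 : IntegrableOn (fun x : ℝ => x ^ (-1 : ℝ)) (Set.Ioo 0 1) := by
    refine Integrable.mono' ((h1.mono_set Set.Ioo_subset_Ioi_self).const_mul (Real.exp Real.pi)) ?_ ?_
    · exact (measurable_id.pow_const _).aestronglyMeasurable
    · refine (ae_restrict_iff' measurableSet_Ioo).2 (.of_forall fun r hr => ?_)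
      have hr0 : 0 < r := hr.1
      have hd : 0 < finrank ℝ V := finrank_pos
      have e1 : r ^ (finrank ℝ V - 1) * (r ^ finrank ℝ V)⁻¹ = r⁻¹ := by
        obtain ⟨d, hd⟩ : ∃ d, finrank ℝ V = d + 1 := ⟨finrank ℝ V - 1, by omega⟩
        rw [hd, Nat.add_sub_cancel, pow_succ]; field_simp
      rw [smul_eq_mul, ← mul_assoc (r ^ (finrank ℝ V - 1)), e1, mul_left_comm, ← Real.exp_add, Real.rpow_neg_one,
        Real.norm_of_nonneg (inv_nonneg.2 hr0.le)]
      refine le_mul_of_one_le_right (inv_nonneg.2 hr0.le) (Real.one_le_exp ?_)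
      have : r ^ 2 ≤ 1 := pow_le_one₀ hr0.le hr.2.le
      nlinarith [Real.pi_pos]
  rw [intervalIntegral.integrableOn_Ioo_rpow_iff one_pos] at h2
  exact lt_irrefl _ h2

theorem lintegral_norm_inv_pow_finrank [Nontrivial V] :
    ∫⁻ x : V, ENNReal.ofReal ((‖x‖ ^ finrank ℝ V)⁻¹ * gauss x) = ∞ := by
  by_contra h
  refine not_integrable_norm_inv_pow_finrank (V := V) ⟨?_, ?_⟩
  · exact (((by fun_prop : Continuous fun x : V => ‖x‖ ^ finrank ℝ V).measurable.inv).mul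
      continuous_gauss.measurable).aestronglyMeasurable
  · rw [hasFiniteIntegral_iff_ofReal (.of_forall fun x => by have := gauss_pos x; positivity)]
    exact lt_top_iff_ne_top.2 h

/-- The Gaussian integral of `‖x‖ ^ (-k)` after dilating the second summand. -/
def R0 (k : ℕ) (s : ℝ) : ℝ :=
  ∫ p : V₁ × V₂, (‖inl J p.1 + inr J (s⁻¹ • p.2)‖ ^ k)⁻¹ * (gauss p.1 * gauss p.2) ∂(volume.prod volume)

variable {J} in
theorem integrable_stretched {k : ℕ} (hk : 1 ≤ k) (hkV : k < finrank ℝ V) {F : V → ℝ} (hF : PosHom k F)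
    {s : ℝ} (hs : s ≠ 0) :
    Integrable (fun p : V₁ × V₂ => F (inl J p.1 + inr J (s⁻¹ • p.2)) * (gauss p.1 * gauss p.2))
      (volume.prod volume) := by
  have := integrable_frame J ((hF.comp_equiv (stretch J 1 s⁻¹ one_ne_zero (inv_ne_zero hs))).integrable_gauss_mul hk hkV)
  simpa only [stretch_apply, one_smul, gauss_inl_add_inr] using this

theorem integral_stretched (F : V → ℝ) {s : ℝ} (hs : s ≠ 0) :
    ∫ x, F (stretch J 1 s⁻¹ one_ne_zero (inv_ne_zero hs) x) * gauss x =
    ∫ p : V₁ × V₂, F (inl J p.1 + inr J (s⁻¹ • p.2)) * (gauss p.1 * gauss p.2) ∂(volume.prod volume) := by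
  rw [integral_frame J]
  simp only [stretch_apply, one_smul, gauss_inl_add_inr]

theorem tendsto_R0 [Nontrivial V₁] {k : ℕ} (h1 : finrank ℝ V₁ = k) (hkV : k < finrank ℝ V) :
    Filter.Tendsto (fun j : ℕ => R0 J k (j + 1)) Filter.atTop Filter.atTop := by
  have hk : 1 ≤ k := by rw [← h1]; exact finrank_pos
  set f : ℕ → V₁ × V₂ → ℝ := fun j p =>
    (‖inl J p.1 + inr J (((j : ℝ) + 1)⁻¹ • p.2)‖ ^ k)⁻¹ * (gauss p.1 * gauss p.2) with hf
  have hf0 (j p) : 0 ≤ f j p := by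
    have := gauss_pos p.1; have := gauss_pos p.2; simp only [hf]; positivity
  have hfi (j) : Integrable (f j) (volume.prod volume) :=
    integrable_stretched hk hkV (PosHom.norm_inv k) (by positivity)
  have hfm (j) : Measurable (f j) := by
    refine Measurable.mul (Continuous.measurable ?_).inv (Continuous.measurable ?_)
    · have := (inl J).continuous; have := (inr J).continuous
      fun_prop
    · exact (continuous_gauss.comp continuous_fst).mul (continuous_gauss.comp continuous_snd)
  have key : Filter.liminf (fun j => ∫⁻ p, ENNReal.ofReal (f j p) ∂(volume.prod volume)) Filter.atTop = ∞ := by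
    rw [eq_top_iff]
    refine le_trans ?_ (lintegral_liminf_le fun j => (hfm j).ennreal_ofReal)
    have : ∀ᵐ p ∂((volume : Measure V₁).prod (volume : Measure V₂)),
        ENNReal.ofReal ((‖p.1‖ ^ finrank ℝ V₁)⁻¹ * gauss p.1) * ENNReal.ofReal (gauss p.2) =
        Filter.liminf (fun j => ENNReal.ofReal (f j p)) Filter.atTop := by
      have h0 : ∀ᵐ v : V₁, v ≠ 0 := by simp [ae_iff]
      filter_upwards [Measure.quasiMeasurePreserving_fst.ae h0] with p hp
      refine (Filter.Tendsto.liminf_eq ?_).symm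
      rw [← ENNReal.ofReal_mul (by have := gauss_pos p.1; positivity)]
      refine ENNReal.tendsto_ofReal ?_
      rw [mul_assoc, h1]
      refine Filter.Tendsto.mul_const _ (Filter.Tendsto.inv₀ ?_ ?_)
      · refine Filter.Tendsto.pow ?_ k
        have h3 : Filter.Tendsto (fun j : ℕ => ((j : ℝ) + 1)⁻¹) Filter.atTop (nhds 0) :=
          (Filter.tendsto_atTop_add_const_right _ 1 tendsto_natCast_atTop_atTop).inv_tendsto_atTop
        have h4 : Continuous fun t : ℝ => ‖inl J p.1 + inr J (t • p.2)‖ := by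
          have := (inr J).continuous; fun_prop
        have := (h4.tendsto 0).comp h3
        simpa [Function.comp_def] using this
      · exact pow_ne_zero _ (norm_ne_zero_iff.2 hp)
    rw [← lintegral_congr_ae this, lintegral_prod_mul (f := fun v : V₁ => ENNReal.ofReal ((‖v‖ ^ finrank ℝ V₁)⁻¹ * gauss v))
      (g := fun w : V₂ => ENNReal.ofReal (gauss w)), lintegral_norm_inv_pow_finrank, ← ofReal_integral_eq_lintegral_ofReal
      integrable_gauss (.of_forall fun x => (gauss_pos x).le), integral_gauss]
    · simp
    · exact (((by fun_prop : Continuous fun x : V₁ => ‖x‖ ^ finrank ℝ V₁).measurable.inv).mul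
        continuous_gauss.measurable).ennreal_ofReal.aemeasurable
    · exact continuous_gauss.measurable.ennreal_ofReal.aemeasurable
  refine Filter.tendsto_atTop.2 fun b => ?_
  have h5 : ENNReal.ofReal (max b 0) < Filter.liminf (fun j => ∫⁻ p, ENNReal.ofReal (f j p) ∂(volume.prod volume)) Filter.atTop := by
    rw [key]; exact ENNReal.ofReal_lt_top
  filter_upwards [Filter.eventually_lt_of_lt_liminf h5] with j hj
  rw [← ofReal_integral_eq_lintegral_ofReal (hfi j) (.of_forall (hf0 j))] at hj
  exact (le_max_left b 0).trans (ENNReal.ofReal_lt_ofReal_iff'.1 hj).1.le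

end Stretch

section Limit
variable {V : Type*} [NormedAddCommGroup V] [InnerProductSpace ℝ V] [FiniteDimensional ℝ V]
  [MeasurableSpace V] [BorelSpace V]
variable {V₁ : Type*} [NormedAddCommGroup V₁] [InnerProductSpace ℝ V₁] [FiniteDimensional ℝ V₁]
  [MeasurableSpace V₁] [BorelSpace V₁]
variable {V₂ : Type*} [NormedAddCommGroup V₂] [InnerProductSpace ℝ V₂] [FiniteDimensional ℝ V₂]
  [MeasurableSpace V₂] [BorelSpace V₂]
variable (J : WithLp 2 (V₁ × V₂) ≃ₗᵢ[ℝ] V)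

theorem norm_inl_le (v : V₁) (w : V₂) : ‖v‖ ≤ ‖inl J v + inr J w‖ := by
  have := norm_inl_add_inr_sq J v w
  nlinarith [norm_nonneg v, norm_nonneg (inl J v + inr J w), sq_nonneg ‖w‖]

theorem norm_inr_le (v : V₁) (w : V₂) : ‖w‖ ≤ ‖inl J v + inr J w‖ := by
  have := norm_inl_add_inr_sq J v w
  nlinarith [norm_nonneg w, norm_nonneg (inl J v + inr J w), sq_nonneg ‖v‖]

theorem PosHom.exists_angle {k : ℕ} {F : V → ℝ} (hF : PosHom k F) {ε : ℝ} (hε : 0 < ε) :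
    ∃ δ > 0, ∀ (v : V₁) (w : V₂), v ≠ 0 → ‖w‖ ≤ δ * ‖v‖ →
      |F (inl J v + inr J w) * ‖inl J v + inr J w‖ ^ k - F (inl J v) * ‖v‖ ^ k| ≤ ε := by
  set Φ : V₁ × V₂ → ℝ := fun p => F (inl J p.1 + inr J p.2) * ‖inl J p.1 + inr J p.2‖ ^ k
  have hK : IsCompact (sphere (0 : V₁) 1 ×ˢ closedBall (0 : V₂) 1) :=
    (isCompact_sphere _ _).prod (isCompact_closedBall _ _)
  have h1 := (inl J).continuous
  have h2 := (inr J).continuous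
  have hΦ : ContinuousOn Φ (sphere (0 : V₁) 1 ×ˢ closedBall (0 : V₂) 1) := by
    refine ContinuousOn.mul (hF.cont.comp (by fun_prop) fun p hp => ?_) (by fun_prop)
    have hp1 : ‖p.1‖ = 1 := by simpa using hp.1
    have := norm_inl_le J p.1 p.2
    rw [hp1] at this
    exact norm_pos_iff.1 (one_pos.trans_le this)
  obtain ⟨δ, hδ, H⟩ := Metric.uniformContinuousOn_iff.1 (hK.uniformContinuousOn_of_continuous hΦ) ε hε
  refine ⟨min 1 (δ / 2), by positivity, fun v w hv hw => ?_⟩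
  have hv' := norm_pos_iff.2 hv
  have hw' : ‖‖v‖⁻¹ • w‖ ≤ min 1 (δ / 2) := by
    rw [norm_smul, _root_.norm_inv, norm_norm]
    rw [inv_mul_le_iff₀ hv', mul_comm]; exact hw
  have hs (x : V) : F (‖v‖⁻¹ • x) * ‖‖v‖⁻¹ • x‖ ^ k = F x * ‖x‖ ^ k := by
    rw [hF.hom _ (inv_pos.2 hv'), norm_smul, _root_.norm_inv, norm_norm, mul_pow]
    field_simp
  have e1 : ‖‖v‖⁻¹ • v‖ = 1 := by simp [norm_smul, hv'.ne']
  have := H (‖v‖⁻¹ • v, ‖v‖⁻¹ • w) ⟨by simpa using e1, by simpa using hw'.trans (min_le_left _ _)⟩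
    (‖v‖⁻¹ • v, 0) ⟨by simpa using e1, by simp⟩ (by
      rw [Prod.dist_eq, dist_self, dist_zero_right, max_lt_iff]
      exact ⟨hδ, (hw'.trans (min_le_right _ _)).trans_lt (half_lt_self hδ)⟩)
  simp only [Φ, map_smul, ← smul_add, map_zero, add_zero, Real.dist_eq, hs, LinearIsometry.norm_map] at this
  exact this.le

theorem integrable_cone {k : ℕ} (hk : 1 ≤ k) (hkV : k < finrank ℝ V) (δ : ℝ) {s : ℝ} (hs : 0 < s) :
    Integrable (fun p : V₁ × V₂ => {p : V₁ × V₂ | s * δ * ‖p.1‖ < ‖p.2‖}.indicator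
      (fun p => (‖inl J p.1 + inr J (s⁻¹ • p.2)‖ ^ k)⁻¹ * (gauss p.1 * gauss p.2)) p) (volume.prod volume) :=
  (integrable_stretched hk hkV (PosHom.norm_inv k) hs.ne').indicator
    (measurableSet_lt (by fun_prop) (by fun_prop))

theorem integral_cone_le [Nontrivial V₁] [Nontrivial V₂] {k : ℕ} (h1 : finrank ℝ V₁ = k) (hkV : k < finrank ℝ V)
    {δ : ℝ} (hδ : 0 < δ) {s : ℝ} (hs : 0 < s) :
    ∫ p : V₁ × V₂, {p : V₁ × V₂ | s * δ * ‖p.1‖ < ‖p.2‖}.indicator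
      (fun p => (‖inl J p.1 + inr J (s⁻¹ • p.2)‖ ^ k)⁻¹ * (gauss p.1 * gauss p.2)) p ∂(volume.prod volume)
    ≤ (δ ^ k)⁻¹ * volume.real (ball (0 : V₁) 1) := by
  have hk : 1 ≤ k := by rw [← h1]; exact finrank_pos
  have hi := integrable_cone J hk hkV δ hs
  rw [integral_prod_symm _ hi]
  have hb : ∀ᵐ w : V₂, ∫ v : V₁, {p : V₁ × V₂ | s * δ * ‖p.1‖ < ‖p.2‖}.indicator
      (fun p => (‖inl J p.1 + inr J (s⁻¹ • p.2)‖ ^ k)⁻¹ * (gauss p.1 * gauss p.2)) (v, w) ≤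
      (δ ^ k)⁻¹ * volume.real (ball (0 : V₁) 1) * gauss w := by
    have h0 : ∀ᵐ w : V₂, w ≠ 0 := by simp [ae_iff]
    filter_upwards [h0] with w hw
    have hw' := norm_pos_iff.2 hw
    calc _ ≤ ∫ v : V₁, (ball (0 : V₁) (‖w‖ / (s * δ))).indicator (fun _ => ((s⁻¹ * ‖w‖) ^ k)⁻¹ * gauss w) v := by
          refine integral_mono_of_nonneg (.of_forall fun v => ?_) ?_ (.of_forall fun v => ?_)
          · refine Set.indicator_nonneg (fun p _ => ?_) _
            have := gauss_pos p.1; have := gauss_pos p.2; positivity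
          · refine (integrable_indicator_iff measurableSet_ball).2 (integrableOn_const ?_)
            exact measure_ball_lt_top.ne
          · simp only [Set.indicator, Set.mem_ofPred_eq, mem_ball_zero_iff]
            have hiff : s * δ * ‖v‖ < ‖w‖ ↔ ‖v‖ < ‖w‖ / (s * δ) := by
              rw [lt_div_iff₀ (by positivity), mul_comm]
            by_cases h : ‖v‖ < ‖w‖ / (s * δ)
            · rw [if_pos h, if_pos (hiff.2 h)]
              have h3 : s⁻¹ * ‖w‖ ≤ ‖inl J v + inr J (s⁻¹ • w)‖ := by
                refine le_trans (le_of_eq ?_) (norm_inr_le J v (s⁻¹ • w))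
                rw [norm_smul, _root_.norm_inv, Real.norm_of_nonneg hs.le]
              have := gauss_pos v; have := gauss_pos w
              have : gauss v * gauss w ≤ gauss w := mul_le_of_le_one_left (gauss_pos w).le (gauss_le_one v)
              gcongr
            · rw [if_neg h, if_neg (mt hiff.1 h)]
      _ = _ := by
          rw [integral_indicator measurableSet_ball, setIntegral_const, smul_eq_mul, measureReal_def,
            measureReal_def, Measure.addHaar_ball volume (0 : V₁) (by positivity), h1, ENNReal.toReal_mul,
            ENNReal.toReal_ofReal (by positivity)]
          have hgw := gauss_pos w
          rw [div_pow, mul_pow, mul_pow, inv_pow]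
          field_simp
  refine (integral_mono_ae hi.integral_prod_right (integrable_gauss.const_mul _) hb).trans ?_
  rw [integral_const_mul, integral_gauss, mul_one]

theorem integral_main [Nontrivial V₁] [Nontrivial V₂] {k : ℕ} (h1 : finrank ℝ V₁ = k) (hkV : k < finrank ℝ V)
    {F : V → ℝ} (hF : PosHom k F) {s : ℝ} (hs : 0 < s) :
    Integrable (fun p : V₁ × V₂ => F (inl J p.1) * ‖p.1‖ ^ k *
      ((‖inl J p.1 + inr J (s⁻¹ • p.2)‖ ^ k)⁻¹ * (gauss p.1 * gauss p.2))) (volume.prod volume) ∧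
    ∫ p : V₁ × V₂, F (inl J p.1) * ‖p.1‖ ^ k *
      ((‖inl J p.1 + inr J (s⁻¹ • p.2)‖ ^ k)⁻¹ * (gauss p.1 * gauss p.2)) ∂(volume.prod volume) =
      tot k (fun v => F (inl J v)) * R0 J k s := by
  have hk : 1 ≤ k := by rw [← h1]; exact finrank_pos
  have hF1 : PosHom k (fun v => F (inl J v)) := hF.comp_linear (inl J).toContinuousLinearMap (inl J).injective
  obtain ⟨C, hC, HC⟩ := hF1.abs_le hk
  have hC' (v : V₁) := abs_mul_pow_le hC HC v
  have hi0 : Integrable (fun p : V₁ × V₂ => (‖inl J p.1 + inr J (s⁻¹ • p.2)‖ ^ k)⁻¹ * (gauss p.1 * gauss p.2))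
      (volume.prod volume) := integrable_stretched hk hkV (PosHom.norm_inv k) hs.ne'
  have hm : Measurable fun p : V₁ × V₂ => F (inl J p.1) * ‖p.1‖ ^ k :=
    (hF1.measurable.comp measurable_fst).mul (by fun_prop)
  have hi := hi0.bdd_mul (c := C) hm.aestronglyMeasurable (.of_forall fun p => hC' p.1)
  refine ⟨hi, ?_⟩
  rw [integral_prod_symm _ hi, R0, integral_prod_symm _ hi0, ← integral_const_mul]
  have h0 : ∀ᵐ w : V₂, w ≠ 0 := by simp [ae_iff]
  refine integral_congr_ae ?_
  filter_upwards [h0] with w hw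
  have hw' := norm_pos_iff.2 hw
  set g : ℝ → ℝ := fun r => r ^ k * ((Real.sqrt (r ^ 2 + (s⁻¹ * ‖w‖) ^ 2) ^ k)⁻¹ *
    (Real.exp (-Real.pi * r ^ 2) * gauss w)) with hg
  have hgeq (v : V₁) : g ‖v‖ = ‖v‖ ^ k * ((‖inl J v + inr J (s⁻¹ • w)‖ ^ k)⁻¹ * (gauss v * gauss w)) := by
    have : ‖inl J v + inr J (s⁻¹ • w)‖ = Real.sqrt (‖v‖ ^ 2 + (s⁻¹ * ‖w‖) ^ 2) := by
      rw [← Real.sqrt_sq (norm_nonneg (inl J v + inr J (s⁻¹ • w))), norm_inl_add_inr_sq, norm_smul, _root_.norm_inv,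
        Real.norm_of_nonneg hs.le]
    rw [this]; rfl
  have hig : Integrable fun v : V₁ => F (inl J v) * g ‖v‖ := by
    refine (integrable_gauss.const_mul (C * (((s⁻¹ * ‖w‖) ^ k)⁻¹ * gauss w))).mono' ?_ (.of_forall fun v => ?_)
    · refine (hF1.measurable.mul ?_).aestronglyMeasurable
      simp only [hg]
      fun_prop
    · rw [hgeq, ← mul_assoc, norm_mul, mul_assoc]
      refine mul_le_mul (hC' v) ?_ (norm_nonneg _) hC.le
      have h3 : s⁻¹ * ‖w‖ ≤ ‖inl J v + inr J (s⁻¹ • w)‖ := by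
        refine le_trans (le_of_eq ?_) (norm_inr_le J v (s⁻¹ • w))
        rw [norm_smul, _root_.norm_inv, Real.norm_of_nonneg hs.le]
      have := gauss_pos v; have := gauss_pos w
      rw [Real.norm_of_nonneg (by positivity), mul_assoc, mul_comm (gauss w)]
      gcongr
  have := hF1.integral_mul_radial hk hig
  simp only [hgeq, ← mul_assoc] at this
  simp only [← mul_assoc]
  rw [this]
  congr 1
  have h0 : ∀ᵐ w : V₁, w ≠ 0 := by simp [ae_iff]
  refine integral_congr_ae ?_
  filter_upwards [h0] with v hv
  have hv' := norm_pos_iff.2 hv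
  rw [inv_mul_cancel₀ (by positivity), one_mul]

theorem PosHom.abs_stretched_sub_le [Nontrivial V₁] [Nontrivial V₂] {k : ℕ} (h1 : finrank ℝ V₁ = k)
    (hkV : k < finrank ℝ V) {F : V → ℝ} (hF : PosHom k F) {ε : ℝ} (hε : 0 < ε) :
    ∃ K, ∀ s : ℝ, 0 < s →
      |∫ p : V₁ × V₂, F (inl J p.1 + inr J (s⁻¹ • p.2)) * (gauss p.1 * gauss p.2) ∂(volume.prod volume) -
        tot k (fun v => F (inl J v)) * R0 J k s| ≤ ε * R0 J k s + K := by
  have hk : 1 ≤ k := by rw [← h1]; exact finrank_pos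
  have hF1 : PosHom k (fun v => F (inl J v)) := hF.comp_linear (inl J).toContinuousLinearMap (inl J).injective
  obtain ⟨C₁, hC₁, HC₁⟩ := hF1.abs_le hk
  obtain ⟨C₂, hC₂, HC₂⟩ := hF.abs_le hk
  obtain ⟨δ, hδ, hang⟩ := hF.exists_angle J hε
  refine ⟨(C₂ + C₁) * ((δ ^ k)⁻¹ * volume.real (ball (0 : V₁) 1)), fun s hs => ?_⟩
  obtain ⟨hi, he⟩ := integral_main J h1 hkV hF hs
  have hi0 : Integrable (fun p : V₁ × V₂ => (‖inl J p.1 + inr J (s⁻¹ • p.2)‖ ^ k)⁻¹ * (gauss p.1 * gauss p.2))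
      (volume.prod volume) := integrable_stretched hk hkV (PosHom.norm_inv k) hs.ne'
  have hiF := integrable_stretched (J := J) hk hkV hF hs.ne'
  rw [← he, ← integral_sub hiF hi]
  refine (abs_integral_le_integral_abs).trans ?_
  have hic := integrable_cone J hk hkV δ hs
  refine (integral_mono_ae (hiF.sub hi).abs ((hi0.const_mul ε).add (hic.const_mul (C₂ + C₁))) ?_).trans ?_
  · have h0 : ∀ᵐ v : V₁, v ≠ 0 := by simp [ae_iff]
    filter_upwards [Measure.quasiMeasurePreserving_fst.ae h0] with p hp
    have hp' := norm_pos_iff.2 hp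
    set x := inl J p.1 + inr J (s⁻¹ • p.2) with hx
    have hxp : 0 < ‖x‖ := hp'.trans_le (norm_inl_le J _ _)
    have hg : 0 < gauss p.1 * gauss p.2 := mul_pos (gauss_pos _) (gauss_pos _)
    set q := (‖x‖ ^ k)⁻¹ * (gauss p.1 * gauss p.2) with hq
    have hq0 : 0 < q := by positivity
    have e1 : F x * (gauss p.1 * gauss p.2) - F (inl J p.1) * ‖p.1‖ ^ k * q =
        (F x * ‖x‖ ^ k - F (inl J p.1) * ‖p.1‖ ^ k) * q := by
      rw [hq]; field_simp
    simp only [Pi.sub_apply, Pi.add_apply]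
    rw [← hx, e1, abs_mul, abs_of_pos hq0]
    by_cases hc : s * δ * ‖p.1‖ < ‖p.2‖
    · rw [Set.indicator_of_mem (by exact hc), ← hx, ← hq]
      have : |F x * ‖x‖ ^ k - F (inl J p.1) * ‖p.1‖ ^ k| ≤ C₂ + C₁ :=
        (abs_sub _ _).trans (add_le_add (abs_mul_pow_le hC₂ HC₂ x) (abs_mul_pow_le hC₁ HC₁ p.1))
      nlinarith [mul_pos hε hq0]
    · rw [Set.indicator_of_notMem (by exact hc), mul_zero, add_zero]
      refine mul_le_mul_of_nonneg_right (hang p.1 (s⁻¹ • p.2) hp ?_) hq0.le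
      rw [norm_smul, _root_.norm_inv, Real.norm_of_nonneg hs.le, inv_mul_le_iff₀ hs, ← mul_assoc]
      exact not_lt.1 hc
  · simp only [Pi.add_apply]
    rw [integral_add (hi0.const_mul ε) (hic.const_mul _), integral_const_mul, integral_const_mul, R0]
    gcongr
    exact integral_cone_le J h1 hkV hδ hs

theorem PosHom.tendsto_ratio [Nontrivial V₁] [Nontrivial V₂] {k : ℕ} (h1 : finrank ℝ V₁ = k)
    (hkV : k < finrank ℝ V) {F : V → ℝ} (hF : PosHom k F) :
    Filter.Tendsto (fun j : ℕ => (∫ p : V₁ × V₂, F (inl J p.1 + inr J (((j : ℝ) + 1)⁻¹ • p.2)) *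
      (gauss p.1 * gauss p.2) ∂(volume.prod volume)) / R0 J k (j + 1)) Filter.atTop
      (nhds (tot k (fun v => F (inl J v)))) := by
  rw [Metric.tendsto_atTop']
  intro ε hε
  obtain ⟨K, hK⟩ := hF.abs_stretched_sub_le J h1 hkV (ε := ε / 2) (by positivity)
  obtain ⟨N, hN⟩ := Filter.eventually_atTop.1 ((tendsto_R0 J h1 hkV).eventually_gt_atTop (max 0 (K / (ε / 2))))
  refine ⟨N, fun j hj => ?_⟩
  have hR := hN j hj.le
  have hR0 := (le_max_left _ _).trans_lt hR
  have hR1 := (le_max_right _ _).trans_lt hR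
  rw [div_lt_iff₀ (by positivity)] at hR1
  have := hK (j + 1) (by positivity)
  rw [Real.dist_eq, div_sub' hR0.ne', abs_div, abs_of_pos hR0, div_lt_iff₀ hR0, mul_comm (R0 J k _)]
  nlinarith

end Limit

section Converse
variable {V : Type*} [NormedAddCommGroup V] [InnerProductSpace ℝ V] [FiniteDimensional ℝ V]
  [MeasurableSpace V] [BorelSpace V]
variable {V₁ : Type*} [NormedAddCommGroup V₁] [InnerProductSpace ℝ V₁] [FiniteDimensional ℝ V₁]
  [MeasurableSpace V₁] [BorelSpace V₁]
variable {V₂ : Type*} [NormedAddCommGroup V₂] [InnerProductSpace ℝ V₂] [FiniteDimensional ℝ V₂]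
  [MeasurableSpace V₂] [BorelSpace V₂]
variable {J : WithLp 2 (V₁ × V₂) ≃ₗᵢ[ℝ] V}

theorem tot_norm_inv [Nontrivial V] (d : ℕ) : tot d (fun x : V => (‖x‖ ^ d)⁻¹) = 1 := by
  unfold tot
  rw [← integral_gauss (V := V)]
  have h0 : ∀ᵐ v : V, v ≠ 0 := by simp [ae_iff]
  refine integral_congr_ae ?_
  filter_upwards [h0] with v hv
  have := norm_pos_iff.2 hv
  field_simp

theorem secEq_norm [Nontrivial V₁] [Nontrivial V₂] (k m : ℕ) :
    SecEq J k m (fun x : V => (‖x‖ ^ k)⁻¹) (fun x : V => (‖x‖ ^ m)⁻¹) 1 := fun U => by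
  simp only [LinearIsometryEquiv.norm_map, LinearIsometry.norm_map, tot_norm_inv, one_mul]

theorem GaussEq.stretched {m : ℕ} {F G : V → ℝ} (hG : PosHom m G) {c : ℝ} (h : GaussEq F G c)
    (U : V ≃ₗᵢ[ℝ] V) {s : ℝ} (hs : 0 < s) :
    adet (stretch J 1 s⁻¹ one_ne_zero (inv_ne_zero hs.ne')) *
      ∫ p : V₁ × V₂, F (U (inl J p.1 + inr J (s⁻¹ • p.2))) * (gauss p.1 * gauss p.2) ∂(volume.prod volume) =
    c * ((s ^ m)⁻¹ * ∫ p : V₂ × V₁, G (U (inl (flip J) p.1 + inr (flip J) (s⁻¹ • p.2))) *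
      (gauss p.1 * gauss p.2) ∂(volume.prod volume)) := by
  have hd := (dual_stretch J one_ne_zero (inv_ne_zero hs.ne')).trans (dual_orth U)
  have := h _ _ hd
  rw [adet_trans, adet_orth, mul_one] at this
  rw [← integral_stretched J (fun x => F (U x)) hs.ne', ← integral_stretched (flip J) (fun x => G (U x)) hs.ne',
    ← integral_const_mul (s ^ m)⁻¹]
  refine this.trans ?_
  congr 2
  ext x
  rw [← mul_assoc, ← hG.hom s hs]
  congr 2
  rw [stretch_flip, ← map_smul]
  obtain ⟨v, w, rfl⟩ := exists_eq_inl_add_inr J x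
  change U (stretch J _ _ _ _ _) = _
  rw [stretch_apply, stretch_apply, smul_add, ← map_smul, ← map_smul, smul_smul, mul_inv_cancel₀ hs.ne',
    smul_smul, inv_inv, mul_one, inv_one]

theorem GaussEq.secEq [Nontrivial V₁] [Nontrivial V₂] {k m : ℕ} (h1 : finrank ℝ V₁ = k) (h2 : finrank ℝ V₂ = m)
    (hkV : k < finrank ℝ V) (hmV : m < finrank ℝ V)
    {F G : V → ℝ} (hF : PosHom k F) (hG : PosHom m G)
    {c : ℝ} (h : GaussEq F G c) : SecEq J k m F G (c * radI V m / radI V k) := by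
  intro U
  have hk : 1 ≤ k := by rw [← h1]; exact finrank_pos
  have hm : 1 ≤ m := by rw [← h2]; exact finrank_pos
  have href := (secEq_norm (J := J) k m).gaussEq hk hm h1 h2 hkV hmV (PosHom.norm_inv k) (PosHom.norm_inv m)
  have hFU := hF.comp_equiv U.toContinuousLinearEquiv
  have hGU := hG.comp_equiv U.toContinuousLinearEquiv
  have t1 := hFU.tendsto_ratio J h1 hkV
  have t2 := hGU.tendsto_ratio (flip J) h2 hmV
  have p1 := radI_pos hk hkV
  have p2 := radI_pos hm hmV
  have key := tendsto_nhds_unique_of_eventuallyEq (t1.const_mul (radI V k / radI V m)) (t2.const_mul c) ?_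
  · change _ * tot k (fun v => F (U (inl J v))) = c * tot m (fun w => G (U (inr J w))) at key
    field_simp at key ⊢
    linarith
  filter_upwards [(tendsto_R0 J h1 hkV).eventually_gt_atTop 0, (tendsto_R0 (flip J) h2 hmV).eventually_gt_atTop 0]
    with j hj1 hj2
  have hs : (0 : ℝ) < (j : ℝ) + 1 := by positivity
  have e1 := h.stretched (J := J) hG U hs
  have e2 := href.stretched (J := J) (PosHom.norm_inv m) (LinearIsometryEquiv.refl ℝ V) hs
  have ha := adet_pos (stretch J 1 ((j : ℝ) + 1)⁻¹ one_ne_zero (inv_ne_zero hs.ne'))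
  rw [one_mul] at e2
  change _ * R0 J k ((j : ℝ) + 1) = _ * (_ * R0 (flip J) m ((j : ℝ) + 1)) at e2
  have hsm : 0 < ((((j : ℝ) + 1) ^ m)⁻¹) := by positivity
  change _ / _ * ((∫ p : V₁ × V₂, F (U (inl J p.1 + inr J (((j : ℝ) + 1)⁻¹ • p.2))) * (gauss p.1 * gauss p.2)
    ∂(volume.prod volume)) / _) = c * ((∫ p : V₂ × V₁, G (U (inl (flip J) p.1 + inr (flip J) (((j : ℝ) + 1)⁻¹ • p.2)))
    * (gauss p.1 * gauss p.2) ∂(volume.prod volume)) / _)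
  generalize (∫ p : V₁ × V₂, F (U (inl J p.1 + inr J (((j : ℝ) + 1)⁻¹ • p.2))) * (gauss p.1 * gauss p.2)
    ∂(volume.prod volume)) = LF at *
  generalize (∫ p : V₂ × V₁, G (U (inl (flip J) p.1 + inr (flip J) (((j : ℝ) + 1)⁻¹ • p.2)))
    * (gauss p.1 * gauss p.2) ∂(volume.prod volume)) = LG at *
  generalize adet (stretch J 1 ((j : ℝ) + 1)⁻¹ one_ne_zero (inv_ne_zero hs.ne')) = a at *
  generalize ((((j : ℝ) + 1) ^ m)⁻¹) = b at *
  generalize radI V k / radI V m = κ at *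
  generalize R0 J k ((j : ℝ) + 1) = R at *
  generalize R0 (flip J) m ((j : ℝ) + 1) = R' at *
  rw [← mul_div_assoc, ← mul_div_assoc, div_eq_div_iff hj1.ne' hj2.ne']
  refine mul_left_cancel₀ (mul_pos ha hsm).ne' ?_
  linear_combination (b * κ * R') * e1 - (b * c * LG) * e2

end Converse

section Bodies
variable {n : ℕ}

theorem _root_.IsStarBody.gauge_pos {K : Set (Euc n)} (hK : IsStarBody K) {x : Euc n} (hx : x ≠ 0) : 0 < gauge K x :=
  (gauge_nonneg x).lt_of_ne' (hK.2.2.2.1 x hx)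

theorem _root_.IsStarBody.posHom {K : Set (Euc n)} (hK : IsStarBody K) (d : ℕ) :
    PosHom d (fun x => radialFn K x ^ d) where
  pos x hx := pow_pos (inv_pos.2 (hK.gauge_pos hx)) d
  cont := (hK.2.2.1.continuousOn.inv₀ fun x hx => hK.2.2.2.1 x hx).pow d
  hom t ht x := by
    simp only [radialFn, gauge_smul_of_nonneg ht.le, smul_eq_mul, mul_inv, mul_pow, inv_pow]

theorem _root_.IsStarBody.eq_body {K : Set (Euc n)} (hK : IsStarBody K) {d : ℕ} (hd : 1 ≤ d) :
    K = body (fun x => radialFn K x ^ d) := by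
  have h := hK.2.2.2.2
  ext x
  have hx : x ∈ K ↔ gauge K x ≤ 1 := by nth_rw 1 [h]; rfl
  rw [hx]
  simp only [body, Set.mem_ofPred_eq]
  rcases eq_or_ne x 0 with rfl | hx
  · simp
  · have := hK.gauge_pos hx
    simp only [hx, false_or, radialFn]
    rw [one_le_pow_iff_of_nonneg (by positivity) (by omega), one_le_inv₀ this]

theorem PosHom.starBody_body_one {R : Euc n → ℝ} (hR : PosHom 1 R) :
    IsStarBody (body R) ∧ ∀ x, gauge (body R) x = (R x)⁻¹ := by
  have hz := hR.zero le_rfl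
  obtain ⟨c, C, hc, hC, H⟩ := hR.bounds
  simp only [pow_one] at H
  have hmem (x : Euc n) : x ∈ body R ↔ (R x)⁻¹ ≤ 1 := by
    simp only [body, Set.mem_ofPred_eq]
    rcases eq_or_ne x 0 with rfl | hx
    · simp [hz]
    · simp only [hx, false_or]; rw [inv_le_one₀ (hR.pos x hx)]
  have hg (x : Euc n) : gauge (body R) x = (R x)⁻¹ := by
    rw [gauge_def']
    have h0 : 0 ≤ (R x)⁻¹ := inv_nonneg.2 (hR.nonneg le_rfl x)
    have : {r ∈ Set.Ioi (0 : ℝ) | r⁻¹ • x ∈ body R} = Set.Ioi 0 ∩ Set.Ici (R x)⁻¹ := by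
      ext r
      simp only [Set.mem_inter_iff, Set.mem_Ioi, Set.mem_Ici, Set.mem_ofPred_eq]
      refine and_congr_right fun hr => ?_
      rw [hmem, hR.hom _ (inv_pos.2 hr), pow_one, inv_inv, mul_inv, inv_mul_le_iff₀ hr, mul_one]
    rw [this]
    rcases h0.eq_or_lt with h1 | h1
    · rw [← h1, Set.inter_eq_left.2 Set.Ioi_subset_Ici_self, csInf_Ioi]
    · have h2 : Set.Ici (R x)⁻¹ ⊆ Set.Ioi 0 := fun r hr => h1.trans_le hr
      rw [Set.inter_eq_right.2 h2, csInf_Ici]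
  have hle (x : Euc n) : (R x)⁻¹ ≤ c⁻¹ * ‖x‖ := by
    rcases eq_or_ne x 0 with rfl | hx
    · simp [hz]
    · have := (H x hx).1
      have hx' := norm_pos_iff.2 hx
      calc (R x)⁻¹ ≤ (c * ‖x‖⁻¹)⁻¹ := inv_anti₀ (by positivity) this
        _ = _ := by rw [mul_inv, inv_inv]
  have hge (x : Euc n) : C⁻¹ * ‖x‖ ≤ (R x)⁻¹ := by
    rcases eq_or_ne x 0 with rfl | hx
    · simp [hz]
    · have := (H x hx).2
      have hx' := norm_pos_iff.2 hx
      calc C⁻¹ * ‖x‖ = (C * ‖x‖⁻¹)⁻¹ := by rw [mul_inv, inv_inv]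
        _ ≤ _ := inv_anti₀ (hR.pos x hx) this
  have hcont : Continuous fun x => (R x)⁻¹ := by
    refine continuous_iff_continuousAt.2 fun x => ?_
    rcases eq_or_ne x 0 with rfl | hx
    · have : Filter.Tendsto (fun x : Euc n => c⁻¹ * ‖x‖) (nhds 0) (nhds 0) := by
        have h : Continuous fun x : Euc n => c⁻¹ * ‖x‖ := by fun_prop
        simpa using h.tendsto 0
      have h := squeeze_zero (fun x => inv_nonneg.2 (hR.nonneg le_rfl x)) hle this
      rw [ContinuousAt, hz, inv_zero]; exact h
    · exact (hR.continuousAt hx).inv₀ (hR.pos x hx).ne'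
  have hset : body R = {x | (R x)⁻¹ ≤ 1} := Set.ext hmem
  refine ⟨⟨?_, ?_, ?_, fun x hx => ?_, ?_⟩, hg⟩
  · refine Metric.isCompact_of_isClosed_isBounded ?_ ?_
    · rw [hset]; exact isClosed_le hcont continuous_const
    · refine (Metric.isBounded_closedBall (x := (0 : Euc n)) (r := C)).subset fun x hx => ?_
      have := (hge x).trans ((hmem x).1 hx)
      rw [inv_mul_le_iff₀ hC, mul_one] at this
      simpa using this
  · rw [mem_interior]
    refine ⟨{x | (R x)⁻¹ < 1}, fun x hx => (hmem x).2 (le_of_lt hx), isOpen_lt hcont continuous_const, ?_⟩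
    simp [hz]
  · rw [show gauge (body R) = fun x => (R x)⁻¹ from funext hg]; exact hcont
  · rw [hg]; exact (inv_pos.2 (hR.pos x hx)).ne'
  · simp only [hg]; exact hset

theorem PosHom.root {V : Type*} [NormedAddCommGroup V] [InnerProductSpace ℝ V]
    {d : ℕ} (hd : 1 ≤ d) {F : V → ℝ} (hF : PosHom d F) : PosHom 1 (fun x => F x ^ (d : ℝ)⁻¹) where
  pos x hx := Real.rpow_pos_of_pos (hF.pos x hx) _
  cont := hF.cont.rpow_const fun x hx => .inl (hF.pos x hx).ne'
  hom t ht x := by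
    rw [hF.hom t ht, Real.mul_rpow (by positivity) (hF.nonneg hd x), Real.inv_rpow (by positivity),
      Real.pow_rpow_inv_natCast ht.le (by omega), pow_one]

theorem PosHom.starBody_body {d : ℕ} (hd : 1 ≤ d) {F : Euc n → ℝ} (hF : PosHom d F) :
    IsStarBody (body F) ∧ (fun x => radialFn (body F) x ^ d) = F := by
  have hb : body F = body (fun x => F x ^ (d : ℝ)⁻¹) := by
    ext x
    simp only [body, Set.mem_ofPred_eq]
    refine or_congr_right ?_
    rw [← Real.one_rpow ((d : ℝ)⁻¹), Real.rpow_le_rpow_iff zero_le_one (hF.nonneg hd x) (by positivity)]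
    simp
  obtain ⟨h1, h2⟩ := (hF.root hd).starBody_body_one
  rw [hb]
  refine ⟨h1, funext fun x => ?_⟩
  rw [radialFn, h2, inv_inv, Real.rpow_inv_natCast_pow (hF.nonneg hd x) (by omega)]

/-- The ratio of the Hausdorff measure to Lebesgue measure. -/
theorem exists_hausdorff_eq (d : ℕ) :
    ∃ c : ℝ, 0 < c ∧ (μH[(d : ℝ)] : Measure (Euc d)) = ENNReal.ofReal c • volume := by
  have h : (μH[(finrank ℝ (Euc d) : ℝ)] : Measure (Euc d)).IsAddHaarMeasure := inferInstance
  rw [finrank_euclideanSpace_fin] at h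
  have := Measure.isAddLeftInvariant_eq_smul (μH[(d : ℝ)] : Measure (Euc d)) volume
  refine ⟨((Measure.addHaarScalarFactor (μH[(d : ℝ)] : Measure (Euc d)) volume : NNReal) : ℝ),
    Measure.addHaarScalarFactor_pos_of_isAddHaarMeasure (μH[(d : ℝ)] : Measure (Euc d)) volume, ?_⟩
  rw [ENNReal.ofReal_coe_nnreal]
  exact this

theorem body_section {V W : Type*} [NormedAddCommGroup V] [InnerProductSpace ℝ V]
    [NormedAddCommGroup W] [InnerProductSpace ℝ W] (S : W →ₗᵢ[ℝ] V) (H : Submodule ℝ V)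
    (hH : ∀ w, S w ∈ H) (hH' : ∀ x ∈ H, ∃ w, S w = x) (F : V → ℝ) :
    (H : Set V) ∩ body F = S '' body (fun w => F (S w)) := by
  ext x
  constructor
  · rintro ⟨h1, h2⟩
    obtain ⟨w, rfl⟩ := hH' x h1
    refine ⟨w, ?_, rfl⟩
    simpa [body, map_eq_zero_iff S S.injective] using h2
  · rintro ⟨w, hw, rfl⟩
    refine ⟨hH w, ?_⟩
    simpa [body, map_eq_zero_iff S S.injective] using hw

theorem exists_hausdorff_section {d : ℕ} (hd : 1 ≤ d) : ∃ c : ℝ, 0 < c ∧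
    ∀ {F : Euc n → ℝ}, PosHom d F → ∀ (S : Euc d →ₗᵢ[ℝ] Euc n) (H : Submodule ℝ (Euc n)),
      (∀ w, S w ∈ H) → (∀ x ∈ H, ∃ w, S w = x) →
      μH[(d : ℝ)] ((H : Set (Euc n)) ∩ body F) = ENNReal.ofReal (c * tot d (fun w => F (S w))) := by
  obtain ⟨c, hc, h⟩ := exists_hausdorff_eq d
  have hb0 : 0 < volume (ball (0 : Euc d) 1) := measure_ball_pos _ _ one_pos
  have hbt : volume (ball (0 : Euc d) 1) ≠ ∞ := measure_ball_lt_top.ne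
  refine ⟨c * (volume (ball (0 : Euc d) 1)).toReal, mul_pos hc (ENNReal.toReal_pos hb0.ne' hbt), ?_⟩
  intro F hF S H h1 h2
  have hFS : PosHom d (fun w => F (S w)) := hF.comp_linear S.toContinuousLinearMap S.injective
  rw [body_section S H h1 h2, S.isometry.hausdorffMeasure_image (.inl (by positivity)), h, Measure.smul_apply,
    hFS.volume_body hd (finrank_euclideanSpace_fin),
    smul_eq_mul, mul_assoc, ENNReal.ofReal_mul hc.le, mul_comm (ENNReal.toReal _), ENNReal.ofReal_mul', ENNReal.ofReal_toReal hbt]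
  exact ENNReal.toReal_nonneg

theorem exists_isKIntBodyOf_iff {k : ℕ} (hk : 1 ≤ k) (hkn : k < n)
    (J : WithLp 2 (Euc k × Euc (n - k)) ≃ₗᵢ[ℝ] Euc n) : ∃ c : ℝ, 0 < c ∧
    ∀ {F G : Euc n → ℝ}, PosHom k F → PosHom (n - k) G →
      (IsKIntBodyOf n k (body F) (body G) ↔ SecEq J k (n - k) F G c) := by
  obtain ⟨c₁, hc₁, h₁⟩ := exists_hausdorff_section (n := n) hk
  obtain ⟨c₂, hc₂, h₂⟩ := exists_hausdorff_section (n := n) (d := n - k) (by omega)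
  have : Nontrivial (Euc k) := finrank_pos_iff (R := ℝ).1 (by rw [finrank_euclideanSpace_fin]; omega)
  have : Nontrivial (Euc (n - k)) := finrank_pos_iff (R := ℝ).1 (by rw [finrank_euclideanSpace_fin]; omega)
  refine ⟨c₂ / c₁, by positivity, fun {F G} hF hG => ?_⟩
  have key (U : Euc n ≃ₗᵢ[ℝ] Euc n) (H : Submodule ℝ (Euc n)) (hH : ∀ v, U (inr J v) ∈ H)
      (hH' : ∀ x ∈ H, ∃ v, U (inr J v) = x) :
      μH[(k : ℝ)] ((Hᗮ : Set (Euc n)) ∩ body F) = μH[((n - k : ℕ) : ℝ)] ((H : Set (Euc n)) ∩ body G) ↔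
      tot k (fun v => F (U (inl J v))) = c₂ / c₁ * tot (n - k) (fun w => G (U (inr J w))) := by
    have e1 := h₁ hF (U.toLinearIsometry.comp (inl J)) Hᗮ (fun w => ?_) (fun x hx => ?_)
    have e2 := h₂ hG (U.toLinearIsometry.comp (inr J)) H hH hH'
    · rw [e1, e2]
      have hFU : PosHom k (fun v => F (U (inl J v))) :=
        hF.comp_linear (U.toLinearIsometry.comp (inl J)).toContinuousLinearMap (U.toLinearIsometry.comp (inl J)).injective
      have hGU : PosHom (n - k) (fun v => G (U (inr J v))) :=
        hG.comp_linear (U.toLinearIsometry.comp (inr J)).toContinuousLinearMap (U.toLinearIsometry.comp (inr J)).injective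
      have t1 := hFU.tot_pos hk
      have t2 := hGU.tot_pos (by omega)
      rw [div_mul_eq_mul_div, eq_div_iff hc₁.ne', mul_comm (tot k _)]
      exact ENNReal.ofReal_eq_ofReal_iff (mul_pos hc₁ t1).le (mul_pos hc₂ t2).le
    · rw [Submodule.mem_orthogonal]
      intro y hy
      obtain ⟨v, rfl⟩ := hH' y hy
      change ⟪U (inr J v), U (inl J w)⟫ = 0
      rw [LinearIsometryEquiv.inner_map_map, real_inner_comm, inner_inl_inr]
    · obtain ⟨v, w, hvw⟩ := exists_eq_inl_add_inr J (U.symm x)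
      rw [Submodule.mem_orthogonal] at hx
      have h3 := hx _ (hH w)
      rw [← U.apply_symm_apply x, hvw, LinearIsometryEquiv.inner_map_map, inner_add_right, real_inner_comm,
        inner_inl_inr, zero_add, LinearIsometry.inner_map_map, inner_self_eq_zero] at h3
      refine ⟨v, ?_⟩
      rw [h3, map_zero, add_zero] at hvw
      change U (inl J v) = x
      rw [← hvw, U.apply_symm_apply]
  constructor
  · intro h U
    let H := LinearMap.range (U.toLinearIsometry.comp (inr J)).toLinearMap
    refine (key U H (fun v => ⟨v, rfl⟩) (fun x hx => hx)).1 (h H ?_)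
    rw [LinearMap.finrank_range_of_inj (U.toLinearIsometry.comp (inr J)).injective, finrank_euclideanSpace_fin]
  · intro h H hH
    obtain ⟨U, hU, hU'⟩ := exists_orth_map (inr J) H (by rw [hH, finrank_euclideanSpace_fin])
    exact (key U H hU hU').2 (h U)

theorem exists_frame {k : ℕ} (hkn : k < n) : Nonempty (WithLp 2 (Euc k × Euc (n - k)) ≃ₗᵢ[ℝ] Euc n) := by
  have : finrank ℝ (WithLp 2 (Euc k × Euc (n - k))) = finrank ℝ (Euc n) := by
    rw [(WithLp.linearEquiv 2 ℝ (Euc k × Euc (n - k))).finrank_eq, finrank_prod]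
    simp only [finrank_euclideanSpace_fin]; omega
  exact ⟨(stdOrthonormalBasis ℝ _).equiv (stdOrthonormalBasis ℝ _) (finCongr this)⟩

end Bodies

section EG
variable {V : Type*} [NormedAddCommGroup V] [InnerProductSpace ℝ V] [FiniteDimensional ℝ V]
  [MeasurableSpace V] [BorelSpace V]

/-- The homogeneous function `F` is represented by the measure `μ`, tested against Gaussians. -/
def GaussRep (k : ℕ) (F : V → ℝ) (μ : Measure (sphere (0 : V) 1)) : Prop :=
  ∀ A A' : V ≃L[ℝ] V, Dual A A' →
    adet A * ∫ x, F x * gauss (A x) = ∫ θ : sphere (0 : V) 1, (‖A' θ‖ ^ k)⁻¹ ∂μ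

/-- The orbit map of a unit vector. -/
def orbit (e : sphere (0 : V) 1) (U : Orth V) : sphere (0 : V) 1 :=
  ⟨(U : V →L[ℝ] V) e, by simp [Unitary.norm_map]⟩

theorem continuous_orbit (e : sphere (0 : V) 1) : Continuous (orbit e) :=
  Continuous.subtype_mk (by fun_prop) _

theorem surjective_orbit (e : sphere (0 : V) 1) : Function.Surjective (orbit e) := fun θ => by
  obtain ⟨U, hU⟩ := exists_orth_apply_eq (x := (e : V)) (y := (θ : V)) (by simp)
  exact ⟨U, Subtype.ext hU⟩

theorem integral_gauss_dilate {m : ℕ} (hm : m ≤ finrank ℝ V) {a : ℝ} (ha : 0 < a) :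
    ∫ x : V, (‖x‖ ^ m)⁻¹ * Real.exp (-Real.pi * (‖x‖ * a) ^ 2) = (a ^ (finrank ℝ V - m))⁻¹ * radI V m := by
  have h := Measure.integral_comp_smul (volume : Measure V) (fun x : V => (‖x‖ ^ m)⁻¹ * gauss x) a
  have h2 (x : V) : (‖a • x‖ ^ m)⁻¹ * gauss (a • x) =
      (a ^ m)⁻¹ * ((‖x‖ ^ m)⁻¹ * Real.exp (-Real.pi * (‖x‖ * a) ^ 2)) := by
    rw [gauss, norm_smul, Real.norm_of_nonneg ha.le, mul_pow, mul_inv, mul_assoc, mul_comm a]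
  simp only [h2, integral_const_mul, smul_eq_mul] at h
  rw [abs_of_pos (by positivity)] at h
  have e1 : a ^ finrank ℝ V = a ^ m * a ^ (finrank ℝ V - m) := by rw [← pow_add]; congr 1; omega
  rw [e1, mul_inv, mul_assoc] at h
  exact mul_left_cancel₀ (by positivity) h

theorem PosHom.integral_gauss_comp_eq {k m : ℕ} (hk : 1 ≤ k) (hm : 1 ≤ m) (hV : finrank ℝ V = k + m)
    {G : V → ℝ} (hG : PosHom m G) (A : V ≃L[ℝ] V) (e : sphere (0 : V) 1) :
    ∫ x, G x * gauss (A x) = radI V m * ∫ U : Orth V, G (orbit e U) * (‖A (orbit e U)‖ ^ k)⁻¹ ∂haar V := by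
  have he : ‖(e : V)‖ = 1 := by simp
  have hA : Measurable fun x => gauss (A x) := (continuous_gauss.comp A.continuous).measurable
  have hmeas : Measurable fun x => G x * gauss (A x) := hG.measurable.mul hA
  have h0 (x : V) : 0 ≤ G x * gauss (A x) := mul_nonneg (hG.nonneg hm x) (gauss_pos _).le
  have hmU : Measurable fun U : Orth V => G (orbit e U) * (‖A (orbit e U)‖ ^ k)⁻¹ := by
    have := (continuous_orbit e).measurable
    exact (hG.measurable.comp (measurable_subtype_coe.comp this)).mul (by fun_prop)
  have h0U (U : Orth V) : 0 ≤ G (orbit e U) * (‖A (orbit e U)‖ ^ k)⁻¹ :=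
    mul_nonneg (hG.nonneg hm _) (by positivity)
  have hrad := radI_pos (V := V) hm (by omega)
  have key (U : Orth V) : ∫⁻ x : V, ENNReal.ofReal (G (‖x‖ • (U : V →L[ℝ] V) e) * gauss (A (‖x‖ • (U : V →L[ℝ] V) e))) =
      ENNReal.ofReal (radI V m * (G (orbit e U) * (‖A (orbit e U)‖ ^ k)⁻¹)) := by
    have hne : (orbit e U : V) ≠ 0 := ne_zero_of_mem_unit_sphere _
    have ha : 0 < ‖A (orbit e U)‖ := norm_pos_iff.2 (by simpa using hne)
    have e1 (x : V) : G (‖x‖ • (U : V →L[ℝ] V) e) * gauss (A (‖x‖ • (U : V →L[ℝ] V) e)) =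
        G (orbit e U) * ((‖x‖ ^ m)⁻¹ * Real.exp (-Real.pi * (‖x‖ * ‖A (orbit e U)‖) ^ 2)) := by
      rcases eq_or_ne x 0 with rfl | hx
      · simp [hG.zero hm, show m ≠ 0 by omega]
      · rw [hG.hom _ (norm_pos_iff.2 hx), gauss, map_smul, norm_smul, norm_norm]
        change _ * G (orbit e U) * _ = _
        simp only [orbit]; ring
    have e2 := integral_gauss_dilate (V := V) (m := m) (by omega) ha
    have hpos : 0 < (‖A (orbit e U)‖ ^ (finrank ℝ V - m))⁻¹ * radI V m := by positivity
    have hInt : Integrable fun x : V => G (orbit e U) *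
        ((‖x‖ ^ m)⁻¹ * Real.exp (-Real.pi * (‖x‖ * ‖A (orbit e U)‖) ^ 2)) := by
      refine Integrable.const_mul ?_ _
      by_contra h
      rw [integral_undef h] at e2
      exact hpos.ne e2
    simp only [e1]
    rw [← ofReal_integral_eq_lintegral_ofReal hInt, integral_const_mul, e2, show finrank ℝ V - m = k by omega]
    · congr 1; ring
    · exact .of_forall fun x => mul_nonneg (hG.nonneg hm _) (by positivity)
  rw [← integral_const_mul, integral_eq_lintegral_of_nonneg_ae (.of_forall h0) hmeas.aestronglyMeasurable,
    integral_eq_lintegral_of_nonneg_ae (.of_forall fun U => mul_nonneg hrad.le (h0U U))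
      (hmU.const_mul _).aestronglyMeasurable,
    lintegral_polar hmeas.ennreal_ofReal he]
  simp only [key]

/-- The measure on the sphere with density `c • G` with respect to the rotation invariant one. -/
def dens (e : sphere (0 : V) 1) (G : V → ℝ) (c : ℝ) : Measure (sphere (0 : V) 1) :=
  ((haar V).withDensity fun U => ENNReal.ofReal (c * G (orbit e U))).map (orbit e)

theorem continuous_sphere {m : ℕ} {G : V → ℝ} (hG : PosHom m G) :
    Continuous fun θ : sphere (0 : V) 1 => G θ :=
  hG.cont.comp_continuous continuous_subtype_val fun θ => ne_zero_of_mem_unit_sphere θ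

theorem integral_dens (e : sphere (0 : V) 1) {m : ℕ} (hm : 1 ≤ m) {G : V → ℝ} (hG : PosHom m G) {c : ℝ}
    (hc : 0 ≤ c) (f : sphere (0 : V) 1 → ℝ) (hf : Measurable f) :
    ∫ θ, f θ ∂dens e G c = c * ∫ U : Orth V, G (orbit e U) * f (orbit e U) ∂haar V := by
  have hc0 := (continuous_orbit e)
  have hG' : Measurable fun U : Orth V => G (orbit e U) := ((continuous_sphere hG).comp hc0).measurable
  unfold dens
  rw [integral_map hc0.measurable.aemeasurable hf.aestronglyMeasurable,
    integral_withDensity_eq_integral_toReal_smul (hG'.const_mul _).ennreal_ofReal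
      (.of_forall fun _ => ENNReal.ofReal_lt_top), ← integral_const_mul]
  congr 1; ext U
  rw [ENNReal.toReal_ofReal (mul_nonneg hc (hG.nonneg hm _)), smul_eq_mul, mul_assoc]

theorem isFiniteMeasure_dens (e : sphere (0 : V) 1) {m : ℕ} {G : V → ℝ} (hG : PosHom m G) (c : ℝ) :
    IsFiniteMeasure (dens e G c) := by
  have hc0 : Continuous fun U : Orth V => c * G (orbit e U) :=
    continuous_const.mul ((continuous_sphere hG).comp (continuous_orbit e))
  have := isFiniteMeasure_withDensity_ofReal
    ((hc0.integrable_of_hasCompactSupport (μ := haar V) (HasCompactSupport.of_compactSpace _)).2)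
  unfold dens
  infer_instance

theorem gaussEq_iff_gaussRep {k m : ℕ} (hk : 1 ≤ k) (hm : 1 ≤ m) (hV : finrank ℝ V = k + m)
    {F G : V → ℝ} (hG : PosHom m G) (e : sphere (0 : V) 1) {c : ℝ} (hc : 0 ≤ c) :
    GaussEq F G c ↔ GaussRep k F (dens e G (c * radI V m)) := by
  have hrad := radI_pos (V := V) hm (by omega)
  have h1 (A' : V ≃L[ℝ] V) : ∫ θ : sphere (0 : V) 1, (‖A' θ‖ ^ k)⁻¹ ∂dens e G (c * radI V m) =
      c * ∫ x, G x * gauss (A' x) := by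
    rw [integral_dens e hm hG (by positivity) _ (by fun_prop), hG.integral_gauss_comp_eq hk hm hV A' e]
    ring
  have h2 (H : V → ℝ) (A : V ≃L[ℝ] V) : ∫ x, H (A x) * gauss x = (adet A)⁻¹ * ∫ x, H x * gauss (A.symm x) := by
    rw [← integral_comp_equiv A]; simp
  have h3 {A A' : V ≃L[ℝ] V} (h : Dual A A') : (adet A)⁻¹ = adet A' :=
    inv_eq_of_mul_eq_one_right h.adet_mul
  constructor
  · intro h A A' hA
    have := h A.symm A'.symm hA.symm
    rw [h2, h2, mul_inv_cancel_left₀ (adet_pos _).ne', adet_symm, inv_inv] at this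
    rw [h1, ← A.symm_symm, this, A'.symm_symm, A.symm_symm]
    have := hA.adet_mul
    linear_combination (c * ∫ x, G x * gauss (A' x)) * this
  · intro h A A' hA
    have := h A.symm A'.symm hA.symm
    rw [h1] at this
    rw [h2, h2, mul_inv_cancel_left₀ (adet_pos _).ne', h3 hA.swap, mul_left_comm, ← this, adet_symm,
      mul_inv_cancel_left₀ (adet_pos _).ne']

end EG

section Compactness
variable {V : Type*} [NormedAddCommGroup V] [InnerProductSpace ℝ V] [FiniteDimensional ℝ V]
  [MeasurableSpace V] [BorelSpace V]

theorem PosHom.integrable_gauss_comp {k : ℕ} (hk : 1 ≤ k) (hkV : k < finrank ℝ V) {F : V → ℝ}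
    (hF : PosHom k F) (A : V ≃L[ℝ] V) : Integrable fun x => F x * gauss (A x) :=
  hF.integrable_mul hk hkV (integrable_comp_equiv A integrable_gauss) (M := 1) fun x => by
    rw [abs_of_pos (gauss_pos _)]; exact gauss_le_one _

theorem PosHom.integral_gauss_mul_pos {k : ℕ} (hk : 1 ≤ k) (hkV : k < finrank ℝ V) {F : V → ℝ}
    (hF : PosHom k F) : 0 < ∫ x, F x * gauss x := by
  have : Nontrivial V := finrank_pos_iff (R := ℝ).1 (by omega)
  rw [integral_pos_iff_support_of_nonneg (fun x => mul_nonneg (hF.nonneg hk x) (gauss_pos _).le)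
    (by simpa using hF.integrable_gauss_comp hk hkV (.refl ℝ V))]
  have h1 : ({0}ᶜ : Set V) ⊆ Function.support fun x => F x * gauss x := fun x hx =>
    (mul_pos (hF.pos x hx) (gauss_pos x)).ne'
  exact (isOpen_compl_singleton.measure_pos _ (exists_ne (0 : V))).trans_le (measure_mono h1)

theorem PosHom.abs_sub_le {k : ℕ} (hk : 1 ≤ k) {F F' : V → ℝ} (hF : PosHom k F) (hF' : PosHom k F')
    {ε : ℝ} (h : ∀ θ ∈ sphere (0 : V) 1, |F θ - F' θ| ≤ ε) (x : V) :
    |F x - F' x| ≤ ε * (‖x‖ ^ k)⁻¹ := by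
  rcases eq_or_ne x 0 with rfl | hx
  · simp [hF.zero hk, hF'.zero hk, show k ≠ 0 by omega]
  · have h1 : ‖x‖⁻¹ • x ∈ sphere (0 : V) 1 := by simp [norm_smul, norm_ne_zero_iff.2 hx]
    have h0 : 0 ≤ (‖x‖ ^ k)⁻¹ := by positivity
    rw [hF.eq_dir hx, hF'.eq_dir hx, ← mul_sub, abs_mul, mul_comm, abs_of_nonneg h0]
    exact mul_le_mul_of_nonneg_right (h _ h1) h0

theorem continuous_norm_inv (A : V ≃L[ℝ] V) (k : ℕ) :
    Continuous fun θ : sphere (0 : V) 1 => (‖A θ‖ ^ k)⁻¹ := by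
  refine Continuous.inv₀ (by fun_prop) fun θ => pow_ne_zero _ (norm_ne_zero_iff.2 ?_)
  simpa using ne_zero_of_mem_unit_sphere θ

theorem exists_gaussRep_of_forall_approx {k : ℕ} (hk : 1 ≤ k) (hkV : k < finrank ℝ V) {F : V → ℝ}
    (hF : PosHom k F)
    (h : ∀ ε : ℝ, 0 < ε → ∃ F' : V → ℝ, PosHom k F' ∧ (∀ θ ∈ sphere (0 : V) 1, |F θ - F' θ| ≤ ε) ∧
      ∃ μ : Measure (sphere (0 : V) 1), IsFiniteMeasure μ ∧ GaussRep k F' μ) :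
    ∃ μ : Measure (sphere (0 : V) 1), IsFiniteMeasure μ ∧ GaussRep k F μ := by
  choose F' hF' hd μ hμ hR using fun j : ℕ => h (1 / ((j : ℝ) + 1)) (by positivity)
  have hlim (A : V ≃L[ℝ] V) : Filter.Tendsto (fun j => ∫ x, F' j x * gauss (A x)) Filter.atTop
      (nhds (∫ x, F x * gauss (A x))) := by
    rw [tendsto_iff_norm_sub_tendsto_zero]
    have hN := (PosHom.norm_inv (V := V) k).integrable_gauss_comp hk hkV A
    refine squeeze_zero (fun _ => norm_nonneg _) (g := fun j : ℕ => 1 / ((j : ℝ) + 1) *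
      ∫ x, (‖x‖ ^ k)⁻¹ * gauss (A x)) (fun j => ?_) ?_
    · rw [← integral_sub ((hF' j).integrable_gauss_comp hk hkV A) (hF.integrable_gauss_comp hk hkV A),
        ← integral_const_mul]
      refine norm_integral_le_of_norm_le (hN.const_mul _) (.of_forall fun x => ?_)
      rw [← sub_mul, norm_mul, Real.norm_of_nonneg (gauss_pos _).le, ← mul_assoc, norm_sub_rev]
      gcongr
      · exact (gauss_pos _).le
      · exact hF.abs_sub_le hk (hF' j) (hd j) x
    · simpa using tendsto_one_div_add_atTop_nhds_zero_nat.mul_const (∫ x : V, (‖x‖ ^ k)⁻¹ * gauss (A x))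
  have hrefl : Dual (.refl ℝ V) (.refl ℝ V : V ≃L[ℝ] V) := fun x y => rfl
  have hadet : adet (.refl ℝ V : V ≃L[ℝ] V) = 1 := by
    simpa using adet_orth (LinearIsometryEquiv.refl ℝ V)
  have hmass (j : ℕ) : ∫ x, F' j x * gauss x = (μ j).real Set.univ := by
    have := hR j _ _ hrefl
    simpa [hadet] using this
  have hm (j : ℕ) : 0 < (μ j).real Set.univ := (hmass j) ▸ (hF' j).integral_gauss_mul_pos hk hkV
  have hm' (j : ℕ) : NeZero (μ j) := ⟨fun h0 => by have := hm j; simp [h0] at this⟩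
  let P (j : ℕ) : ProbabilityMeasure (sphere (0 : V) 1) :=
    ⟨((μ j) Set.univ)⁻¹ • μ j, isProbabilityMeasureSMul⟩
  have hP (j : ℕ) (f : sphere (0 : V) 1 → ℝ) : ∫ θ, f θ ∂μ j = (μ j).real Set.univ * ∫ θ, f θ ∂(P j : Measure _) := by
    have : (P j : Measure _) = ((μ j) Set.univ)⁻¹ • μ j := rfl
    rw [this, integral_smul_measure, ENNReal.toReal_inv, smul_eq_mul]
    change _ = (μ j).real Set.univ * (((μ j).real Set.univ)⁻¹ * _)
    rw [mul_inv_cancel_left₀ (hm j).ne']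
  let u : Ultrafilter ℕ := Ultrafilter.of Filter.atTop
  have hu : (u : Filter ℕ) ≤ Filter.atTop := Ultrafilter.of_le _
  obtain ⟨Q, hQ⟩ : ∃ Q, Filter.Tendsto P u (nhds Q) :=
    ⟨(u.map P).lim, (u.map P).le_nhds_lim⟩
  rw [ProbabilityMeasure.tendsto_iff_forall_integral_tendsto] at hQ
  refine ⟨ENNReal.ofReal (∫ x, F x * gauss x) • (Q : Measure _),
    Measure.smul_finite _ ENNReal.ofReal_ne_top, fun A A' hA => ?_⟩
  have h1 := (hlim (.refl ℝ V)).mono_left hu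
  simp only [ContinuousLinearEquiv.coe_refl', id_eq, hmass] at h1
  have h2 := hQ (BoundedContinuousFunction.mkOfCompact ⟨_, continuous_norm_inv A' k⟩)
  have h3 := (((hlim A).mono_left hu).const_mul (adet A)).congr fun j => by
    rw [hR j A A' hA, hP]
  rw [integral_smul_measure, ENNReal.toReal_ofReal (hF.integral_gauss_mul_pos hk hkV).le]
  exact tendsto_nhds_unique h3 (h1.mul h2)

end Compactness

section Mollify
variable {V : Type*} [NormedAddCommGroup V] [InnerProductSpace ℝ V] [FiniteDimensional ℝ V]
  [MeasurableSpace V] [BorelSpace V]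

/-- Average of `F` over the orthogonal group with weight `ρ`. -/
def mol (ρ : Orth V → ℝ) (F : V → ℝ) (x : V) : ℝ := ∫ U : Orth V, ρ U * F ((U : V →L[ℝ] V) x) ∂haar V

theorem integrable_orth {f : Orth V → ℝ} (hf : Continuous f) : Integrable f (haar V) :=
  hf.integrable_of_hasCompactSupport (HasCompactSupport.of_compactSpace _)

theorem integral_orth_pos {f : Orth V → ℝ} (hf : Continuous f) (h0 : ∀ U, 0 ≤ f U) {W : Orth V} (h : f W ≠ 0) :
    0 < ∫ U, f U ∂haar V :=
  hf.integral_pos_of_hasCompactSupport_nonneg_nonzero (HasCompactSupport.of_compactSpace _) h0 h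

theorem continuous_parametric_orth {X : Type*} [TopologicalSpace X] [FirstCountableTopology X] [LocallyCompactSpace X]
    {f : X → Orth V → ℝ} (hf : Continuous f.uncurry) : Continuous fun x => ∫ U, f x U ∂haar V := by
  simpa using continuous_parametric_integral_of_continuous (μ := haar V) hf isCompact_univ

theorem PosHom.continuous_orth {d : ℕ} {F : V → ℝ} (hF : PosHom d F) {X : Type*} [TopologicalSpace X]
    {u : X → Orth V} (hu : Continuous u) {v : X → V} (hv : Continuous v) (h0 : ∀ x, v x ≠ 0) :
    Continuous fun x => F ((u x : V →L[ℝ] V) (v x)) :=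
  hF.cont.comp_continuous (by fun_prop) fun x => orth_ne_zero _ (h0 x)

theorem PosHom.mol {d : ℕ} {F : V → ℝ} (hF : PosHom d F) {ρ : Orth V → ℝ} (hρ : Continuous ρ)
    (h0 : ∀ U, 0 < ρ U) : PosHom d (mol ρ F) where
  pos x hx := by
    refine integral_orth_pos (W := 1) (hρ.mul (hF.continuous_orth continuous_id continuous_const fun _ => hx))
      (fun U => (mul_pos (h0 U) (hF.pos _ (orth_ne_zero U hx))).le) ?_
    exact (mul_pos (h0 1) (hF.pos _ (orth_ne_zero 1 hx))).ne'
  cont := by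
    rw [continuousOn_iff_continuous_domRestrict]
    have : LocallyCompactSpace ({0}ᶜ : Set V) := isOpen_compl_singleton.locallyCompactSpace
    exact continuous_parametric_orth (f := fun (x : ({0}ᶜ : Set V)) U => ρ U * F ((U : V →L[ℝ] V) x))
      ((hρ.comp continuous_snd).mul (hF.continuous_orth continuous_snd (continuous_subtype_val.comp continuous_fst)
        fun p => p.1.2))
  hom t ht x := by
    unfold KInt.mol
    rw [← integral_const_mul]
    congr 1; ext U
    rw [map_smul, hF.hom t ht]; ring

theorem continuous_orbit_uncurry : Continuous fun p : Orth V × sphere (0 : V) 1 => orbit p.2 p.1 :=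
  Continuous.subtype_mk (by fun_prop) _

theorem exists_mollifier [Nontrivial V] {d : ℕ} {F : V → ℝ} (hF : PosHom d F) {ε : ℝ} (hε : 0 < ε) :
    ∃ ρ : Orth V → ℝ, Continuous ρ ∧ (∀ U, 0 < ρ U) ∧ ∀ θ ∈ sphere (0 : V) 1, |F θ - mol ρ F θ| ≤ ε := by
  let g : Orth V × sphere (0 : V) 1 → ℝ := fun p => |F ((p.1 : V →L[ℝ] V) p.2) - F p.2|
  have hg : Continuous g := ((hF.continuous_orth continuous_fst (continuous_subtype_val.comp continuous_snd)
    fun p => ne_zero_of_mem_unit_sphere _).sub ((continuous_sphere hF).comp continuous_snd)).abs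
  obtain ⟨M, hM⟩ := (isCompact_range hg).bddAbove
  replace hM p : g p ≤ M := hM ⟨p, rfl⟩
  have h1 : ∀ᶠ U in nhds (1 : Orth V), ∀ θ ∈ (Set.univ : Set (sphere (0 : V) 1)), g (U, θ) < ε / 2 := by
    refine isCompact_univ.eventually_forall_of_forall_eventually fun θ _ => ?_
    refine hg.continuousAt.eventually_lt continuousAt_const ?_
    simpa [g] using half_pos hε
  obtain ⟨δ, hδ, hδ'⟩ := Metric.eventually_nhds_iff.1 h1
  let b : Orth V → ℝ := fun U => max 0 (δ - dist U 1)
  have hb : Continuous b := by fun_prop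
  have hb0 U : 0 ≤ b U := le_max_left _ _
  have hB : 0 < ∫ U, b U ∂haar V := integral_orth_pos hb hb0 (W := 1) (by simp [b, hδ.ne', hδ.le])
  set B := ∫ U, b U ∂haar V
  let η : ℝ := ε * B / (2 * (|M| + 1))
  have hη : 0 < η := by positivity
  let ρ : Orth V → ℝ := fun U => (B + η)⁻¹ * (b U + η)
  have hρ : Continuous ρ := by fun_prop
  have hρ1 : ∫ U, ρ U ∂haar V = 1 := by
    simp only [ρ, integral_const_mul]
    rw [integral_add (integrable_orth hb) (integrable_const _)]
    simp only [integral_const, probReal_univ, one_smul]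
    exact inv_mul_cancel₀ (by positivity)
  have hρ0 U : 0 < ρ U := mul_pos (by positivity) (by linarith [hb0 U])
  refine ⟨ρ, hρ, hρ0, fun θ hθ => ?_⟩
  have hθ0 : θ ≠ 0 := ne_zero_of_mem_unit_sphere ⟨θ, hθ⟩
  have hF1 : Continuous fun U : Orth V => F ((U : V →L[ℝ] V) θ) :=
    hF.continuous_orth continuous_id continuous_const fun _ => hθ0
  have e1 : mol ρ F θ - F θ = ∫ U, ρ U * (F ((U : V →L[ℝ] V) θ) - F θ) ∂haar V := by
    simp only [mul_sub]
    rw [integral_sub (f := fun U => ρ U * F ((U : V →L[ℝ] V) θ)) (g := fun U => ρ U * F θ)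
        (integrable_orth (hρ.mul hF1)) (integrable_orth (hρ.mul continuous_const)),
      integral_mul_const, hρ1, one_mul]
    rfl
  rw [abs_sub_comm, e1, ← Real.norm_eq_abs]
  have e2 : ∫ U, (B + η)⁻¹ * (b U * (ε / 2) + η * M) ∂haar V = (B + η)⁻¹ * (B * (ε / 2) + η * M) := by
    rw [integral_const_mul, integral_add (f := fun U => b U * (ε / 2)) (integrable_orth (hb.mul continuous_const)) (integrable_const _),
      integral_mul_const, integral_const, probReal_univ, one_smul]
  refine (norm_integral_le_of_norm_le (integrable_orth (f := fun U => (B + η)⁻¹ * (b U * (ε / 2) + η * M))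
    (by fun_prop)) (.of_forall fun U => ?_)).trans ?_
  · have h2 : g (U, ⟨θ, hθ⟩) ≤ M := hM _
    rw [norm_mul, Real.norm_of_nonneg (hρ0 U).le, mul_assoc, add_mul]
    change (B + η)⁻¹ * (b U * g (U, ⟨θ, hθ⟩) + η * g (U, ⟨θ, hθ⟩)) ≤ _
    refine mul_le_mul_of_nonneg_left (add_le_add ?_ (mul_le_mul_of_nonneg_left h2 hη.le)) (by positivity)
    rcases lt_or_ge (dist U 1) δ with h | h
    · exact mul_le_mul_of_nonneg_left (hδ' h _ trivial).le (hb0 U)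
    · have : b U = 0 := max_eq_left (by linarith)
      simp [this]
  · rw [e2, inv_mul_le_iff₀ (by positivity)]
    have h3 : η * M ≤ ε * B / 2 := by
      have h4 : η * (|M| + 1) = ε * B / 2 := by simp only [η]; field_simp
      have h5 : M ≤ |M| + 1 := by linarith [le_abs_self M]
      rw [← h4]; exact mul_le_mul_of_nonneg_left h5 hη.le
    nlinarith

theorem GaussRep.mol {k : ℕ} (hk : 1 ≤ k) (hkV : k < finrank ℝ V) {F : V → ℝ} (hF : PosHom k F)
    {μ : Measure (sphere (0 : V) 1)} (h : GaussRep k F μ) {ρ : Orth V → ℝ} (hρ : Continuous ρ)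
    {A A' : V ≃L[ℝ] V} (hA : Dual A A') :
    adet A * ∫ x, mol ρ F x * gauss (A x) =
      ∫ U : Orth V, ρ U * ∫ θ, (‖A' (orbit θ U⁻¹)‖ ^ k)⁻¹ ∂μ ∂haar V := by
  obtain ⟨C, hC, hFC⟩ := hF.abs_le hk
  obtain ⟨R, hR⟩ := (isCompact_range hρ.abs).bddAbove
  replace hR U : |ρ U| ≤ R := hR ⟨U, rfl⟩
  have hi : Integrable (fun p : Orth V × V => ρ p.1 * F ((p.1 : V →L[ℝ] V) p.2) * gauss (A p.2))
      ((haar V).prod volume) := by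
    have hN := ((PosHom.norm_inv (V := V) k).integrable_gauss_comp hk hkV A).comp_snd (haar V)
    refine (hN.const_mul (R * C)).mono' ?_ (.of_forall fun p => ?_)
    · refine Measurable.aestronglyMeasurable (((hρ.measurable.comp measurable_fst).mul
        (hF.measurable.comp continuous_act.measurable)).mul ?_)
      exact (continuous_gauss.comp A.continuous).measurable.comp measurable_snd
    · rw [norm_mul, norm_mul, Real.norm_of_nonneg (gauss_pos _).le, ← mul_assoc, mul_assoc R]
      have h2 := hFC ((p.1 : V →L[ℝ] V) p.2)
      rw [Unitary.norm_map] at h2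
      exact mul_le_mul_of_nonneg_right (mul_le_mul (hR _) h2 (abs_nonneg _) ((abs_nonneg _).trans (hR 1)))
        (gauss_pos _).le
  have e1 : ∫ x, KInt.mol ρ F x * gauss (A x) =
      ∫ U : Orth V, (∫ x, ρ U * F ((U : V →L[ℝ] V) x) * gauss (A x)) ∂haar V := by
    rw [integral_integral_swap hi]
    congr 1; ext x
    rw [KInt.mol, integral_mul_const]
  rw [e1, ← integral_const_mul]
  congr 1; ext U
  let T := (Unitary.linearIsometryEquiv U).toContinuousLinearEquiv
  have hT : adet T = 1 := adet_orth _
  have hD := (dual_orth (Unitary.linearIsometryEquiv U)).symm.trans hA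
  have h2 := h _ _ hD
  have e3 := integral_comp_equiv T fun x => F x * gauss (A (T.symm x))
  simp only [ContinuousLinearEquiv.symm_apply_apply, hT, inv_one, one_mul] at e3
  rw [adet_trans, adet_symm, hT, inv_one, one_mul] at h2
  simp only [mul_assoc, integral_const_mul]
  rw [mul_left_comm]
  congr 1
  change adet A * ∫ x, F (T x) * gauss (A x) = _
  rw [e3]
  exact h2

end Mollify

section Density
variable {V : Type*} [NormedAddCommGroup V] [InnerProductSpace ℝ V] [FiniteDimensional ℝ V]
  [MeasurableSpace V] [BorelSpace V]

theorem orbit_mul (e : sphere (0 : V) 1) (U W : Orth V) : orbit e (U * W) = orbit (orbit e W) U := rfl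

theorem continuous_orbit_inv : Continuous fun p : Orth V × sphere (0 : V) 1 => orbit p.2 p.1⁻¹ :=
  continuous_orbit_uncurry.comp (continuous_fst.inv.prodMk continuous_snd)

/-- The convolution of a weight on the orthogonal group with a measure on the sphere. -/
def convMeasure (ρ : Orth V → ℝ) (μ : Measure (sphere (0 : V) 1)) : Measure (sphere (0 : V) 1) :=
  (((haar V).withDensity fun U => ENNReal.ofReal (ρ U)).prod μ).map fun p => orbit p.2 p.1⁻¹

theorem isFiniteMeasure_withDensity_orth {ρ : Orth V → ℝ} (hρ : Continuous ρ) :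
    IsFiniteMeasure ((haar V).withDensity fun U => ENNReal.ofReal (ρ U)) :=
  isFiniteMeasure_withDensity_ofReal (integrable_orth hρ).2

theorem isFiniteMeasure_convMeasure {ρ : Orth V → ℝ} (hρ : Continuous ρ) (μ : Measure (sphere (0 : V) 1))
    [IsFiniteMeasure μ] : IsFiniteMeasure (convMeasure ρ μ) := by
  have := isFiniteMeasure_withDensity_orth hρ
  unfold convMeasure; infer_instance

theorem integral_convMeasure {ρ : Orth V → ℝ} (hρ : Continuous ρ) (h0 : ∀ U, 0 < ρ U)
    (μ : Measure (sphere (0 : V) 1)) [IsFiniteMeasure μ] {f : sphere (0 : V) 1 → ℝ} (hf : Continuous f) :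
    ∫ θ, f θ ∂convMeasure ρ μ = ∫ U : Orth V, ρ U * ∫ θ, f (orbit θ U⁻¹) ∂μ ∂haar V := by
  have := isFiniteMeasure_withDensity_orth hρ
  unfold convMeasure
  rw [integral_map continuous_orbit_inv.measurable.aemeasurable hf.aestronglyMeasurable,
    integral_prod, integral_withDensity_eq_integral_toReal_smul hρ.measurable.ennreal_ofReal
      (.of_forall fun _ => ENNReal.ofReal_lt_top)]
  · congr 1; ext U
    rw [ENNReal.toReal_ofReal (h0 U).le, smul_eq_mul]
  · exact (hf.comp continuous_orbit_inv).integrable_of_hasCompactSupport (HasCompactSupport.of_compactSpace _)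

theorem convMeasure_absolutelyContinuous (ρ : Orth V → ℝ) (μ : Measure (sphere (0 : V) 1))
    [IsFiniteMeasure μ] (hρ : Continuous ρ) (e : sphere (0 : V) 1) :
    convMeasure ρ μ ≪ (haar V).map (orbit e) := by
  have := isFiniteMeasure_withDensity_orth hρ
  refine Measure.AbsolutelyContinuous.mk fun N hN h => ?_
  rw [Measure.map_apply (continuous_orbit e).measurable hN] at h
  unfold convMeasure
  rw [Measure.map_apply continuous_orbit_inv.measurable hN,
    Measure.prod_apply_symm (continuous_orbit_inv.measurable hN), lintegral_eq_zero_iff']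
  · refine .of_forall fun θ => ?_
    refine withDensity_absolutelyContinuous _ _ ?_
    obtain ⟨Z, rfl⟩ := surjective_orbit e θ
    have h1 : (haar V) ((fun U => U * Z) ⁻¹' (orbit e ⁻¹' N)) = 0 := by
      rw [measure_preimage_mul_right, h]
    have h2 : (fun U : Orth V => (U, orbit e Z)) ⁻¹' ((fun p : Orth V × sphere (0 : V) 1 => orbit p.2 p.1⁻¹) ⁻¹' N) =
        Inv.inv ⁻¹' ((fun U => U * Z) ⁻¹' (orbit e ⁻¹' N)) := by
      ext U; simp only [Set.mem_preimage, orbit_mul]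
    rw [h2]
    exact (quasiMeasurePreserving_inv (haar V)).preimage_null h1
  · exact (measurable_measure_prodMk_right (continuous_orbit_inv.measurable hN)).aemeasurable

theorem exists_density {μ : Measure (sphere (0 : V) 1)} [IsFiniteMeasure μ] {e : sphere (0 : V) 1}
    (h : μ ≪ (haar V).map (orbit e)) :
    ∃ q : sphere (0 : V) 1 → ℝ, Measurable q ∧ (∀ θ, 0 ≤ q θ) ∧
      Integrable (fun W => q (orbit e W)) (haar V) ∧
      ∀ f : sphere (0 : V) 1 → ℝ, Continuous f →
        ∫ θ, f θ ∂μ = ∫ W, q (orbit e W) * f (orbit e W) ∂haar V := by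
  have hm := (continuous_orbit e).measurable
  have hfin : IsFiniteMeasure ((haar V).map (orbit e)) := inferInstance
  have hLD : μ.HaveLebesgueDecomposition ((haar V).map (orbit e)) :=
    Measure.haveLebesgueDecomposition_of_sigmaFinite _ _
  have hq : Measurable fun θ => (μ.rnDeriv ((haar V).map (orbit e)) θ).toReal :=
    (Measure.measurable_rnDeriv _ _).ennreal_toReal
  refine ⟨_, hq, fun θ => ENNReal.toReal_nonneg, ?_, fun f hf => ?_⟩
  · have h1 : Integrable (fun θ => (μ.rnDeriv ((haar V).map (orbit e)) θ).toReal) ((haar V).map (orbit e)) :=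
      Measure.integrable_toReal_rnDeriv
    exact (integrable_map_measure hq.aestronglyMeasurable hm.aemeasurable).1 h1
  · have h1 : Measurable fun θ => (μ.rnDeriv ((haar V).map (orbit e)) θ).toReal * f θ := hq.mul hf.measurable
    rw [← integral_toReal_rnDeriv_mul h, integral_map hm.aemeasurable h1.aestronglyMeasurable]

theorem exists_continuous_density {q : sphere (0 : V) 1 → ℝ} (hq : Measurable q) (hq0 : ∀ θ, 0 ≤ q θ)
    {e : sphere (0 : V) 1} (hi : Integrable (fun W => q (orbit e W)) (haar V))
    (hpos : 0 < ∫ W, q (orbit e W) ∂haar V) {ρ : Orth V → ℝ} (hρ : Continuous ρ) (h0 : ∀ U, 0 < ρ U) :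
    ∃ G : sphere (0 : V) 1 → ℝ, Continuous G ∧ (∀ θ, 0 < G θ) ∧
      ∀ f : sphere (0 : V) 1 → ℝ, Continuous f →
        ∫ U : Orth V, ρ U * (∫ W, q (orbit e W) * f (orbit (orbit e W) U⁻¹) ∂haar V) ∂haar V =
          ∫ W, G (orbit e W) * f (orbit e W) ∂haar V := by
  obtain ⟨R, hR⟩ := (isCompact_range hρ.abs).bddAbove
  replace hR U : |ρ U| ≤ R := hR ⟨U, rfl⟩
  obtain ⟨U₀, -, hU₀⟩ := isCompact_univ.exists_isMinOn ⟨(1 : Orth V), trivial⟩ hρ.continuousOn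
  have hmin U : ρ U₀ ≤ ρ U := hU₀ trivial
  have hqm : Measurable fun W => q (orbit e W) := hq.comp (continuous_orbit e).measurable
  let G : sphere (0 : V) 1 → ℝ := fun ξ => ∫ U, ρ U * q (orbit ξ U) ∂haar V
  have hG (W : Orth V) : G (orbit e W) = ∫ U, ρ (U * W⁻¹) * q (orbit e U) ∂haar V := by
    rw [← integral_mul_right_eq_self _ W]
    simp only [mul_inv_cancel_right, orbit_mul, G]
  have hGi (W : Orth V) : Integrable (fun U => ρ (U * W⁻¹) * q (orbit e U)) (haar V) :=
    hi.bdd_mul (c := R) (by fun_prop) (.of_forall fun U => hR _)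
  have hcont : Continuous fun W => G (orbit e W) := by
    simp only [hG]
    refine continuous_of_dominated (bound := fun U => R * q (orbit e U)) (fun W => (hGi W).1)
      (fun W => .of_forall fun U => ?_) (hi.const_mul R) (.of_forall fun U => by fun_prop)
    rw [norm_mul, Real.norm_of_nonneg (hq0 _)]
    exact mul_le_mul_of_nonneg_right (hR _) (hq0 _)
  have hquot : Topology.IsQuotientMap (orbit e) :=
    (continuous_orbit e).isClosedMap.isQuotientMap (continuous_orbit e) (surjective_orbit e)
  refine ⟨G, hquot.continuous_iff.2 hcont, fun θ => ?_, fun f hf => ?_⟩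
  · obtain ⟨W, rfl⟩ := surjective_orbit e θ
    rw [hG]
    refine lt_of_lt_of_le (mul_pos (h0 U₀) hpos) ?_
    rw [← integral_const_mul]
    exact integral_mono (hi.const_mul _) (hGi W) fun U => mul_le_mul_of_nonneg_right (hmin _) (hq0 _)
  · obtain ⟨M, hM⟩ := (isCompact_range hf.abs).bddAbove
    replace hM U : |f U| ≤ M := hM ⟨U, rfl⟩
    have h1 (U : Orth V) : ∫ W, q (orbit e W) * f (orbit (orbit e W) U⁻¹) ∂haar V =
        ∫ W, q (orbit e (U * W)) * f (orbit e W) ∂haar V := by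
      rw [← integral_mul_left_eq_self _ U]
      simp only [← orbit_mul, inv_mul_cancel_left]
    have h2 : Integrable (fun p : Orth V × Orth V => ρ p.1 * (q (orbit e (p.1 * p.2)) * f (orbit e p.2)))
        ((haar V).prod (haar V)) := by
      have h3 := (measurePreserving_prod_mul (haar V) (haar V)).integrable_comp_of_integrable
        (hi.comp_snd (haar V))
      have h4 : Continuous fun p : Orth V × Orth V => ρ p.1 * f (orbit e p.2) :=
        (hρ.comp continuous_fst).mul (hf.comp ((continuous_orbit e).comp continuous_snd))
      refine (h3.bdd_mul (c := R * M) h4.aestronglyMeasurable (.of_forall fun p => ?_)).congr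
        (.of_forall fun p => ?_)
      · rw [norm_mul]
        exact mul_le_mul (hR _) (hM _) (abs_nonneg _) ((abs_nonneg _).trans (hR 1))
      · simp only [Function.comp_apply]; ring
    simp only [h1, ← integral_const_mul]
    rw [integral_integral_swap h2]
    congr 1; ext W
    rw [← integral_mul_const]
    congr 1; ext U
    rw [orbit_mul]; ring

theorem exists_posHom_extension (m : ℕ) {G : sphere (0 : V) 1 → ℝ} (hG : Continuous G) (h0 : ∀ θ, 0 < G θ) :
    ∃ G' : V → ℝ, PosHom m G' ∧ ∀ θ : sphere (0 : V) 1, G' θ = G θ := by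
  classical
  have hmem (x : V) (hx : x ≠ 0) : ‖x‖⁻¹ • x ∈ sphere (0 : V) 1 := by
    simp [norm_smul, norm_ne_zero_iff.2 hx]
  refine ⟨fun x => if hx : x ≠ 0 then (‖x‖ ^ m)⁻¹ * G ⟨‖x‖⁻¹ • x, hmem x hx⟩ else 0, ⟨?_, ?_, ?_⟩, fun θ => ?_⟩
  · intro x hx
    have := norm_pos_iff.2 hx
    simp only [hx, ne_eq, not_false_eq_true, dif_pos]
    exact mul_pos (by positivity) (h0 _)
  · rw [continuousOn_iff_continuous_domRestrict]
    have h1 (x : ({0}ᶜ : Set V)) : (x : V) ≠ 0 := x.2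
    have h2 : Continuous fun x : ({0}ᶜ : Set V) => ‖(x : V)‖⁻¹ :=
      Continuous.inv₀ (by fun_prop) fun x => norm_ne_zero_iff.2 (h1 x)
    have : Continuous fun x : ({0}ᶜ : Set V) => (‖(x : V)‖ ^ m)⁻¹ * G ⟨‖(x : V)‖⁻¹ • (x : V), hmem x (h1 x)⟩ := by
      refine Continuous.mul (Continuous.inv₀ (by fun_prop) fun x => pow_ne_zero _ (norm_ne_zero_iff.2 (h1 x))) ?_
      exact hG.comp (Continuous.subtype_mk (h2.smul continuous_subtype_val) _)
    refine this.congr fun x => ?_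
    simp [h1 x]
  · intro t ht x
    rcases eq_or_ne x 0 with rfl | hx
    · simp
    · have htx : t • x ≠ 0 := smul_ne_zero ht.ne' hx
      have e1 : (⟨‖t • x‖⁻¹ • t • x, hmem _ htx⟩ : sphere (0 : V) 1) = ⟨‖x‖⁻¹ • x, hmem x hx⟩ := by
        refine Subtype.ext ?_
        simp only [smul_smul, norm_smul, Real.norm_of_nonneg ht.le]
        congr 1
        field_simp
      simp only [hx, htx, ne_eq, not_false_eq_true, dif_pos]
      rw [e1, ← mul_assoc, ← mul_inv, norm_smul, Real.norm_of_nonneg ht.le, mul_pow]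
  · have := ne_zero_of_mem_unit_sphere θ
    simp [this]

theorem GaussRep.exists_gaussEq [Nontrivial V] {k m : ℕ} (hk : 1 ≤ k) (hm : 1 ≤ m) (hV : finrank ℝ V = k + m)
    {F : V → ℝ} (hF : PosHom k F) {μ : Measure (sphere (0 : V) 1)} [IsFiniteMeasure μ] (h : GaussRep k F μ)
    {ε : ℝ} (hε : 0 < ε) :
    ∃ F' G : V → ℝ, ∃ c : ℝ, 0 < c ∧ PosHom k F' ∧ PosHom m G ∧
      (∀ θ ∈ sphere (0 : V) 1, |F θ - F' θ| ≤ ε) ∧ GaussEq F' G c := by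
  obtain ⟨e⟩ : Nonempty (sphere (0 : V) 1) :=
    (NormedSpace.sphere_nonempty.2 zero_le_one).to_subtype
  have hkV : k < finrank ℝ V := by omega
  have hrad := radI_pos (V := V) hm (by omega)
  obtain ⟨ρ₁, hc₁, hp₁, hd₁⟩ := exists_mollifier hF (half_pos hε)
  have hF₁ := hF.mol hc₁ hp₁
  obtain ⟨ρ₂, hc₂, hp₂, hd₂⟩ := exists_mollifier hF₁ (half_pos hε)
  have hF₂ := hF₁.mol hc₂ hp₂
  have hfin := isFiniteMeasure_convMeasure hc₁ μ
  have h₁ : GaussRep k (KInt.mol ρ₁ F) (convMeasure ρ₁ μ) := fun A A' hA => by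
    rw [h.mol hk hkV hF hc₁ hA, integral_convMeasure hc₁ hp₁ μ (continuous_norm_inv A' k)]
  obtain ⟨q, hq, hq0, hqi, hqf⟩ := exists_density (convMeasure_absolutelyContinuous ρ₁ μ hc₁ e)
  have hpos : 0 < ∫ W, q (orbit e W) ∂haar V := by
    have h2 := hqf (fun _ => 1) continuous_const
    simp only [mul_one] at h2
    rw [← h2]
    have h3 := h₁ (.refl ℝ V) (.refl ℝ V) (fun x y => rfl)
    simp only [ContinuousLinearEquiv.coe_refl', id_eq, norm_eq_of_mem_sphere, one_pow, inv_one] at h3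
    rw [← h3]
    exact mul_pos (adet_pos _) (hF₁.integral_gauss_mul_pos hk hkV)
  obtain ⟨G, hG, hG0, hGf⟩ := exists_continuous_density hq hq0 hqi hpos hc₂ hp₂
  obtain ⟨G', hG', hGG'⟩ := exists_posHom_extension m hG hG0
  refine ⟨KInt.mol ρ₂ (KInt.mol ρ₁ F), G', (radI V m)⁻¹, inv_pos.2 hrad, hF₂, hG', fun θ hθ => ?_, ?_⟩
  · have := abs_add_le (F θ - KInt.mol ρ₁ F θ) (KInt.mol ρ₁ F θ - KInt.mol ρ₂ (KInt.mol ρ₁ F) θ)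
    rw [sub_add_sub_cancel] at this
    linarith [hd₁ θ hθ, hd₂ θ hθ]
  · rw [gaussEq_iff_gaussRep hk hm hV hG' e (inv_pos.2 hrad).le, inv_mul_cancel₀ hrad.ne']
    intro A A' hA
    rw [h₁.mol hk hkV hF₁ hc₂ hA, integral_dens e hm hG' zero_le_one _ (by fun_prop), one_mul]
    simp only [hGG']
    rw [← hGf _ (continuous_norm_inv A' k)]
    refine integral_congr_ae (.of_forall fun U => ?_)
    have hw := (continuous_norm_inv A' k).comp (continuous_orbit_inv.comp ((continuous_const (y := U)).prodMk continuous_id))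
    exact congrArg (ρ₂ U * ·) (hqf _ hw)

end Density

section Main
variable {n : ℕ}

theorem SecEq.const_mul {V V₁ V₂ : Type*} [NormedAddCommGroup V] [InnerProductSpace ℝ V] [FiniteDimensional ℝ V]
    [MeasurableSpace V] [BorelSpace V]
    [NormedAddCommGroup V₁] [InnerProductSpace ℝ V₁] [FiniteDimensional ℝ V₁] [MeasurableSpace V₁] [BorelSpace V₁]
    [NormedAddCommGroup V₂] [InnerProductSpace ℝ V₂] [FiniteDimensional ℝ V₂] [MeasurableSpace V₂] [BorelSpace V₂]
    {J : WithLp 2 (V₁ × V₂) ≃ₗᵢ[ℝ] V} {k m : ℕ} {F G : V → ℝ} {c c' : ℝ} (hc' : c' ≠ 0) (h : SecEq J k m F G c) :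
    SecEq J k m F (fun x => c / c' * G x) c' := fun U => by
  have : tot m (fun w => c / c' * G (U (inr J w))) = c / c' * tot m (fun w => G (U (inr J w))) := by
    simp only [tot, mul_assoc]
    rw [integral_const_mul]
  rw [h U, this, ← mul_assoc, mul_div_cancel₀ _ hc']

theorem abs_pow_sub_pow_le_of_bound {k : ℕ} {M δ a b : ℝ} (hδ : δ ≤ 1) (ha : |a| ≤ M) (h : |a - b| ≤ δ) :
    |a ^ k - b ^ k| ≤ δ * (k * (M + 1) ^ (k - 1)) := by
  have hb : |b| ≤ M + 1 := by
    have := abs_sub_abs_le_abs_sub b a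
    rw [abs_sub_comm] at this; linarith
  have hM : 0 ≤ M := (abs_nonneg a).trans ha
  refine (abs_pow_sub_pow_le a b k).trans ?_
  rw [mul_assoc]
  have := max_le (ha.trans (by linarith : M ≤ M + 1)) hb
  have h0 : 0 ≤ max |a| |b| := (abs_nonneg a).trans (le_max_left _ _)
  have : 0 ≤ δ := (abs_nonneg _).trans h
  gcongr

theorem abs_sub_pow_le {k : ℕ} (hk : 1 ≤ k) {a b : ℝ} (ha : 0 ≤ a) (hb : 0 ≤ b) : |a - b| ^ k ≤ |a ^ k - b ^ k| := by
  have key : ∀ {a b : ℝ}, 0 ≤ b → b ≤ a → |a - b| ^ k ≤ |a ^ k - b ^ k| := fun {a b} hb hab => by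
    rw [abs_of_nonneg (sub_nonneg.2 hab), abs_of_nonneg (sub_nonneg.2 (pow_le_pow_left₀ hb hab k))]
    have := pow_add_pow_le (sub_nonneg.2 hab) hb (n := k) (by omega)
    rw [sub_add_cancel] at this; linarith
  rcases le_total b a with h | h
  · exact key hb h
  · rw [abs_sub_comm, abs_sub_comm (a ^ k)]; exact key ha h

theorem isKIntBody_iff_gaussRep {k : ℕ} (hk : 1 ≤ k) (hkn : k < n) {D : Set (Euc n)} (hD : IsStarBody D) :
    IsKIntBody n k D ↔ ∃ μ : Measure (sphere (0 : Euc n) 1), IsFiniteMeasure μ ∧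
      GaussRep k (fun x => radialFn D x ^ k) μ := by
  obtain ⟨J⟩ := exists_frame hkn
  obtain ⟨c₀, hc₀, H⟩ := exists_isKIntBodyOf_iff hk hkn J
  have hm : 1 ≤ n - k := by omega
  have hnV : finrank ℝ (Euc n) = n := finrank_euclideanSpace_fin
  have hV : finrank ℝ (Euc n) = k + (n - k) := by omega
  have hkV : k < finrank ℝ (Euc n) := by omega
  have hmV : n - k < finrank ℝ (Euc n) := by omega
  have i1 : Nontrivial (Euc k) := finrank_pos_iff (R := ℝ).1 (by rw [finrank_euclideanSpace_fin]; omega)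
  have i2 : Nontrivial (Euc (n - k)) := finrank_pos_iff (R := ℝ).1 (by rw [finrank_euclideanSpace_fin]; omega)
  have i3 : Nontrivial (Euc n) := finrank_pos_iff (R := ℝ).1 (by rw [finrank_euclideanSpace_fin]; omega)
  have r1 := radI_pos (V := Euc n) hk hkV
  have r2 := radI_pos (V := Euc n) hm hmV
  have hF := hD.posHom k
  constructor
  · rintro ⟨-, h⟩
    refine exists_gaussRep_of_forall_approx hk hkV hF fun ε hε => ?_
    obtain ⟨a, M, ha, hM, hb⟩ := (hD.posHom 1).bounds
    have hK : 0 < (k : ℝ) * (M + 1) ^ (k - 1) := by positivity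
    obtain ⟨D', L, hD', hL, hDL, hd⟩ := h (min 1 (ε / (k * (M + 1) ^ (k - 1)))) (by positivity)
    refine ⟨_, hD'.posHom k, fun θ hθ => ?_, ?_⟩
    · have hθ0 : θ ≠ 0 := by rintro rfl; simp at hθ
      have h1 : ‖θ‖ = 1 := by simpa using hθ
      have hbd : |radialFn D θ| ≤ M := by
        have := (hb θ hθ0).2
        have h0 := (hD.posHom 1).pos θ hθ0
        simp only [pow_one, h1, inv_one, mul_one] at this h0
        rwa [abs_of_pos h0]
      refine (abs_pow_sub_pow_le_of_bound (min_le_left _ _) hbd (hd θ hθ)).trans ?_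
      calc _ ≤ ε / (k * (M + 1) ^ (k - 1)) * (k * (M + 1) ^ (k - 1)) := by gcongr; exact min_le_right _ _
        _ = ε := by field_simp
    · rw [hD'.eq_body hk, hL.eq_body hm, H (hD'.posHom k) (hL.posHom (n - k))] at hDL
      have hG := hDL.gaussEq hk hm finrank_euclideanSpace_fin finrank_euclideanSpace_fin hkV hmV (hD'.posHom k) (hL.posHom _)
      obtain ⟨e⟩ : Nonempty (sphere (0 : Euc n) 1) := (NormedSpace.sphere_nonempty.2 zero_le_one).to_subtype
      have hc : 0 ≤ c₀ * radI (Euc n) k / radI (Euc n) (n - k) := by positivity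
      exact ⟨_, isFiniteMeasure_dens e (hL.posHom (n - k)) _, (gaussEq_iff_gaussRep hk hm hV (hL.posHom _) e hc).1 hG⟩
  · rintro ⟨μ, hμ, h⟩
    refine ⟨hD, fun ε hε => ?_⟩
    obtain ⟨F', G, c, hc, hF', hG, hd, hE⟩ := h.exists_gaussEq hk hm hV hF (pow_pos hε k)
    have hS := (hE.secEq (J := J) finrank_euclideanSpace_fin finrank_euclideanSpace_fin hkV hmV hF' hG).const_mul hc₀.ne'
    have hG' := hG.const_mul (c := c * radI (Euc n) (n - k) / radI (Euc n) k / c₀) (by positivity)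
    obtain ⟨s1, s2⟩ := hF'.starBody_body hk
    refine ⟨body F', body _, s1, (hG'.starBody_body hm).1, (H hF' hG').2 hS, fun ξ hξ => ?_⟩
    have h1 := hd ξ hξ
    rw [← s2] at h1
    refine le_of_pow_le_pow_left₀ (by omega) hε.le ((abs_sub_pow_le hk ?_ ?_).trans h1)
    · exact inv_nonneg.2 (gauge_nonneg _)
    · exact inv_nonneg.2 (gauge_nonneg _)

end Main

section Schwartz
variable {V : Type*} [NormedAddCommGroup V] [InnerProductSpace ℝ V] [FiniteDimensional ℝ V]
  [MeasurableSpace V] [BorelSpace V]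

theorem exists_pow_mul_exp_le (N : ℕ) : ∃ C : ℝ, ∀ t : ℝ, 0 ≤ t → (1 + t) ^ N * Real.exp (-Real.pi * t ^ 2) ≤ C := by
  refine ⟨N.factorial * Real.exp (1 + 1), fun t ht => ?_⟩
  have h1 := Real.pow_div_factorial_le_exp (1 + t) (by positivity) N
  rw [div_le_iff₀ (by positivity)] at h1
  calc (1 + t) ^ N * Real.exp (-Real.pi * t ^ 2)
      ≤ (Real.exp (1 + t) * N.factorial) * Real.exp (-Real.pi * t ^ 2) := by gcongr
    _ = N.factorial * Real.exp (1 + t + -Real.pi * t ^ 2) := by rw [Real.exp_add (1 + t)]; ring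
    _ ≤ _ := by
      gcongr ?_ * Real.exp ?_
      nlinarith [Real.pi_gt_three, sq_nonneg (t - 1), sq_nonneg t]

theorem gauss_schwartz_bound (k n : ℕ) :
    ∃ C : ℝ, ∀ x : V, ‖x‖ ^ k * ‖iteratedFDeriv ℝ n (gauss : V → ℝ) x‖ ≤ C := by
  have hf : (fun x : V => -Real.pi * ‖x‖ ^ 2).HasTemperateGrowth :=
    (Function.HasTemperateGrowth.const (-Real.pi)).mul (Function.hasTemperateGrowth_norm_sq V)
  obtain ⟨p, K, hK, H⟩ := hf.norm_iteratedFDeriv_le_uniform n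
  obtain ⟨C, hC⟩ := exists_pow_mul_exp_le (k + p * n)
  refine ⟨n.factorial * (K + 1) ^ n * C, fun x => ?_⟩
  have hD : 1 ≤ (K + 1) * (1 + ‖x‖) ^ p :=
    one_le_mul_of_one_le_of_one_le (by linarith) (one_le_pow₀ (by linarith [norm_nonneg x]))
  have key := norm_iteratedFDeriv_comp_le (𝕜 := ℝ) (g := Real.exp) (f := fun x : V => -Real.pi * ‖x‖ ^ 2) (n := n)
    (N := (⊤ : ℕ∞)) Real.contDiff_exp hf.1 (by exact_mod_cast le_top) x (C := Real.exp (-Real.pi * ‖x‖ ^ 2))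
    (D := (K + 1) * (1 + ‖x‖) ^ p) (fun i _ => ?_) (fun i h1 hi => ?_)
  · calc ‖x‖ ^ k * ‖iteratedFDeriv ℝ n (gauss : V → ℝ) x‖
        ≤ (1 + ‖x‖) ^ k * (n.factorial * Real.exp (-Real.pi * ‖x‖ ^ 2) * ((K + 1) * (1 + ‖x‖) ^ p) ^ n) := by
          gcongr
          · linarith
          · exact key
      _ = n.factorial * (K + 1) ^ n * ((1 + ‖x‖) ^ (k + p * n) * Real.exp (-Real.pi * ‖x‖ ^ 2)) := by
          rw [mul_pow, pow_add, pow_mul]; ring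
      _ ≤ _ := by
          gcongr
          exact hC _ (norm_nonneg x)
  · rw [norm_iteratedFDeriv_eq_norm_iteratedDeriv, iteratedDeriv_eq_iterate, Real.iter_deriv_exp,
      Real.norm_of_nonneg (Real.exp_pos _).le]
  · calc _ ≤ K * (1 + ‖x‖) ^ p := H i hi x
      _ ≤ (K + 1) * (1 + ‖x‖) ^ p := by gcongr; linarith
      _ ≤ _ := le_self_pow₀ hD (by omega)

/-- The Gaussian as a Schwartz function. -/
def gaussSchwartz : SchwartzMap V ℝ where
  toFun := gauss
  smooth' := by
    unfold gauss
    exact Real.contDiff_exp.comp (contDiff_const.mul (contDiff_norm_sq ℝ))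
  decay' := gauss_schwartz_bound

/-- The Gaussian composed with a linear isomorphism, as a complex Schwartz function. -/
def gaussComp (A : V ≃L[ℝ] V) : SchwartzMap V ℂ :=
  SchwartzMap.compCLMOfContinuousLinearEquiv ℝ A (gaussSchwartz.postcompCLM Complex.ofRealCLM)

theorem gaussComp_apply (A : V ≃L[ℝ] V) (x : V) : gaussComp A x = (gauss (A x) : ℂ) := rfl

theorem fourier_gauss (ξ : V) : 𝓕 (fun x : V => (gauss x : ℂ)) ξ = gauss ξ := by
  have h := fourier_gaussian_innerProductSpace (V := V) (b := (Real.pi : ℂ)) (by simpa using Real.pi_pos) ξ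
  have hp : (Real.pi : ℂ) ≠ 0 := by exact_mod_cast Real.pi_ne_zero
  rw [div_self hp, Complex.one_cpow, one_mul] at h
  have e : (fun x : V => (gauss x : ℂ)) = fun v => Complex.exp (-Real.pi * ‖v‖ ^ 2) := by
    ext x; simp [gauss]
  rw [e, h]
  simp only [gauss, Complex.ofReal_exp]
  congr 1
  push_cast
  field_simp

theorem integral_comp_equiv_complex (A : V ≃L[ℝ] V) (f : V → ℂ) :
    ∫ x, f (A x) = ((adet A)⁻¹ : ℝ) • ∫ x, f x := by
  have h := A.toHomeomorph.measurableEmbedding.integral_map (μ := volume) f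
  refine h.symm.trans ?_
  change ∫ y, f y ∂(Measure.map A volume) = _
  rw [map_volume, integral_smul_measure, ENNReal.toReal_ofReal (inv_nonneg.2 (adet_pos A).le)]

theorem fourier_comp_equiv {A A' : V ≃L[ℝ] V} (h : Dual A A') (f : V → ℂ) (ξ : V) :
    𝓕 (fun x => f (A x)) ξ = ((adet A)⁻¹ : ℝ) • 𝓕 f (A' ξ) := by
  rw [Real.fourier_eq, Real.fourier_eq, ← integral_comp_equiv_complex A]
  simp only [h _ _]

theorem fourier_gaussComp {A A' : V ≃L[ℝ] V} (h : Dual A A') (ξ : V) :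
    𝓕 (⇑(gaussComp A)) ξ = (((adet A)⁻¹ * gauss (A' ξ) : ℝ) : ℂ) := by
  refine (fourier_comp_equiv h (fun y : V => (gauss y : ℂ)) ξ).trans ?_
  rw [fourier_gauss]
  simp

/-- Rapid decay. -/
def Decay (f : V → ℂ) : Prop := ∀ N : ℕ, ∃ C : ℝ, 0 < C ∧ ∀ x, ‖f x‖ ≤ C * ((1 + ‖x‖) ^ N)⁻¹

theorem decay_schwartz (f : SchwartzMap V ℂ) : Decay (f : V → ℂ) := fun N => by
  refine ⟨2 ^ N * ((Finset.Iic (N, 0)).sup fun m => SchwartzMap.seminorm ℝ m.1 m.2) f + 1, by positivity, fun x => ?_⟩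
  have := SchwartzMap.one_add_le_sup_seminorm_apply (𝕜 := ℝ) (m := (N, 0)) (le_refl N) (le_refl 0) f x
  rw [norm_iteratedFDeriv_zero] at this
  have hp : 0 < (1 + ‖x‖) ^ N := by positivity
  rw [← div_eq_mul_inv, le_div_iff₀ hp, mul_comm]
  linarith

theorem Decay.integrable {f : V → ℂ} (hf : Decay f) (hc : Continuous f) {α : Measure V} {N : ℕ}
    (hα : Integrable (fun x => ((1 + ‖x‖) ^ N)⁻¹) α) : Integrable f α := by
  obtain ⟨C, hC, H⟩ := hf N
  exact (hα.const_mul C).mono' hc.aestronglyMeasurable (.of_forall H)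

theorem decay_gauss : Decay (fun x : V => (gauss x : ℂ)) :=
  decay_schwartz (gaussComp (ContinuousLinearEquiv.refl ℝ V))

theorem peetre (ξ y : V) : (1 + ‖ξ - y‖)⁻¹ ≤ (1 + ‖y‖) * (1 + ‖ξ‖)⁻¹ := by
  have : ‖ξ‖ ≤ ‖ξ - y‖ + ‖y‖ := norm_le_norm_sub_add ξ y
  have h1 := norm_nonneg (ξ - y)
  have h2 := norm_nonneg y
  have h3 := norm_nonneg ξ
  rw [← div_eq_mul_inv, le_div_iff₀ (by positivity), inv_mul_le_iff₀ (by positivity)]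
  nlinarith

theorem Decay.sub_le {u : V → ℂ} (hu : Decay u) (N : ℕ) :
    ∃ C : ℝ, 0 < C ∧ ∀ ξ y, ‖u (ξ - y)‖ ≤ C * (1 + ‖y‖) ^ N * ((1 + ‖ξ‖) ^ N)⁻¹ := by
  obtain ⟨C, hC, H⟩ := hu N
  refine ⟨C, hC, fun ξ y => (H _).trans ?_⟩
  rw [mul_assoc, ← inv_pow, ← inv_pow, ← mul_pow]
  gcongr
  exact peetre ξ y

end Schwartz

section OneDim

theorem integrable_exp_mul {δ : ℝ → ℝ} (hc : Continuous δ) {C : ℝ} {N : ℕ} (hb : ∀ w, |δ w| ≤ C * (1 + |w|) ^ N) :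
    Integrable fun w : ℝ => Real.exp (-Real.pi * w ^ 2) * δ w := by
  obtain ⟨K, hK⟩ := exists_pow_mul_exp_le (N + 2)
  have hC : 0 ≤ C := by simpa using (abs_nonneg _).trans (hb 0)
  refine (integrable_inv_one_add_sq.const_mul (C * K)).mono' (by fun_prop) (.of_forall fun w => ?_)
  have h1 := hK |w| (abs_nonneg w)
  rw [sq_abs] at h1
  rw [norm_mul, Real.norm_of_nonneg (Real.exp_pos _).le, Real.norm_eq_abs, ← div_eq_mul_inv, le_div_iff₀ (by positivity)]
  have h2 : 1 + w ^ 2 ≤ (1 + |w|) ^ 2 := by rw [← sq_abs w]; nlinarith [abs_nonneg w]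
  calc _ ≤ Real.exp (-Real.pi * w ^ 2) * (C * (1 + |w|) ^ N) * (1 + |w|) ^ 2 := by
        gcongr
        exact hb w
    _ = C * ((1 + |w|) ^ (N + 2) * Real.exp (-Real.pi * w ^ 2)) := by rw [pow_add]; ring
    _ ≤ C * K := by gcongr

theorem eq_zero_of_gauss_integrals_real {δ : ℝ → ℝ} (hc : Continuous δ) (he : ∀ w, δ (-w) = δ w) {C : ℝ} {N : ℕ}
    (hb : ∀ w, |δ w| ≤ C * (1 + |w|) ^ N)
    (h : ∀ r : ℝ, 0 < r → ∫ w, Real.exp (-Real.pi * r * w ^ 2) * δ w = 0) (w₀ : ℝ) : δ w₀ = 0 := by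
  set E : ℝ → ℝ := fun w => Real.exp (-Real.pi * w ^ 2) with hE
  have hEc : Continuous E := by fun_prop
  have hE0 (w) : 0 < E w := Real.exp_pos _
  have hE1 (w) : E w ≤ 1 := Real.exp_le_one_iff.2 (by nlinarith [Real.pi_pos, sq_nonneg w])
  have hInt : Integrable fun w => E w * δ w := integrable_exp_mul hc hb
  have hInt' {f : ℝ → ℝ} (hf : Continuous f) : Integrable fun w => f (E w) * (E w * δ w) := by
    obtain ⟨B, hB⟩ := isCompact_Icc.exists_bound_of_continuousOn (s := Set.Icc (0 : ℝ) 1) hf.continuousOn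
    exact hInt.bdd_mul (c := B) (hf.comp hEc).aestronglyMeasurable (.of_forall fun w => hB _ ⟨(hE0 w).le, hE1 w⟩)
  have hpow (j : ℕ) : ∫ w, E w ^ j * (E w * δ w) = 0 := by
    rw [← h (j + 1) (by positivity)]
    refine integral_congr_ae (.of_forall fun w => ?_)
    simp only [hE]
    rw [← mul_assoc, ← pow_succ, ← Real.exp_nat_mul]
    congr 2; push_cast; ring
  have hpoly (p : Polynomial ℝ) : ∫ w, p.eval (E w) * (E w * δ w) = 0 := by
    simp only [Polynomial.eval_eq_sum_range, Finset.sum_mul]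
    rw [integral_finsetSum]
    · refine Finset.sum_eq_zero fun j _ => ?_
      simp only [mul_assoc]
      rw [integral_const_mul, hpow, mul_zero]
    · intro j _
      exact hInt' (f := fun t => p.coeff j * t ^ j) (by fun_prop)
  have hfun {f : ℝ → ℝ} (hf : Continuous f) : ∫ w, f (E w) * (E w * δ w) = 0 := by
    by_contra hne
    have hpos := abs_pos.2 hne
    set I := ∫ w, |E w * δ w|
    have hI : 0 ≤ I := integral_nonneg fun w => abs_nonneg _
    obtain ⟨p, hp⟩ := exists_polynomial_near_of_continuousOn 0 1 f hf.continuousOn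
      (|∫ w, f (E w) * (E w * δ w)| / (I + 1)) (by positivity)
    have h1 : |∫ w, f (E w) * (E w * δ w)| ≤ |∫ w, f (E w) * (E w * δ w)| / (I + 1) * I := by
      conv_lhs => rw [← sub_zero (∫ w, f (E w) * (E w * δ w)), ← hpoly p,
        ← integral_sub (hInt' hf) (hInt' p.continuous)]
      rw [← Real.norm_eq_abs, ← integral_const_mul]
      refine norm_integral_le_of_norm_le (hInt.abs.const_mul _) (.of_forall fun w => ?_)
      rw [← sub_mul, norm_mul, Real.norm_eq_abs, Real.norm_eq_abs, abs_sub_comm]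
      gcongr
      exact (hp _ ⟨(hE0 w).le, hE1 w⟩).le
    rw [div_mul_eq_mul_div, le_div_iff₀ (by positivity)] at h1
    nlinarith
  obtain ⟨c, hc0, hc1⟩ := exists_between (hE0 w₀)
  let f : ℝ → ℝ := fun t => δ √(-Real.log (max t c) / Real.pi) * max 0 (t - c)
  have hf : Continuous f := by
    have hl : Continuous fun t : ℝ => Real.log (max t c) :=
      Continuous.log (by fun_prop) fun t => (hc0.trans_le (le_max_right t c)).ne'
    exact (hc.comp (Real.continuous_sqrt.comp (hl.neg.div_const _))).mul (by fun_prop)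
  have hfE (w : ℝ) : f (E w) * (E w * δ w) = δ w ^ 2 * (max 0 (E w - c) * E w) := by
    simp only [f]
    rcases le_total (E w) c with h1 | h1
    · rw [max_eq_left (sub_nonpos.2 h1)]; ring
    · have : -Real.log (E w) / Real.pi = w ^ 2 := by
        simp only [hE, Real.log_exp]; field_simp
      rw [max_eq_left h1, this, Real.sqrt_sq_eq_abs]
      have : δ |w| = δ w := by rcases abs_choice w with h | h <;> rw [h]; exact he w
      rw [this]; ring
  have h0 := hfun hf
  simp only [hfE] at h0
  have hnn : 0 ≤ fun w => δ w ^ 2 * (max 0 (E w - c) * E w) := fun w => by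
    have := hE0 w
    positivity
  rw [integral_eq_zero_iff_of_nonneg hnn (by simpa only [hfE] using hInt' hf)] at h0
  have h2 := (Continuous.ae_eq_iff_eq volume (by fun_prop) continuous_zero).1 h0
  have h3 := congrFun h2 w₀
  have h4 : 0 < max 0 (E w₀ - c) * E w₀ := mul_pos (lt_max_of_lt_right (sub_pos.2 hc1)) (hE0 _)
  simpa [h4.ne'] using h3

theorem eq_zero_of_gauss_integrals {δ : ℝ → ℂ} (hc : Continuous δ) (he : ∀ w, δ (-w) = δ w) {C : ℝ} {N : ℕ}
    (hb : ∀ w, ‖δ w‖ ≤ C * (1 + |w|) ^ N)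
    (h : ∀ r : ℝ, 0 < r → ∫ w : ℝ, (Real.exp (-Real.pi * r * w ^ 2) : ℂ) * δ w = 0) (w : ℝ) : δ w = 0 := by
  have hInt {r : ℝ} (hr : 0 < r) : Integrable fun w : ℝ => (Real.exp (-Real.pi * r * w ^ 2) : ℂ) * δ w := by
    have h1 := integrable_exp_mul (δ := fun w => ‖δ (w / √r)‖) (C := C * (1 + (√r)⁻¹) ^ N) (N := N) (by fun_prop) fun w => by
      have h0 := (norm_nonneg _).trans (hb 0)
      have hC : 0 ≤ C := by simpa using h0
      rw [abs_norm]
      refine (hb _).trans ?_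
      rw [mul_assoc, ← mul_pow, abs_div, abs_of_nonneg (Real.sqrt_nonneg r)]
      gcongr
      rw [div_eq_mul_inv]
      have : 0 ≤ (√r)⁻¹ := by positivity
      nlinarith [abs_nonneg w]
    have hs : √r ≠ 0 := (Real.sqrt_pos.2 hr).ne'
    have h2 := h1.comp_mul_right' hs
    refine Integrable.mono' h2 (by fun_prop) (.of_forall fun w => ?_)
    rw [norm_mul, Complex.norm_real, Real.norm_of_nonneg (Real.exp_pos _).le, mul_div_cancel_right₀ _ hs, mul_pow, Real.sq_sqrt hr.le,
      mul_comm (w ^ 2), mul_assoc]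
  refine Complex.ext ?_ ?_
  · refine eq_zero_of_gauss_integrals_real (δ := fun w => (δ w).re) (by fun_prop) (fun w => by rw [he])
      (fun w => (Complex.abs_re_le_norm _).trans (hb w)) (fun r hr => ?_) w
    have := congrArg Complex.re (h r hr)
    rw [← Complex.reCLM_apply, ← ContinuousLinearMap.integral_comp_comm _ (hInt hr)] at this
    simpa only [Complex.reCLM_apply, Complex.re_ofReal_mul, Complex.zero_re] using this
  · refine eq_zero_of_gauss_integrals_real (δ := fun w => (δ w).im) (by fun_prop) (fun w => by rw [he])
      (fun w => (Complex.abs_im_le_norm _).trans (hb w)) (fun r hr => ?_) w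
    have := congrArg Complex.im (h r hr)
    rw [← Complex.imCLM_apply, ← ContinuousLinearMap.integral_comp_comm _ (hInt hr)] at this
    simpa only [Complex.imCLM_apply, Complex.im_ofReal_mul, Complex.zero_im] using this

end OneDim

section Superposition
variable {V : Type*} [NormedAddCommGroup V] [InnerProductSpace ℝ V] [FiniteDimensional ℝ V]
  [MeasurableSpace V] [BorelSpace V]

/-- The character `t ↦ exp (2πit)`, with complex values. -/
def ex (t : ℝ) : ℂ := (Real.fourierChar t : ℂ)

theorem norm_ex (t : ℝ) : ‖ex t‖ = 1 := Circle.norm_coe _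

theorem continuous_ex : Continuous ex := continuous_subtype_val.comp Real.continuous_fourierChar

theorem ex_add (s t : ℝ) : ex (s + t) = ex s * ex t := by
  simp [ex, AddChar.map_add_eq_mul]

theorem fourier_eq_ex (f : V → ℂ) (ξ : V) : 𝓕 f ξ = ∫ x, ex (-⟪x, ξ⟫) * f x := by
  rw [Real.fourier_eq]
  rfl

theorem fourierInv_eq_ex (f : V → ℂ) (x : V) : 𝓕⁻ f x = ∫ ξ, ex ⟪ξ, x⟫ * f ξ := by
  rw [Real.fourierInv_eq]
  rfl

variable {Ω : Type*} [TopologicalSpace Ω] [SecondCountableTopology Ω] [MeasurableSpace Ω] [BorelSpace Ω]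
  {ν : Measure Ω} [SFinite ν]

theorem integral_superposition {α : Measure V} [SFinite α] {g : V → ℂ} (hg : Continuous g) (hgi : Integrable g α)
    {ψ : Ω → ℂ} (hψ : Continuous ψ) (hψi : Integrable ψ ν) {y : Ω → V} (hy : Continuous y) :
    ∫ x, g x * (∫ ω, ψ ω * ex ⟪x, y ω⟫ ∂ν) ∂α = ∫ ω, ψ ω * (∫ x, g x * ex ⟪x, y ω⟫ ∂α) ∂ν := by
  simp only [← integral_const_mul]
  have hex := continuous_ex
  rw [integral_integral_swap]
  · refine integral_congr_ae (.of_forall fun ω => integral_congr_ae (.of_forall fun x => ?_))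
    ring
  · refine (hgi.norm.mul_prod hψi.norm).mono' ?_ (.of_forall fun p => ?_)
    · exact Continuous.aestronglyMeasurable (by unfold Function.uncurry; fun_prop)
    · simp [Function.uncurry, norm_ex]

theorem fourier_superposition {g : V → ℂ} (hg : Continuous g) (hgi : Integrable g)
    {ψ : Ω → ℂ} (hψ : Continuous ψ) (hψi : Integrable ψ ν) {y : Ω → V} (hy : Continuous y) (ξ : V) :
    𝓕 (fun x => g x * ∫ ω, ψ ω * ex ⟪x, y ω⟫ ∂ν) ξ = ∫ ω, ψ ω * 𝓕 g (ξ - y ω) ∂ν := by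
  have hex := continuous_ex
  have hc : Continuous fun x => ex (-⟪x, ξ⟫) * g x := by fun_prop
  have hi : Integrable fun x => ex (-⟪x, ξ⟫) * g x :=
    hgi.norm.mono' hc.aestronglyMeasurable (.of_forall fun x => by rw [norm_mul, norm_ex, one_mul])
  have := integral_superposition hc hi hψ hψi hy
  simp only [fourier_eq_ex, ← mul_assoc]
  rw [this]
  refine integral_congr_ae (.of_forall fun ω => ?_)
  refine congrArg (ψ ω * ·) (integral_congr_ae (.of_forall fun x => ?_))
  have : -⟪x, ξ - y ω⟫ = -⟪x, ξ⟫ + ⟪x, y ω⟫ := by rw [inner_sub_right]; ring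
  simp only [this, ex_add]
  ring

theorem integral_shift_superposition {β : Measure V} [SFinite β] {N : ℕ} (hβ : Integrable (fun x => ((1 + ‖x‖) ^ N)⁻¹) β)
    {u : V → ℂ} (hu : Continuous u) (hud : Decay u)
    {ψ : Ω → ℂ} (hψ : Continuous ψ) {y : Ω → V} (hy : Continuous y)
    (hψi : Integrable (fun ω => (1 + ‖y ω‖) ^ N * ‖ψ ω‖) ν) :
    ∫ ξ, (∫ ω, ψ ω * u (ξ - y ω) ∂ν) ∂β = ∫ ω, ψ ω * (∫ ξ, u (ξ - y ω) ∂β) ∂ν := by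
  obtain ⟨C, hC, H⟩ := hud.sub_le N
  simp only [← integral_const_mul]
  rw [integral_integral_swap]
  refine ((hβ.const_mul C).mul_prod hψi).mono' ?_ (.of_forall fun p => ?_)
  · exact Continuous.aestronglyMeasurable (by unfold Function.uncurry; fun_prop)
  · simp only [Function.uncurry, norm_mul]
    calc _ ≤ ‖ψ p.2‖ * (C * (1 + ‖y p.2‖) ^ N * ((1 + ‖p.1‖) ^ N)⁻¹) := by gcongr; exact H _ _
      _ = _ := by ring

theorem continuous_integral_ex {α : Measure V} {g : V → ℂ} (hg : Continuous g) (hgi : Integrable g α) :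
    Continuous fun y : V => ∫ x, g x * ex ⟪x, y⟫ ∂α := by
  have hex := continuous_ex
  refine continuous_of_dominated (bound := fun x => ‖g x‖) (fun y => ?_) (fun y => .of_forall fun x => ?_)
    hgi.norm (.of_forall fun x => by fun_prop)
  · exact Continuous.aestronglyMeasurable (by fun_prop)
  · rw [norm_mul, norm_ex, mul_one]

theorem norm_integral_shift_le {β : Measure V} {N : ℕ} (hβ : Integrable (fun x => ((1 + ‖x‖) ^ N)⁻¹) β)
    {u : V → ℂ} (hud : Decay u) : ∃ C : ℝ, ∀ y, ‖∫ ξ, u (ξ - y) ∂β‖ ≤ C * (1 + ‖y‖) ^ N := by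
  obtain ⟨C, hC, H⟩ := hud.sub_le N
  refine ⟨C * ∫ x, ((1 + ‖x‖) ^ N)⁻¹ ∂β, fun y => ?_⟩
  refine (norm_integral_le_of_norm_le (hβ.const_mul (C * (1 + ‖y‖) ^ N)) (.of_forall fun ξ => H ξ y)).trans (le_of_eq ?_)
  rw [integral_const_mul]; ring

theorem continuous_integral_shift {β : Measure V} {N : ℕ} (hβ : Integrable (fun x => ((1 + ‖x‖) ^ N)⁻¹) β)
    {u : V → ℂ} (hu : Continuous u) (hud : Decay u) : Continuous fun y : V => ∫ ξ, u (ξ - y) ∂β := by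
  obtain ⟨C, hC, H⟩ := hud.sub_le N
  refine continuous_iff_continuousAt.2 fun y₀ => ?_
  refine continuousAt_of_dominated (bound := fun ξ => C * (1 + (‖y₀‖ + 1)) ^ N * ((1 + ‖ξ‖) ^ N)⁻¹)
    (.of_forall fun y => Continuous.aestronglyMeasurable (by fun_prop)) ?_ (hβ.const_mul _)
    (.of_forall fun x => by fun_prop)
  filter_upwards [Metric.ball_mem_nhds y₀ one_pos] with y hy
  refine .of_forall fun ξ => (H ξ y).trans ?_
  have : ‖y‖ ≤ ‖y₀‖ + 1 := by
    rw [mem_ball_iff_norm] at hy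
    have := norm_le_norm_add_norm_sub' y y₀
    linarith
  gcongr

end Superposition

section Shear
variable {V : Type*} [NormedAddCommGroup V] [InnerProductSpace ℝ V] [FiniteDimensional ℝ V]

theorem exists_shear {s r : ℝ} (hs : 0 < s) (hr : 0 < r) {y : V} (hy : ‖y‖ = 1) :
    ∃ A : V ≃L[ℝ] V, ∀ x, ‖A x‖ ^ 2 = s ^ 2 * ‖x‖ ^ 2 + ⟪x, y⟫ ^ 2 / r := by
  let τ : ℝ := √(s ^ 2 + 1 / r) - s
  have hτ : 2 * s * τ + τ ^ 2 = 1 / r := by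
    have : √(s ^ 2 + 1 / r) ^ 2 = s ^ 2 + 1 / r := Real.sq_sqrt (by positivity)
    simp only [τ]; nlinarith
  let L : V →ₗ[ℝ] V := s • LinearMap.id + τ • ((innerₗ V y).smulRight y)
  have hL (x : V) : ‖L x‖ ^ 2 = s ^ 2 * ‖x‖ ^ 2 + ⟪x, y⟫ ^ 2 / r := by
    have : L x = s • x + (τ * ⟪x, y⟫) • y := by
      simp [L, smul_smul, real_inner_comm y x]
    rw [this, norm_add_sq_real, norm_smul, norm_smul, inner_smul_left, inner_smul_right, hy]
    simp only [mul_pow, Real.norm_eq_abs, sq_abs, conj_trivial]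
    rw [div_eq_mul_one_div, ← hτ]; ring
  have hinj : Function.Injective L := by
    rw [injective_iff_map_eq_zero]
    intro x hx
    have h1 := hL x
    rw [hx, norm_zero] at h1
    have h2 : 0 ≤ ⟪x, y⟫ ^ 2 / r := by positivity
    have h3 : s ^ 2 * ‖x‖ ^ 2 = 0 := le_antisymm (by linarith) (by positivity)
    simpa [hs.ne'] using h3
  exact ⟨(LinearEquiv.ofInjectiveEndo L hinj).toContinuousLinearEquiv, hL⟩

theorem integral_gauss_ex {r : ℝ} (hr : 0 < r) (t : ℝ) :
    ∫ w : ℝ, (Real.exp (-Real.pi * r * w ^ 2) : ℂ) * ex (w * t) = (1 / (r : ℂ) ^ (1 / 2 : ℂ)) * (Real.exp (-Real.pi * (t ^ 2 / r)) : ℝ) := by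
  have h := congrFun (fourier_gaussian_pi (b := (r : ℂ)) (by simpa using hr)) (-t)
  rw [fourier_eq_ex] at h
  have e : ∀ w : ℝ, (Real.exp (-Real.pi * r * w ^ 2) : ℂ) * ex (w * t) =
      ex (-⟪w, -t⟫) * Complex.exp (-Real.pi * r * w ^ 2) := fun w => by
    rw [inner_neg_right, neg_neg, mul_comm]
    simp [mul_comm]
  simp only [e]
  rw [h]
  congr 1
  rw [Complex.ofReal_exp]
  congr 1
  push_cast
  ring

theorem continuousLinearEquiv_smul {s : ℝ} (hs : s ≠ 0) : ∃ S S' : V ≃L[ℝ] V, Dual S S' ∧ (∀ x, S x = s • x) ∧ ∀ x, S' x = s⁻¹ • x := by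
  refine ⟨(LinearEquiv.smulOfNeZero ℝ V s hs).toContinuousLinearEquiv,
    (LinearEquiv.smulOfNeZero ℝ V s⁻¹ (inv_ne_zero hs)).toContinuousLinearEquiv, fun x y => ?_, fun x => rfl, fun x => rfl⟩
  change ⟪s • x, s⁻¹ • y⟫ = _
  rw [inner_smul_left, inner_smul_right, ← mul_assoc]
  simp [hs]

end Shear

section Extension
variable {V : Type*} [NormedAddCommGroup V] [InnerProductSpace ℝ V] [FiniteDimensional ℝ V]
  [MeasurableSpace V] [BorelSpace V] {α β : Measure V} [SFinite α] [SFinite β] [α.IsNegInvariant] [β.IsNegInvariant] {N : ℕ}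

theorem gaussComp_neg (A : V ≃L[ℝ] V) (x : V) : gaussComp A (-x) = gaussComp A x := by
  rw [gaussComp_apply, gaussComp_apply, map_neg, gauss_congr (W := V) (x := -(A x)) (y := A x) (norm_neg (A x))]

theorem fourier_gaussComp_neg (A : V ≃L[ℝ] V) (ξ : V) : 𝓕 (⇑(gaussComp A)) (-ξ) = 𝓕 (⇑(gaussComp A)) ξ := by
  obtain ⟨A', h⟩ := exists_dual A
  rw [fourier_gaussComp h, fourier_gaussComp h, map_neg, gauss_congr (W := V) (x := -(A' ξ)) (y := A' ξ) (norm_neg (A' ξ))]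

theorem integrable_pow_mul_exp {r : ℝ} (hr : 0 < r) (N : ℕ) :
    Integrable fun w : ℝ => (1 + |w|) ^ N * Real.exp (-Real.pi * r * w ^ 2) := by
  obtain ⟨S, S', -, hS, -⟩ := continuousLinearEquiv_smul (V := ℝ) (s := √r) (Real.sqrt_pos.2 hr).ne'
  obtain ⟨C, hC, H⟩ := decay_schwartz (gaussComp S) (N + 2)
  refine (integrable_inv_one_add_sq.const_mul C).mono' (by fun_prop) (.of_forall fun w => ?_)
  have h1 := H w
  have e : gauss (S w) = Real.exp (-Real.pi * r * w ^ 2) := by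
    rw [gauss, hS, norm_smul, mul_pow, Real.norm_eq_abs, Real.norm_eq_abs, sq_abs, sq_abs, Real.sq_sqrt hr.le, mul_assoc]
  rw [gaussComp_apply, Complex.norm_real, Real.norm_of_nonneg (gauss_pos _).le, e, Real.norm_eq_abs] at h1
  rw [Real.norm_of_nonneg (by positivity)]
  have h2 : 1 + w ^ 2 ≤ (1 + |w|) ^ 2 := by rw [← sq_abs w]; nlinarith [abs_nonneg w]
  calc _ ≤ (1 + |w|) ^ N * (C * ((1 + |w|) ^ (N + 2))⁻¹) := by gcongr
    _ = C * ((1 + |w|) ^ 2)⁻¹ := by rw [pow_add, mul_inv]; field_simp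
    _ ≤ C * (1 + w ^ 2)⁻¹ := by gcongr

theorem integral_shift_eq [Nontrivial V] (hα : Integrable (fun x => ((1 + ‖x‖) ^ N)⁻¹) α)
    (hβ : Integrable (fun x => ((1 + ‖x‖) ^ N)⁻¹) β)
    (H : ∀ A : V ≃L[ℝ] V, ∫ x, gaussComp A x ∂α = ∫ ξ, 𝓕 (⇑(gaussComp A)) ξ ∂β)
    {s : ℝ} (hs : 0 < s) {S : V ≃L[ℝ] V} (hS : ∀ x, S x = s • x) (y : V) :
    ∫ x, gaussComp S x * ex ⟪x, y⟫ ∂α = ∫ ξ, 𝓕 (⇑(gaussComp S)) (ξ - y) ∂β := by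
  have hg : Continuous (gaussComp S) := (gaussComp S).continuous
  have hgi : Integrable (gaussComp S) α := (decay_schwartz _).integrable hg hα
  have hgv : Integrable (gaussComp S) := (gaussComp S).integrable
  have hu : Continuous (𝓕 (⇑(gaussComp S))) := (𝓕 (gaussComp S)).continuous
  have hud : Decay (𝓕 (⇑(gaussComp S))) := decay_schwartz (𝓕 (gaussComp S))
  set h₁ : V → ℂ := fun y => ∫ x, gaussComp S x * ex ⟪x, y⟫ ∂α with hh₁
  set h₂ : V → ℂ := fun y => ∫ ξ, 𝓕 (⇑(gaussComp S)) (ξ - y) ∂β with hh₂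
  have c₁ : Continuous h₁ := continuous_integral_ex hg hgi
  have c₂ : Continuous h₂ := continuous_integral_shift hβ hu hud
  have e₁ (y) : h₁ (-y) = h₁ y := by
    simp only [hh₁]
    rw [← integral_neg_eq_self]
    simp only [gaussComp_neg, inner_neg_neg]
  have e₂ (y) : h₂ (-y) = h₂ y := by
    simp only [hh₂]
    rw [← integral_neg_eq_self]
    refine integral_congr_ae (.of_forall fun ξ => ?_)
    change 𝓕 (⇑(gaussComp S)) (-ξ - -y) = 𝓕 (⇑(gaussComp S)) (ξ - y)
    rw [← fourier_gaussComp_neg, neg_sub, sub_neg_eq_add, neg_add_eq_sub, ← fourier_gaussComp_neg, neg_sub]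
  suffices key : ∀ e : V, ‖e‖ = 1 → ∀ w : ℝ, h₁ (w • e) - h₂ (w • e) = 0 by
    obtain ⟨e, w, he, hw⟩ : ∃ (e : V) (w : ℝ), ‖e‖ = 1 ∧ w • e = y := by
      rcases eq_or_ne y 0 with rfl | hy
      · obtain ⟨e, he⟩ := NormedSpace.sphere_nonempty (E := V) (x := 0) (r := 1) |>.2 zero_le_one
        exact ⟨e, 0, by simpa using he, by simp⟩
      · exact ⟨‖y‖⁻¹ • y, ‖y‖, by simp [norm_smul, norm_ne_zero_iff.2 hy], by simp [smul_smul, norm_ne_zero_iff.2 hy]⟩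
    have := key e he w
    rw [hw] at this
    exact sub_eq_zero.1 this
  intro e he
  obtain ⟨C, hC⟩ := norm_integral_shift_le hβ hud
  refine eq_zero_of_gauss_integrals (δ := fun w : ℝ => h₁ (w • e) - h₂ (w • e)) (C := (∫ x, ‖gaussComp S x‖ ∂α) + C) (N := N)
    (by fun_prop) (fun w => by simp only [neg_smul, e₁, e₂]) (fun w => ?_) (fun r hr => ?_)
  · refine (norm_sub_le _ _).trans ?_
    rw [add_mul]
    have b₁ : ‖h₁ (w • e)‖ ≤ ∫ x, ‖gaussComp S x‖ ∂α :=
      norm_integral_le_of_norm_le hgi.norm (.of_forall fun x => by rw [norm_mul, norm_ex, mul_one])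
    have b₂ := hC (w • e)
    rw [norm_smul, he, mul_one, Real.norm_eq_abs] at b₂
    refine add_le_add (b₁.trans (le_mul_of_one_le_right (integral_nonneg fun x => norm_nonneg _) (one_le_pow₀ ?_))) b₂
    linarith [abs_nonneg w]
  · let ψ : ℝ → ℂ := fun w => (Real.exp (-Real.pi * r * w ^ 2) : ℂ)
    have hψ : Continuous ψ := by fun_prop
    have hyc : Continuous fun w : ℝ => w • e := by fun_prop
    have hψN (M : ℕ) : Integrable fun w : ℝ => (1 + ‖w • e‖) ^ M * ‖ψ w‖ := by
      refine (integrable_pow_mul_exp hr M).congr (.of_forall fun w => ?_)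
      simp only [ψ, norm_smul, he, mul_one, Real.norm_eq_abs, Complex.norm_real, abs_of_pos (Real.exp_pos _)]
    have hψi : Integrable ψ := by
      have := hψN 0
      simp only [pow_zero, one_mul] at this
      exact (integrable_norm_iff hψ.aestronglyMeasurable).1 this
    obtain ⟨A, hA⟩ := exists_shear hs hr he
    have hr' : (r : ℂ) ^ (1 / 2 : ℂ) ≠ 0 := by
      rw [Complex.cpow_ne_zero_iff]; left; exact_mod_cast hr.ne'
    have hΨ (x : V) : gaussComp S x * ∫ w, ψ w * ex ⟪x, w • e⟫ = 1 / (r : ℂ) ^ (1 / 2 : ℂ) * gaussComp A x := by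
      simp only [inner_smul_right, ψ]
      rw [integral_gauss_ex hr, gaussComp_apply, gaussComp_apply, mul_left_comm, ← Complex.ofReal_mul]
      congr 2
      rw [gauss, gauss, ← Real.exp_add, hA, hS, norm_smul, mul_pow, Real.norm_of_nonneg hs.le]
      ring_nf
    have s₁ := integral_superposition hg hgi hψ hψi hyc (α := α)
    have s₂ := integral_shift_superposition hβ hu hud hψ hyc (hψN N)
    simp only [← fourier_superposition hg hgv hψ hψi hyc] at s₂
    simp only [hΨ] at s₁ s₂
    have hF (ξ : V) : 𝓕 (fun x => 1 / (r : ℂ) ^ (1 / 2 : ℂ) * gaussComp A x) ξ = 1 / (r : ℂ) ^ (1 / 2 : ℂ) * 𝓕 (⇑(gaussComp A)) ξ := by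
      rw [fourier_eq_ex, fourier_eq_ex, ← integral_const_mul]
      refine integral_congr_ae (.of_forall fun x => ?_)
      ring
    simp only [hF, integral_const_mul, H A] at s₁ s₂
    have i₁ : Integrable fun w : ℝ => ψ w * h₁ (w • e) := by
      refine (hψi.norm.const_mul (∫ x, ‖gaussComp S x‖ ∂α)).mono' (by fun_prop) (.of_forall fun w => ?_)
      rw [norm_mul, mul_comm]
      gcongr
      exact norm_integral_le_of_norm_le hgi.norm (.of_forall fun x => by rw [norm_mul, norm_ex, mul_one])
    have i₂ : Integrable fun w : ℝ => ψ w * h₂ (w • e) := by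
      refine ((hψN N).const_mul C).mono' (by fun_prop) (.of_forall fun w => ?_)
      rw [norm_mul, mul_comm, ← mul_assoc]
      gcongr
      exact hC _
    simp only [mul_sub]
    rw [integral_sub i₁ i₂]
    exact sub_eq_zero.2 (s₁.symm.trans s₂)

theorem Decay.integrable_pow_mul {f : V → ℂ} (hf : Decay f) (hc : Continuous f) (N : ℕ) :
    Integrable fun x => (1 + ‖x‖) ^ N * ‖f x‖ := by
  obtain ⟨M, hM⟩ := (inferInstance : (volume : Measure V).HasTemperateGrowth).exists_integrable
  obtain ⟨C, hC, H⟩ := hf (N + M)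
  refine (hM.const_mul C).mono' (by fun_prop) (.of_forall fun x => ?_)
  have hx : 0 < 1 + ‖x‖ := by positivity
  rw [norm_mul, norm_norm, Real.norm_of_nonneg (by positivity), Real.rpow_neg hx.le, Real.rpow_natCast]
  calc _ ≤ (1 + ‖x‖) ^ N * (C * ((1 + ‖x‖) ^ (N + M))⁻¹) := by gcongr; exact H x
    _ = C * ((1 + ‖x‖) ^ M)⁻¹ := by rw [pow_add, mul_inv]; field_simp

theorem integral_shift_gauss {S S' : V ≃L[ℝ] V} (hS : Dual S S') (hSS : ∀ z, S (S' z) = z) (ψ : V → ℂ) (ξ : V) :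
    ∫ y, ψ y * 𝓕 (⇑(gaussComp S)) (ξ - y) = ∫ z, ψ (ξ - S z) * gauss z := by
  rw [← integral_sub_left_eq_self _ volume ξ]
  have h := integral_comp_equiv_complex S' (fun z => ψ (ξ - S z) * (gauss z : ℂ))
  simp only [hSS] at h
  have e : ∀ z, ψ (ξ - z) * 𝓕 (⇑(gaussComp S)) (ξ - (ξ - z)) =
      ((adet S)⁻¹ : ℝ) • (ψ (ξ - z) * (gauss (S' z) : ℂ)) := fun z => by
    rw [sub_sub_cancel, fourier_gaussComp hS, Complex.real_smul, Complex.ofReal_mul]; ring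
  simp only [e]
  rw [integral_smul, h, smul_smul, ← mul_inv, hS.adet_mul, inv_one, one_smul]

theorem integral_gauss_smul_mul [Nontrivial V] (hα : Integrable (fun x => ((1 + ‖x‖) ^ N)⁻¹) α)
    (hβ : Integrable (fun x => ((1 + ‖x‖) ^ N)⁻¹) β)
    (H : ∀ A : V ≃L[ℝ] V, ∫ x, gaussComp A x ∂α = ∫ ξ, 𝓕 (⇑(gaussComp A)) ξ ∂β)
    (φ : SchwartzMap V ℂ) {s : ℝ} (hs : 0 < s) :
    ∫ x, (gauss (s • x) : ℂ) * φ x ∂α = ∫ ξ, (∫ z, 𝓕 (⇑φ) (ξ - s • z) * gauss z) ∂β := by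
  obtain ⟨S, S', hd, hS, hS'⟩ := continuousLinearEquiv_smul (V := V) hs.ne'
  have hSS (z : V) : S (S' z) = z := by rw [hS, hS', smul_smul, mul_inv_cancel₀ hs.ne', one_smul]
  have hg : Continuous (gaussComp S) := (gaussComp S).continuous
  have hgi : Integrable (gaussComp S) α := (decay_schwartz _).integrable hg hα
  have hu : Continuous (𝓕 (⇑(gaussComp S))) := (𝓕 (gaussComp S)).continuous
  have hud : Decay (𝓕 (⇑(gaussComp S))) := decay_schwartz (𝓕 (gaussComp S))
  have hψ : Continuous (𝓕 (⇑φ)) := (𝓕 φ).continuous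
  have hψd : Decay (𝓕 (⇑φ)) := decay_schwartz (𝓕 φ)
  have hψi : Integrable (𝓕 (⇑φ)) := (𝓕 φ).integrable
  have hφ (x : V) : φ x = ∫ ω, 𝓕 (⇑φ) ω * ex ⟪x, ω⟫ := by
    have h := congrFun (φ.continuous.fourierInv_fourier_eq φ.integrable hψi) x
    rw [fourierInv_eq_ex] at h
    rw [← h]
    refine integral_congr_ae (.of_forall fun ω => ?_)
    change ex ⟪ω, x⟫ * 𝓕 (⇑φ) ω = 𝓕 (⇑φ) ω * ex ⟪x, ω⟫
    rw [mul_comm, real_inner_comm]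
  have s₁ := integral_superposition hg hgi hψ hψi (y := id) continuous_id (α := α)
  have s₂ := integral_shift_superposition hβ hu hud hψ (y := id) continuous_id (hψd.integrable_pow_mul hψ N)
  simp only [id] at s₁ s₂
  simp only [← hφ, integral_shift_eq hα hβ H hs hS] at s₁
  simp only [integral_shift_gauss hd hSS, hS] at s₂
  simp only [gaussComp_apply, hS] at s₁
  exact s₁.trans s₂.symm

theorem integral_eq_integral_fourier [Nontrivial V] (hα : Integrable (fun x => ((1 + ‖x‖) ^ N)⁻¹) α)
    (hβ : Integrable (fun x => ((1 + ‖x‖) ^ N)⁻¹) β)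
    (H : ∀ A : V ≃L[ℝ] V, ∫ x, gaussComp A x ∂α = ∫ ξ, 𝓕 (⇑(gaussComp A)) ξ ∂β)
    (φ : SchwartzMap V ℂ) : ∫ x, φ x ∂α = ∫ ξ, 𝓕 (⇑φ) ξ ∂β := by
  have hψ : Continuous (𝓕 (⇑φ)) := (𝓕 φ).continuous
  have hψd : Decay (𝓕 (⇑φ)) := decay_schwartz (𝓕 φ)
  have hgc : Continuous (gauss : V → ℝ) := continuous_gauss
  have hφi : Integrable φ α := (decay_schwartz φ).integrable φ.continuous hα
  have hgi : Integrable (fun z : V => (1 + ‖z‖) ^ N * ‖(gauss z : ℂ)‖) :=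
    decay_gauss.integrable_pow_mul (by fun_prop) N
  have hg0 : Integrable (fun z : V => (gauss z : ℂ)) :=
    (gaussComp (ContinuousLinearEquiv.refl ℝ V)).integrable
  let s : ℕ → ℝ := fun j => 1 / ((j : ℝ) + 1)
  have hs (j) : 0 < s j := Nat.one_div_pos_of_nat
  have hs1 (j) : s j ≤ 1 := by
    rw [div_le_one (by positivity)]; linarith [Nat.cast_nonneg (α := ℝ) j]
  have hs0 : Filter.Tendsto s Filter.atTop (nhds 0) := tendsto_one_div_add_atTop_nhds_zero_nat
  have hsv (x : V) : Filter.Tendsto (fun j => s j • x) Filter.atTop (nhds 0) := by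
    simpa using hs0.smul_const x
  obtain ⟨C, hC, hCb⟩ := hψd.sub_le N
  have l₁ : Filter.Tendsto (fun j => ∫ x, (gauss (s j • x) : ℂ) * φ x ∂α) Filter.atTop (nhds (∫ x, φ x ∂α)) := by
    refine tendsto_integral_of_dominated_convergence (fun x => ‖φ x‖) (fun j => ?_) hφi.norm (fun j => .of_forall fun x => ?_)
      (.of_forall fun x => ?_)
    · have := φ.continuous
      exact Continuous.aestronglyMeasurable (by fun_prop)
    · rw [norm_mul, Complex.norm_real, Real.norm_of_nonneg (gauss_pos _).le]
      exact mul_le_of_le_one_left (norm_nonneg _) (gauss_le_one _)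
    · have h : Filter.Tendsto (fun j => (gauss (s j • x) : ℂ) * φ x) Filter.atTop (nhds ((gauss (0 : V) : ℂ) * φ x)) :=
        ((Complex.continuous_ofReal.comp hgc).continuousAt.tendsto.comp (hsv x)).mul_const _
      simpa [gauss] using h
  have hin (ξ z : V) {t : ℝ} (ht : 0 < t) (ht1 : t ≤ 1) : ‖𝓕 (⇑φ) (ξ - t • z) * gauss z‖ ≤
      C * ((1 + ‖ξ‖) ^ N)⁻¹ * ((1 + ‖z‖) ^ N * ‖(gauss z : ℂ)‖) := by
    rw [norm_mul]
    have h1 : ‖t • z‖ ≤ ‖z‖ := by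
      rw [norm_smul, Real.norm_of_nonneg ht.le]; exact mul_le_of_le_one_left (norm_nonneg _) ht1
    calc _ ≤ (C * (1 + ‖t • z‖) ^ N * ((1 + ‖ξ‖) ^ N)⁻¹) * ‖(gauss z : ℂ)‖ := by gcongr; exact hCb _ _
      _ ≤ (C * (1 + ‖z‖) ^ N * ((1 + ‖ξ‖) ^ N)⁻¹) * ‖(gauss z : ℂ)‖ := by gcongr
      _ = _ := by ring
  have l₂ : Filter.Tendsto (fun j => ∫ ξ, (∫ z, 𝓕 (⇑φ) (ξ - s j • z) * gauss z) ∂β) Filter.atTop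
      (nhds (∫ ξ, 𝓕 (⇑φ) ξ ∂β)) := by
    refine tendsto_integral_of_dominated_convergence
      (fun ξ => (C * ∫ z : V, (1 + ‖z‖) ^ N * ‖(gauss z : ℂ)‖) * ((1 + ‖ξ‖) ^ N)⁻¹) (fun j => ?_) (hβ.const_mul _)
      (fun j => .of_forall fun ξ => ?_) (.of_forall fun ξ => ?_)
    · refine Continuous.aestronglyMeasurable ?_
      refine continuous_of_dominated (bound := fun z => C * ((1 + ‖z‖) ^ N * ‖(gauss z : ℂ)‖))
        (fun ξ => Continuous.aestronglyMeasurable (by fun_prop)) (fun ξ => .of_forall fun z => ?_) (hgi.const_mul _)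
        (.of_forall fun z => by fun_prop)
      refine (hin ξ z (hs j) (hs1 j)).trans ?_
      gcongr
      exact mul_le_of_le_one_right hC.le (inv_le_one_of_one_le₀ (one_le_pow₀ (by linarith [norm_nonneg ξ])))
    · refine (norm_integral_le_of_norm_le (hgi.const_mul (C * ((1 + ‖ξ‖) ^ N)⁻¹)) (.of_forall fun z => hin ξ z (hs j) (hs1 j))).trans (le_of_eq ?_)
      rw [integral_const_mul]; ring
    · have e : 𝓕 (⇑φ) ξ = ∫ z : V, 𝓕 (⇑φ) ξ * (gauss z : ℂ) := by
        rw [integral_const_mul, integral_complex_ofReal, integral_gauss, Complex.ofReal_one, mul_one]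
      rw [e]
      refine tendsto_integral_of_dominated_convergence (fun z => C * ((1 + ‖ξ‖) ^ N)⁻¹ * ((1 + ‖z‖) ^ N * ‖(gauss z : ℂ)‖))
        (fun j => Continuous.aestronglyMeasurable (by fun_prop)) (hgi.const_mul _)
        (fun j => .of_forall fun z => hin ξ z (hs j) (hs1 j)) (.of_forall fun z => ?_)
      refine Filter.Tendsto.mul_const _ ?_
      refine hψ.continuousAt.tendsto.comp ?_
      simpa using tendsto_const_nhds.sub (hsv z)
  refine tendsto_nhds_unique l₁ ?_
  simp only [integral_gauss_smul_mul hα hβ H φ (hs _)]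
  exact l₂

end Extension

section Line
variable {G : Type*} [AddCommGroup G] [MeasurableSpace G] [MeasurableNeg G]

theorem isNegInvariant_withDensity {ν : Measure G} [ν.IsNegInvariant] {f : G → ℝ≥0∞}
    (he : ∀ x, f (-x) = f x) : (ν.withDensity f).IsNegInvariant := by
  refine ⟨Measure.ext fun s hs => ?_⟩
  change Measure.map Neg.neg (ν.withDensity f) s = _
  have hs' : MeasurableSet (Neg.neg ⁻¹' s : Set G) := measurable_neg hs
  rw [Measure.map_apply measurable_neg hs, withDensity_apply _ hs', withDensity_apply _ hs,
    ← lintegral_indicator hs', ← lintegral_indicator hs, ← lintegral_neg_eq_self]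
  refine lintegral_congr fun x => ?_
  by_cases hx : x ∈ s
  · rw [Set.indicator_of_mem hx, Set.indicator_of_mem (by simpa using hx), he]
  · rw [Set.indicator_of_notMem hx, Set.indicator_of_notMem (by simpa using hx)]

/-- The measure `|t|^{k-1} dt` on the line. -/
def rho (k : ℕ) : Measure ℝ := volume.withDensity fun t => ENNReal.ofReal (|t| ^ (k - 1))

instance (k : ℕ) : SFinite (rho k) := by unfold rho; infer_instance

instance (k : ℕ) : (rho k).IsNegInvariant := isNegInvariant_withDensity fun t => by rw [abs_neg]

theorem integral_rho (k : ℕ) {E : Type*} [NormedAddCommGroup E] [NormedSpace ℝ E] (f : ℝ → E) :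
    ∫ t, f t ∂(rho k) = ∫ t : ℝ, |t| ^ (k - 1) • f t := by
  rw [rho, integral_withDensity_eq_integral_toReal_smul (by fun_prop) (.of_forall fun _ => ENNReal.ofReal_lt_top)]
  simp only [ENNReal.toReal_ofReal (pow_nonneg (abs_nonneg _) _)]

theorem integrable_rho {k : ℕ} {E : Type*} [NormedAddCommGroup E] [NormedSpace ℝ E] {f : ℝ → E} :
    Integrable f (rho k) ↔ Integrable fun t : ℝ => |t| ^ (k - 1) • f t := by
  rw [rho, integrable_withDensity_iff_integrable_smul' (by fun_prop) (.of_forall fun _ => ENNReal.ofReal_lt_top)]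
  simp only [ENNReal.toReal_ofReal (pow_nonneg (abs_nonneg _) _)]

theorem integrable_rho_decay {k N : ℕ} (hk : 1 ≤ k) (hN : k + 1 ≤ N) : Integrable (fun t : ℝ => ((1 + |t|) ^ N)⁻¹) (rho k) := by
  rw [integrable_rho]
  refine integrable_inv_one_add_sq.mono' ?_ (.of_forall fun t => ?_)
  · exact (by fun_prop : Measurable fun t : ℝ => |t| ^ (k - 1) • ((1 + |t|) ^ N)⁻¹).aestronglyMeasurable
  have h0 := abs_nonneg t
  rw [smul_eq_mul, Real.norm_of_nonneg (by positivity)]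
  calc |t| ^ (k - 1) * ((1 + |t|) ^ N)⁻¹ ≤ (1 + |t|) ^ (N - 2) * ((1 + |t|) ^ N)⁻¹ := by
        gcongr ?_ * _
        exact (pow_le_pow_left₀ h0 (by linarith) _).trans (pow_le_pow_right₀ (by linarith) (by omega))
    _ = ((1 + |t|) ^ 2)⁻¹ := by
        rcases N with _ | _ | N
        · omega
        · omega
        · rw [show N + 1 + 1 = N + 2 from rfl, Nat.add_sub_cancel, pow_add _ N 2, mul_inv]; field_simp
    _ ≤ (1 + t ^ 2)⁻¹ := by
        gcongr
        rw [← sq_abs t]; nlinarith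

/-- The Gaussian moment `∫ |t|^{k-1} exp (-π t ^ 2) dt`. -/
def lineConst (k : ℕ) : ℝ := ∫ t, Real.exp (-Real.pi * t ^ 2) ∂(rho k)

theorem integrable_rho_exp (k : ℕ) : Integrable (fun t => Real.exp (-Real.pi * t ^ 2)) (rho k) := by
  rw [integrable_rho]
  refine (integrable_pow_mul_exp one_pos (k - 1)).mono' (by fun_prop) (.of_forall fun t => ?_)
  rw [smul_eq_mul, Real.norm_of_nonneg (by positivity), mul_one]
  gcongr
  linarith

theorem lineConst_pos (k : ℕ) : 0 < lineConst k := by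
  have hi := integrable_rho.1 (integrable_rho_exp k)
  rw [lineConst, integral_rho, integral_pos_iff_support_of_nonneg (fun t => by positivity) hi]
  have h1 : ({0}ᶜ : Set ℝ) ⊆ Function.support fun t : ℝ => |t| ^ (k - 1) • Real.exp (-Real.pi * t ^ 2) := fun t ht => by
    have : |t| ≠ 0 := abs_ne_zero.2 ht
    simp [this, Real.exp_ne_zero]
  exact (isOpen_compl_singleton.measure_pos _ ⟨1, by simp⟩).trans_le (measure_mono h1)

theorem integral_rho_exp {k : ℕ} (hk : 1 ≤ k) {c : ℝ} (hc : 0 < c) :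
    ∫ t, Real.exp (-Real.pi * (t * c) ^ 2) ∂(rho k) = lineConst k * (c ^ k)⁻¹ := by
  have h := Measure.integral_comp_mul_right (fun t : ℝ => |t| ^ (k - 1) • Real.exp (-Real.pi * t ^ 2)) c
  rw [lineConst, integral_rho, integral_rho]
  simp only [abs_mul, abs_of_pos hc, mul_pow |_|, smul_eq_mul, abs_of_pos (inv_pos.2 hc)] at h ⊢
  obtain ⟨j, rfl⟩ : ∃ j, k = j + 1 := ⟨k - 1, by omega⟩
  simp only [Nat.add_sub_cancel, mul_right_comm _ (c ^ j), integral_mul_const] at h ⊢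
  rw [pow_succ, mul_inv, mul_comm (c ^ j)⁻¹, ← mul_assoc, mul_comm _ c⁻¹, ← h, mul_assoc, mul_inv_cancel₀ (by positivity), mul_one]

end Line

section LineMeas
variable {V : Type*} [NormedAddCommGroup V] [InnerProductSpace ℝ V] [FiniteDimensional ℝ V]
  [MeasurableSpace V] [BorelSpace V] {k : ℕ} (μ : Measure (sphere (0 : V) 1)) [IsFiniteMeasure μ]

/-- The superposition of the measures `|t|^{k-1} dt` on lines. -/
def lineMeas (k : ℕ) : Measure V := (μ.prod (rho k)).map fun p => p.2 • (p.1 : V)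

instance : SFinite (lineMeas μ k) := by unfold lineMeas; infer_instance

theorem measurable_line : Measurable fun p : sphere (0 : V) 1 × ℝ => p.2 • (p.1 : V) :=
  Continuous.measurable (by fun_prop)

instance : (lineMeas μ k).IsNegInvariant := by
  refine ⟨?_⟩
  change Measure.map Neg.neg (lineMeas μ k) = _
  rw [lineMeas, Measure.map_map measurable_neg measurable_line]
  have h := (MeasurePreserving.id μ).prod (Measure.measurePreserving_neg (rho k))
  nth_rw 2 [← h.map_eq]
  rw [Measure.map_map measurable_line h.measurable]
  congr 1
  ext p
  simp

theorem integrable_lineMeas (hk : 1 ≤ k) {N : ℕ} (hN : k + 1 ≤ N) : Integrable (fun x : V => ((1 + ‖x‖) ^ N)⁻¹) (lineMeas μ k) := by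
  have hc : Continuous fun x : V => ((1 + ‖x‖) ^ N)⁻¹ :=
    Continuous.inv₀ (by fun_prop) fun t => by positivity
  rw [lineMeas, integrable_map_measure hc.aestronglyMeasurable measurable_line.aemeasurable]
  refine ((integrable_rho_decay hk hN).comp_snd μ).congr (.of_forall fun p => ?_)
  simp [norm_smul]

theorem integral_lineMeas {f : V → ℂ} (hf : Continuous f) (hi : Integrable f (lineMeas μ k)) :
    ∫ x, f x ∂(lineMeas μ k) = ∫ θ : sphere (0 : V) 1, (∫ t, f (t • (θ : V)) ∂(rho k)) ∂μ := by
  rw [lineMeas, integrable_map_measure hf.aestronglyMeasurable measurable_line.aemeasurable] at hi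
  rw [lineMeas, integral_map measurable_line.aemeasurable hf.aestronglyMeasurable]
  exact integral_prod _ hi

theorem integral_line_gauss (hk : 1 ≤ k) (A : V ≃L[ℝ] V) (θ : sphere (0 : V) 1) :
    ∫ t, gauss (A (t • (θ : V))) ∂(rho k) = lineConst k * (‖A θ‖ ^ k)⁻¹ := by
  have hθ : (θ : V) ≠ 0 := ne_zero_of_mem_unit_sphere θ
  rw [← integral_rho_exp hk (norm_pos_iff.2 ((map_ne_zero_iff A A.injective).2 hθ))]
  refine integral_congr_ae (.of_forall fun t => ?_)
  simp only [gauss, map_smul, norm_smul, mul_pow, Real.norm_eq_abs, sq_abs]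

end LineMeas

section Main
variable {V : Type*} [NormedAddCommGroup V] [InnerProductSpace ℝ V] [FiniteDimensional ℝ V]
  [MeasurableSpace V] [BorelSpace V] {k : ℕ} {F : V → ℝ}

theorem integrable_decay_mono {α : Measure V} {M N : ℕ} (hMN : M ≤ N)
    (h : Integrable (fun x => ((1 + ‖x‖) ^ M)⁻¹) α) : Integrable (fun x : V => ((1 + ‖x‖) ^ N)⁻¹) α := by
  refine h.mono' (by fun_prop : Measurable fun x : V => ((1 + ‖x‖) ^ N)⁻¹).aestronglyMeasurable (.of_forall fun x => ?_)
  have : (1 : ℝ) ≤ 1 + ‖x‖ := by linarith [norm_nonneg x]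
  rw [Real.norm_of_nonneg (by positivity)]
  gcongr

theorem integral_withDensity_ofReal (hF : PosHom k F) (hk : 1 ≤ k) (f : V → ℂ) :
    ∫ x, f x ∂(volume.withDensity fun x => ENNReal.ofReal (F x)) = ∫ x, F x • f x := by
  rw [integral_withDensity_eq_integral_toReal_smul hF.measurable.ennreal_ofReal (.of_forall fun _ => ENNReal.ofReal_lt_top)]
  simp only [ENNReal.toReal_ofReal (hF.nonneg hk _)]

theorem PosHom.exists_integrable_decay (hF : PosHom k F) (hk : 1 ≤ k) (hkV : k < finrank ℝ V) :
    ∃ N : ℕ, Integrable (fun x => ((1 + ‖x‖) ^ N)⁻¹) (volume.withDensity fun x => ENNReal.ofReal (F x)) := by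
  obtain ⟨M, hM⟩ := (inferInstance : (volume : Measure V).HasTemperateGrowth).exists_integrable
  refine ⟨M, (integrable_withDensity_iff_integrable_smul' hF.measurable.ennreal_ofReal
    (.of_forall fun _ => ENNReal.ofReal_lt_top)).2 ?_⟩
  simp only [ENNReal.toReal_ofReal (hF.nonneg hk _), smul_eq_mul]
  refine hF.integrable_mul hk hkV (hM.congr (.of_forall fun x => ?_)) (M := 1) fun x => ?_
  · change (1 + ‖x‖) ^ (-(M : ℝ)) = _
    rw [Real.rpow_neg (by positivity), Real.rpow_natCast]
  · rw [abs_of_nonneg (by positivity)]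
    exact inv_le_one_of_one_le₀ (one_le_pow₀ (by linarith [norm_nonneg x]))

theorem integral_fourier_gaussComp_line (hk : 1 ≤ k) {A A' : V ≃L[ℝ] V} (h : Dual A A') (θ : sphere (0 : V) 1) :
    ∫ t, 𝓕 (⇑(gaussComp A)) (t • (θ : V)) ∂(rho k) =
      (((adet A)⁻¹ * (lineConst k * (‖A' θ‖ ^ k)⁻¹) : ℝ) : ℂ) := by
  simp only [fourier_gaussComp h]
  rw [integral_complex_ofReal, integral_const_mul, integral_line_gauss hk]

theorem GaussRep.integral_eq (hk : 1 ≤ k) (hkV : k < finrank ℝ V) (hF : PosHom k F) (he : ∀ x, F (-x) = F x)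
    {μ : Measure (sphere (0 : V) 1)} [IsFiniteMeasure μ] (h : GaussRep k F μ) (φ : SchwartzMap V ℂ) :
    ∫ x, F x • φ x = ∫ θ : sphere (0 : V) 1, (∫ t : ℝ, |t| ^ (k - 1) • 𝓕 (⇑φ) (t • (θ : V)))
      ∂(ENNReal.ofReal (lineConst k)⁻¹ • μ) := by
  have : Nontrivial V := finrank_pos_iff (R := ℝ).1 (by omega)
  have hc := lineConst_pos k
  set c := ENNReal.ofReal (lineConst k)⁻¹
  have : IsFiniteMeasure (c • μ) := Measure.smul_finite μ ENNReal.ofReal_ne_top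
  obtain ⟨N, hN⟩ := hF.exists_integrable_decay hk hkV
  have hα := integrable_decay_mono (Nat.le_add_right N (k + 1)) hN
  have hβ := integrable_lineMeas (c • μ) hk (Nat.le_add_left (k + 1) N)
  have : (volume.withDensity fun x => ENNReal.ofReal (F x)).IsNegInvariant :=
    isNegInvariant_withDensity fun x => by rw [he]
  have hline (ψ : SchwartzMap V ℂ) : ∫ ξ, 𝓕 (⇑ψ) ξ ∂(lineMeas (c • μ) k) =
      ∫ θ : sphere (0 : V) 1, (∫ t, 𝓕 (⇑ψ) (t • (θ : V)) ∂(rho k)) ∂(c • μ) := by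
    have hψ : Continuous (𝓕 (⇑ψ)) := (𝓕 ψ).continuous
    have hψd : Decay (𝓕 (⇑ψ)) := decay_schwartz (𝓕 ψ)
    exact integral_lineMeas _ hψ (hψd.integrable hψ hβ)
  have key := integral_eq_integral_fourier hα hβ (fun A => ?_) φ
  · rw [hline, integral_withDensity_ofReal hF hk] at key
    simp only [integral_rho] at key
    exact key
  · obtain ⟨A', hA⟩ := exists_dual A
    have hA0 := adet_pos A
    rw [hline, integral_withDensity_ofReal hF hk]
    simp only [integral_fourier_gaussComp_line hk hA, gaussComp_apply, Complex.real_smul, ← Complex.ofReal_mul]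
    rw [integral_complex_ofReal, integral_complex_ofReal, integral_smul_measure, integral_const_mul, integral_const_mul,
      ← h A A' hA, ENNReal.toReal_ofReal (by positivity), smul_eq_mul]
    congr 1
    field_simp

theorem gaussRep_of_integral_eq (hk : 1 ≤ k) {μ : Measure (sphere (0 : V) 1)}
    (h : ∀ φ : SchwartzMap V ℂ, (∀ x, φ (-x) = φ x) → ∫ x, F x • φ x =
      ∫ θ : sphere (0 : V) 1, (∫ t : ℝ, |t| ^ (k - 1) • 𝓕 (⇑φ) (t • (θ : V))) ∂μ) :
    GaussRep k F (ENNReal.ofReal (lineConst k) • μ) := fun A A' hA => by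
  have hA0 := adet_pos A
  have hc := lineConst_pos k
  have := h (gaussComp A) (gaussComp_neg A)
  have hl (θ : sphere (0 : V) 1) := (integral_rho k _).symm.trans (integral_fourier_gaussComp_line hk hA θ)
  simp only [hl] at this
  simp only [gaussComp_apply, Complex.real_smul,
    ← Complex.ofReal_mul] at this
  rw [integral_complex_ofReal, integral_complex_ofReal, Complex.ofReal_inj, integral_const_mul, integral_const_mul] at this
  rw [this, integral_smul_measure, ENNReal.toReal_ofReal hc.le, smul_eq_mul]
  field_simp

theorem embedsInLNeg_gauge_iff {n : ℕ} (hk : 1 ≤ k) (D : Set (Euc n)) :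
    EmbedsInLNeg n k (gauge D) ↔ ∃ μ : Measure (sphere (0 : Euc n) 1), IsFiniteMeasure μ ∧
      ∀ φ : SchwartzMap (Euc n) ℂ, (∀ x, φ (-x) = φ x) → ∫ x, (radialFn D x ^ k) • φ x =
        ∫ θ : sphere (0 : Euc n) 1, (∫ t : ℝ, |t| ^ (k - 1) • 𝓕 (⇑φ) (t • (θ : Euc n))) ∂μ := by
  have e₁ (x : Euc n) : gauge D x ^ (-(k : ℝ)) = radialFn D x ^ k := by
    rw [Real.rpow_neg (gauge_nonneg x), Real.rpow_natCast, radialFn, inv_pow]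
  have e₂ (t : ℝ) : |t| ^ ((k : ℝ) - 1) = |t| ^ (k - 1) := by
    rw [← Nat.cast_one, ← Nat.cast_sub hk, Real.rpow_natCast]
  simp only [EmbedsInLNeg, e₁, e₂]

theorem radialFn_neg {n : ℕ} {D : Set (Euc n)} (hsym : D = -D) (x : Euc n) : radialFn D (-x) = radialFn D x := by
  rw [radialFn, radialFn, gauge_neg fun y hy => by rw [hsym] at hy; exact hy]

end Main

end KInt

/-- **`k`-intersection bodies are exactly the unit balls of spaces embedding in `L_{-k}`.** -/
theorem kIntBody_iff_embeds_Lneg (n k : ℕ) (hk : 1 ≤ k) (hkn : k < n)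
    (D : Set (Euc n)) (hD : IsStarBody D) (hsym : D = -D) :
    IsKIntBody n k D ↔ EmbedsInLNeg n (k : ℝ) (gauge D) := by
  have hV : finrank ℝ (Euc n) = n := finrank_euclideanSpace_fin
  rw [KInt.isKIntBody_iff_gaussRep hk hkn hD, KInt.embedsInLNeg_gauge_iff hk]
  constructor
  · rintro ⟨μ, hμ, h⟩
    exact ⟨_, Measure.smul_finite μ ENNReal.ofReal_ne_top, fun φ _ =>
      h.integral_eq hk (by omega) (hD.posHom k) (fun x => by rw [KInt.radialFn_neg hsym]) φ⟩
  · rintro ⟨μ, hμ, h⟩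
    exact ⟨_, Measure.smul_finite μ ENNReal.ofReal_ne_top, KInt.gaussRep_of_integral_eq hk h⟩

end
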